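/- Let A be an analytic subset of SB such that every Y ∈ A is non-universal and has a Schauder basis. Then there exists a non-universal Banach space Z, with a Schauder basis, that contains every Y ∈ A as a complemented subspace (i.e. every Y ∈ A is isomorphic to a complemented subspace of Z). -/

import Mathlib

open Filter Topology MeasureTheory

noncomputable section

/-! ### The Cantor set and the space `C(2^ℕ)` -/

/-- The Cantor set `2^ℕ`. -/
abbrev CantorSet : Type := ℕ → Bool

/-- The Banach space `C(2^ℕ)` of continuous real-valued functions on the Cantor set. -/
abbrev CantorC : Type := C(CantorSet, ℝ)

/-! ### The standard Borel space `SB` of separable Banach spaces -/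

/-- `SB`: the set of closed linear subspaces of `C(2^ℕ)`. -/
def SB : Type := {Y : Submodule ℝ CantorC // IsClosed (Y : Set CantorC)}

/-- The Effros-Borel σ-algebra on `SB`, generated by the sets
`{Y : Y ∩ U ≠ ∅}` for `U` open in `C(2^ℕ)`. -/
instance : MeasurableSpace SB :=
  MeasurableSpace.generateFrom
    {A : Set SB | ∃ U : Set CantorC, IsOpen U ∧ A = {Y : SB | ((Y.1 : Set CantorC) ∩ U).Nonempty}}

/-- A subset of a standard Borel space is analytic if it is the image of a Borel map
from the Baire space `ℕ^ℕ`. -/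
def IsAnalyticIn {α : Type*} [MeasurableSpace α] (A : Set α) : Prop :=
  ∃ f : (ℕ → ℕ) → α, Measurable f ∧ A = Set.range f

/-! ### Embeddings, isomorphisms, universality -/

/-- `X` embeds isomorphically into `Y`: there is a bounded linear map which is
bounded below, i.e. an isomorphism onto its range. -/
def Embeds (X Y : Type*) [SeminormedAddCommGroup X] [NormedSpace ℝ X]
    [SeminormedAddCommGroup Y] [NormedSpace ℝ Y] : Prop :=
  ∃ (T : X →L[ℝ] Y) (c : ℝ), 0 < c ∧ ∀ x : X, c * ‖x‖ ≤ ‖T x‖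

/-- `X` embeds isometrically into `Y` (i.e. `Y` contains an isometric copy of `X`). -/
def EmbedsIsometrically (X Y : Type*) [SeminormedAddCommGroup X] [NormedSpace ℝ X]
    [SeminormedAddCommGroup Y] [NormedSpace ℝ Y] : Prop :=
  Nonempty (X →ₗᵢ[ℝ] Y)

/-- `X` and `Y` are isomorphic Banach spaces (linearly homeomorphic). -/
def IsomorphicTo (X Y : Type*) [SeminormedAddCommGroup X] [NormedSpace ℝ X]
    [SeminormedAddCommGroup Y] [NormedSpace ℝ Y] : Prop :=
  Nonempty (X ≃L[ℝ] Y)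

/-- The class `NU ⊆ SB` of non-universal spaces: those `X ∈ SB` which do not contain
an isomorphic copy of `C(2^ℕ)` (equivalently, are not universal for all separable
Banach spaces). -/
def NU : Set SB := {Y : SB | ¬ Embeds CantorC Y.1}

/-- The class `NC_X ⊆ SB` of all `Y ∈ SB` containing no isomorphic copy of `X`. -/
def NCin (X : Type*) [SeminormedAddCommGroup X] [NormedSpace ℝ X] : Set SB :=
  {Y : SB | ¬ Embeds X Y.1}

/-! ### Schauder bases -/

/-- `x` is a Schauder basis of `E`: every vector has a unique representation as a
norm convergent series `Σ aₙ • xₙ`. -/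
def IsSchauderBasis {E : Type*} [SeminormedAddCommGroup E] [NormedSpace ℝ E]
    (x : ℕ → E) : Prop :=
  ∀ y : E, ∃! a : ℕ → ℝ,
    Tendsto (fun m => ∑ n ∈ Finset.range m, a n • x n) atTop (𝓝 y)

/-- `E` has a Schauder basis. -/
def HasSchauderBasis (E : Type*) [SeminormedAddCommGroup E] [NormedSpace ℝ E] : Prop :=
  ∃ x : ℕ → E, IsSchauderBasis x

/-- `x` is a monotone basis sequence: initial-segment projections have norm at most 1. -/
def IsMonotoneSeq {E : Type*} [SeminormedAddCommGroup E] [NormedSpace ℝ E]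
    (x : ℕ → E) : Prop :=
  ∀ (a : ℕ → ℝ) (k m : ℕ), k ≤ m →
    ‖∑ n ∈ Finset.range k, a n • x n‖ ≤ ‖∑ n ∈ Finset.range m, a n • x n‖

/-- `x` is a bi-monotone sequence: interval projections have norm at most 1. -/
def IsBimonotoneSeq {E : Type*} [SeminormedAddCommGroup E] [NormedSpace ℝ E]
    (x : ℕ → E) : Prop :=
  ∀ (a : ℕ → ℝ) (j k m : ℕ), j ≤ k → k ≤ m →
    ‖∑ n ∈ Finset.Ico j k, a n • x n‖ ≤ ‖∑ n ∈ Finset.range m, a n • x n‖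

/-- `x` is a Schauder basic sequence: it is a Schauder basis of its closed linear span. -/
def IsSchauderBasicSeq {E : Type*} [NormedAddCommGroup E] [NormedSpace ℝ E]
    (x : ℕ → E) : Prop :=
  ∀ y ∈ (Submodule.span ℝ (Set.range x)).topologicalClosure,
    ∃! a : ℕ → ℝ,
      Tendsto (fun m => ∑ n ∈ Finset.range m, a n • x n) atTop (𝓝 y)

/-! ### Trees, ordinal ranks and Bourgain's index -/

/-- A tree on `Λ`: a set of finite sequences closed under initial segments. -/
def IsTree {Λ : Type*} (T : Set (List Λ)) : Prop :=
  ∀ s t : List Λ, s <+: t → t ∈ T → s ∈ T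

/-- A pruned tree: every node has a proper extension in the tree. -/
def IsPruned {Λ : Type*} (T : Set (List Λ)) : Prop :=
  ∀ t ∈ T, ∃ a : Λ, t ++ [a] ∈ T

/-- `σ` is an infinite branch of `T`. -/
def IsBranch {Λ : Type*} (T : Set (List Λ)) (σ : ℕ → Λ) : Prop :=
  ∀ n : ℕ, (List.ofFn fun i : Fin n => σ i) ∈ T

/-- `T` is ill-founded: it has an infinite branch. -/
def TreeIllFounded {Λ : Type*} (T : Set (List Λ)) : Prop :=
  ∃ σ : ℕ → Λ, IsBranch T σ

/-- The derivative of a tree: its non-maximal nodes, i.e. nodes having a proper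
extension in the tree. -/
def treeDeriv {Λ : Type*} (T : Set (List Λ)) : Set (List Λ) :=
  {l | l ∈ T ∧ ∃ a : Λ, l ++ [a] ∈ T}

/-- The iterated derivatives `T^(ξ)` of a tree, defined by transfinite recursion. -/
def treeDerivIter {Λ : Type*} (T : Set (List Λ)) (ξ : Ordinal.{0}) : Set (List Λ) :=
  Ordinal.limitRecOn ξ T (fun _ S => treeDeriv S)
    (fun o _ ih => ⋂ (o' : Ordinal.{0}) (h : o' < o), ih o' h)

/-- The ordinal rank `o(T)` of a (well-founded) tree: the least `ξ` with `T^(ξ) = ∅`. -/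
def treeRank {Λ : Type*} (T : Set (List Λ)) : Ordinal.{0} :=
  sInf {ξ : Ordinal.{0} | treeDerivIter T ξ = ∅}

/-- The first uncountable ordinal `ω₁`. -/
def omega1 : Ordinal.{0} := (Cardinal.aleph 1).ord

/-- Bourgain's tree `T(Y, (e_n), δ)`: all finite sequences `(y_0, …, y_k)` in `Y`
which are `δ`-equivalent to `(e_0, …, e_k)`. -/
def bourgainTree {W : Type*} [SeminormedAddCommGroup W] [NormedSpace ℝ W] (e : ℕ → W)
    (δ : ℝ) (Y : Type*) [SeminormedAddCommGroup Y] [NormedSpace ℝ Y] : Set (List Y) :=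
  {l : List Y | ∀ a : ℕ → ℝ,
    δ * ‖∑ i ∈ Finset.range l.length, a i • e i‖ ≤
        ‖∑ i ∈ Finset.range l.length, a i • l.getD i 0‖ ∧
    ‖∑ i ∈ Finset.range l.length, a i • l.getD i 0‖ ≤
        δ⁻¹ * ‖∑ i ∈ Finset.range l.length, a i • e i‖}

open Classical in
/-- Bourgain's ordinal index of `Y` relative to a (normalized Schauder) basis `(e_n)`
of a space `W`: it equals `ω₁` if some tree `T(Y, (e_n), δ)` is ill-founded, and
otherwise `sup_{0 < δ ≤ 1} o(T(Y, (e_n), δ))`.  With `W = C(2^ℕ)` this is `φ_NU`,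
and with `W = Z` it is `φ_{NC_Z}`. -/
def bourgainIndex {W : Type*} [SeminormedAddCommGroup W] [NormedSpace ℝ W] (e : ℕ → W)
    (Y : Type*) [SeminormedAddCommGroup Y] [NormedSpace ℝ Y] : Ordinal.{0} :=
  if ∃ δ ∈ Set.Ioc (0:ℝ) 1, TreeIllFounded (bourgainTree e δ Y) then omega1
  else ⨆ δ : Set.Ioc (0:ℝ) 1, treeRank (bourgainTree e δ.1 Y)

/-! ### The Schur property and the Radon-Nikodym property -/

/-- `X` has the Schur property: weakly convergent sequences are norm convergent. -/
def HasSchurProperty (X : Type*) [SeminormedAddCommGroup X] [NormedSpace ℝ X] : Prop :=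
  ∀ (f : ℕ → X) (x : X),
    (∀ φ : X →L[ℝ] ℝ, Tendsto (fun n => φ (f n)) atTop (𝓝 (φ x))) →
    Tendsto f atTop (𝓝 x)

/-- `X` has the Radon-Nikodym property: on every finite measure space, every
`X`-valued vector measure of bounded variation which is absolutely continuous
with respect to the measure has a Bochner-integrable density. -/
def HasRNP (X : Type*) [NormedAddCommGroup X] [NormedSpace ℝ X] : Prop :=
  ∀ (Ω : Type) [MeasurableSpace Ω] (μ : Measure Ω), IsFiniteMeasure μ →
    ∀ τ : VectorMeasure Ω X,
      (∀ s : Set Ω, MeasurableSet s → μ s = 0 → τ s = 0) →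
      (∃ C : ℝ, ∀ P : Finset (Set Ω), (∀ s ∈ P, MeasurableSet s) →
        ((P : Set (Set Ω)).Pairwise fun s t => Disjoint s t) →
        ∑ s ∈ P, ‖τ s‖ ≤ C) →
      ∃ g : Ω → X, Integrable g μ ∧
        ∀ s : Set Ω, MeasurableSet s → τ s = ∫ x in s, g x ∂μ

/-! ### `𝓛_{∞,λ}`-spaces -/

/-- The Banach-Mazur distance from `G` to `ℓ∞^n` is at most `θ`, witnessed by an
isomorphism `e` with `‖e‖ ⬝ ‖e⁻¹‖ ≤ θ'` for every `θ' > θ`. -/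
def BMdistToLinftyLE (G : Type*) [SeminormedAddCommGroup G] [NormedSpace ℝ G]
    (n : ℕ) (θ : ℝ) : Prop :=
  ∀ θ' : ℝ, θ < θ' → ∃ e : G ≃L[ℝ] (Fin n → ℝ),
    ‖(e : G →L[ℝ] (Fin n → ℝ))‖ * ‖(e.symm : (Fin n → ℝ) →L[ℝ] G)‖ ≤ θ'

/-- `X` is an (infinite-dimensional) `𝓛_{∞,λ}`-space: every finite-dimensional subspace
`F` of `X` is contained in a finite-dimensional subspace `G` with `d(G, ℓ∞^(dim G)) ≤ λ`. -/
def IsLinftyLam (lam : ℝ) (X : Type*) [NormedAddCommGroup X] [NormedSpace ℝ X] : Prop :=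
  (¬ FiniteDimensional ℝ X) ∧
  ∀ F : Submodule ℝ X, FiniteDimensional ℝ F →
    ∃ G : Submodule ℝ X, F ≤ G ∧ FiniteDimensional ℝ G ∧
      BMdistToLinftyLE G (Module.finrank ℝ G) lam

/-- `X` is an `𝓛_{∞,λ+}`-space: it is an `𝓛_{∞,θ}`-space for every `θ > λ`. -/
def IsLinftyPlus (lam : ℝ) (X : Type*) [NormedAddCommGroup X] [NormedSpace ℝ X] : Prop :=
  ∀ θ : ℝ, lam < θ → IsLinftyLam θ X

/-! ### Minimal spaces and `ℓ₁` -/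

/-- The space `ℓ₁`. -/
abbrev EllOne : Type := lp (fun _ : ℕ => ℝ) 1

/-- `X` is a minimal Banach space: it is infinite-dimensional and embeds isomorphically
into every infinite-dimensional (closed) subspace of itself. -/
def IsMinimal (X : Type*) [NormedAddCommGroup X] [NormedSpace ℝ X] : Prop :=
  (¬ FiniteDimensional ℝ X) ∧
  ∀ Z : Submodule ℝ X, IsClosed (Z : Set X) → ¬ FiniteDimensional ℝ Z → Embeds X Z

end

/-! ### Part 0: Schauder basis preliminaries -/

section SchauderPrelim

set_option linter.unusedSectionVars false

variable {E : Type*} [NormedAddCommGroup E] [NormedSpace ℝ E]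

/-- Convergent sequences of partial sums along `x`. -/
def convSums (x : ℕ → E) : Submodule ℝ C(OnePoint ℕ, E) where
  carrier := {s | s ((0 : ℕ) : OnePoint ℕ) = 0 ∧
    ∀ n : ℕ, s ((n + 1 : ℕ) : OnePoint ℕ) - s ((n : ℕ) : OnePoint ℕ) ∈ Submodule.span ℝ {x n}}
  zero_mem' := by simp
  add_mem' := by
    rintro s t ⟨hs0, hs⟩ ⟨ht0, ht⟩
    refine ⟨by simp [hs0, ht0], fun n => ?_⟩
    have := Submodule.add_mem _ (hs n) (ht n)
    convert this using 1
    simp only [ContinuousMap.add_apply]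
    abel
  smul_mem' := by
    rintro c s ⟨hs0, hs⟩
    refine ⟨by simp [hs0], fun n => ?_⟩
    have := Submodule.smul_mem _ c (hs n)
    convert this using 1
    simp only [ContinuousMap.smul_apply, smul_sub]

theorem convSums_closed (x : ℕ → E) : IsClosed (convSums x : Set C(OnePoint ℕ, E)) := by
  have : (convSums x : Set C(OnePoint ℕ, E)) = {s | s ((0 : ℕ) : OnePoint ℕ) = 0} ∩
      ⋂ n : ℕ, {s | s ((n + 1 : ℕ) : OnePoint ℕ) - s ((n : ℕ) : OnePoint ℕ) ∈
        (Submodule.span ℝ {x n} : Set E)} := by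
    ext s
    simp [convSums]
  rw [this]
  refine IsClosed.inter ?_ (isClosed_iInter fun n => ?_)
  · exact isClosed_eq (by fun_prop) continuous_const
  · exact IsClosed.preimage (by fun_prop) (Submodule.closed_of_finiteDimensional _)

theorem convSums_repr {x : ℕ → E} {s : C(OnePoint ℕ, E)} (hs : s ∈ convSums x) :
    ∃ a : ℕ → ℝ, (∀ n : ℕ, s (n : OnePoint ℕ) = ∑ i ∈ Finset.range n, a i • x i) := by
  have h2 := hs.2
  simp only [Submodule.mem_span_singleton] at h2
  choose a ha using h2
  refine ⟨a, fun n => ?_⟩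
  induction n with
  | zero => simpa using hs.1
  | succ n ih =>
    rw [Finset.sum_range_succ, ha n, ← ih]
    abel

theorem convSums_tendsto (s : C(OnePoint ℕ, E)) :
    Tendsto (fun n : ℕ => s (n : OnePoint ℕ)) atTop (𝓝 (s OnePoint.infty)) := by
  have h := OnePoint.continuous_iff_from_nat (f := s)
  exact h.1 s.continuous

theorem convSums_mk {x : ℕ → E} (a : ℕ → ℝ) {y : E}
    (h : Tendsto (fun m => ∑ n ∈ Finset.range m, a n • x n) atTop (𝓝 y)) :
    ∃ s ∈ convSums x, (∀ n : ℕ, s (n : OnePoint ℕ) = ∑ i ∈ Finset.range n, a i • x i) ∧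
      s OnePoint.infty = y := by
  refine ⟨OnePoint.continuousMapMkNat _ y h, ⟨?_, fun n => ?_⟩, fun n => ?_, ?_⟩
  · change ∑ i ∈ Finset.range 0, a i • x i = 0
    simp
  · change ∑ i ∈ Finset.range (n + 1), a i • x i - ∑ i ∈ Finset.range n, a i • x i ∈ _
    simp [Finset.sum_range_succ, Submodule.mem_span_singleton]
  · rfl
  · rfl

theorem schauder_ne_zero {x : ℕ → E} (hx : IsSchauderBasis x) (n : ℕ) : x n ≠ 0 := by
  intro h
  obtain ⟨a, ha, hu⟩ := hx 0
  have h1 := hu (fun _ => 0) (by simp)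
  have h2 := hu (Pi.single n 1) (by
    have : ∀ m, ∑ i ∈ Finset.range m, (Pi.single n (1:ℝ) : ℕ → ℝ) i • x i = 0 := by
      intro m
      refine Finset.sum_eq_zero fun i _ => ?_
      by_cases hi : i = n
      · subst hi; simp [h]
      · simp [hi]
    simp only [this]; exact tendsto_const_nhds)
  have := congrFun (h1.trans h2.symm) n
  simp at this

theorem schauder_const [CompleteSpace E] {x : ℕ → E} (hx : IsSchauderBasis x) :
    ∃ K : ℝ, ∀ (a : ℕ → ℝ) (n m : ℕ), n ≤ m →
      ‖∑ i ∈ Finset.range n, a i • x i‖ ≤ K * ‖∑ i ∈ Finset.range m, a i • x i‖ := by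
  have : CompleteSpace (convSums x) := (convSums_closed x).completeSpace_coe
  let L : convSums x →L[ℝ] E :=
    (ContinuousMap.evalCLM ℝ (OnePoint.infty : OnePoint ℕ)).comp (convSums x).subtypeL
  have hL : ∀ s : convSums x, L s = s.1 OnePoint.infty := fun s => rfl
  have hker : L.ker = ⊥ := by
    refine LinearMap.ker_eq_bot'.2 fun s hs => ?_
    have hs' : s.1 OnePoint.infty = 0 := hs
    obtain ⟨a, ha⟩ := convSums_repr s.2
    have ht := convSums_tendsto s.1
    rw [hs'] at ht
    simp only [ha] at ht
    have h0 := (hx 0).unique ht (y₂ := fun _ => 0) (by simp)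
    ext p
    induction p using OnePoint.rec with
    | infty => simpa using hs'
    | coe n => simp [ha, h0]
  have hran : L.range = ⊤ := by
    refine LinearMap.range_eq_top.2 fun y => ?_
    obtain ⟨a, ha, -⟩ := hx y
    obtain ⟨s, hs, -, h2⟩ := convSums_mk a ha
    exact ⟨⟨s, hs⟩, h2⟩
  let e := ContinuousLinearEquiv.ofBijective L hker hran
  refine ⟨‖(e.symm : E →L[ℝ] convSums x)‖, fun a n m hnm => ?_⟩
  let b : ℕ → ℝ := fun i => if i < m then a i else 0
  have hb : ∀ k, m ≤ k → ∑ i ∈ Finset.range k, b i • x i = ∑ i ∈ Finset.range m, a i • x i := by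
    intro k hk
    rw [← Finset.sum_subset (Finset.range_mono hk)]
    · refine Finset.sum_congr rfl fun i hi => ?_
      simp only [Finset.mem_range] at hi
      simp [b, hi]
    · intro i _ hi
      simp only [Finset.mem_range] at hi
      simp [b, hi]
  have hb' : ∑ i ∈ Finset.range n, b i • x i = ∑ i ∈ Finset.range n, a i • x i := by
    refine Finset.sum_congr rfl fun i hi => ?_
    simp only [Finset.mem_range] at hi
    simp [b, lt_of_lt_of_le hi hnm]
  obtain ⟨s, hs, h1, h2⟩ := convSums_mk (x := x) b (y := ∑ i ∈ Finset.range m, a i • x i)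
    (tendsto_atTop_of_eventually_const (i₀ := m) hb)
  have h3 : e.symm (∑ i ∈ Finset.range m, a i • x i) = ⟨s, hs⟩ := by
    rw [ContinuousLinearEquiv.symm_apply_eq]
    exact h2.symm
  have h4 := (e.symm : E →L[ℝ] convSums x).le_opNorm (∑ i ∈ Finset.range m, a i • x i)
  have h5 : ‖s‖ ≤ ‖(e.symm : E →L[ℝ] convSums x)‖ * ‖∑ i ∈ Finset.range m, a i • x i‖ := by
    have : (e.symm : E →L[ℝ] convSums x) (∑ i ∈ Finset.range m, a i • x i) = ⟨s, hs⟩ := h3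
    rw [this] at h4
    exact h4
  rw [← hb', ← h1]
  exact (s.norm_coe_le_norm _).trans h5

theorem schauder_of_const [CompleteSpace E] {x : ℕ → E} {K : ℝ} (hx : ∀ n, x n ≠ 0)
    (hK : ∀ (a : ℕ → ℝ) (n m : ℕ), n ≤ m →
      ‖∑ i ∈ Finset.range n, a i • x i‖ ≤ K * ‖∑ i ∈ Finset.range m, a i • x i‖)
    (X : Submodule ℝ E) (hX : X = (Submodule.span ℝ (Set.range x)).topologicalClosure) :
    HasSchauderBasis X := by
  have : CompleteSpace (convSums x) := (convSums_closed x).completeSpace_coe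
  have hmem : ∀ n, x n ∈ X := fun n => by
    rw [hX]
    exact Submodule.le_topologicalClosure _ (Submodule.subset_span ⟨n, rfl⟩)
  let L : convSums x →L[ℝ] E :=
    (ContinuousMap.evalCLM ℝ (OnePoint.infty : OnePoint ℕ)).comp (convSums x).subtypeL
  have hL : ∀ s : convSums x, L s = s.1 OnePoint.infty := fun s => rfl
  have hbd : ∀ s ∈ convSums x, ∀ n : ℕ, ‖s (n : OnePoint ℕ)‖ ≤ K * ‖s OnePoint.infty‖ := by
    intro s hs n
    obtain ⟨a, ha⟩ := convSums_repr hs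
    have ht := (convSums_tendsto s).norm.const_mul K
    refine ge_of_tendsto ht ?_
    filter_upwards [eventually_ge_atTop n] with m hm
    rw [ha, ha]
    exact hK a n m hm
  have hbd2 : ∀ s ∈ convSums x, ‖s‖ ≤ max K 1 * ‖s OnePoint.infty‖ := by
    intro s hs
    refine (ContinuousMap.norm_le _ (by positivity)).2 fun p => ?_
    induction p using OnePoint.rec with
    | infty =>
      have : (1 : ℝ) ≤ max K 1 := le_max_right _ _
      nlinarith [norm_nonneg (s OnePoint.infty)]
    | coe n =>
      exact (hbd s hs n).trans (mul_le_mul_of_nonneg_right (le_max_left _ _) (norm_nonneg _))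
  have hanti : AntilipschitzWith (max K 1).toNNReal L := by
    refine L.antilipschitz_of_bound fun s => ?_
    rw [Real.coe_toNNReal _ (by positivity)]
    exact hbd2 s.1 s.2
  have hclosed : IsClosed (Set.range L) := hanti.isClosed_range L.uniformContinuous
  have hsub : ∀ y ∈ X, ∃ s : convSums x, L s = y := by
    have h1 : Submodule.span ℝ (Set.range x) ≤ LinearMap.range L.toLinearMap := by
      rw [Submodule.span_le]
      rintro _ ⟨n, rfl⟩
      obtain ⟨s, hs, -, h2⟩ := convSums_mk (x := x) (Pi.single n 1) (y := x n) (by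
        refine tendsto_atTop_of_eventually_const (i₀ := n + 1) fun k hk => ?_
        rw [Finset.sum_eq_single n]
        · simp
        · intro b _ hb
          simp [hb]
        · intro h
          exact absurd (Finset.mem_range.2 hk) h)
      exact ⟨⟨s, hs⟩, h2⟩
    have h2 := Submodule.topologicalClosure_minimal _ h1 hclosed
    intro y hy
    rw [hX] at hy
    exact h2 hy
  refine ⟨fun n => ⟨x n, hmem n⟩, fun y => ?_⟩
  have hco : ∀ (a : ℕ → ℝ), Tendsto (fun m => ∑ n ∈ Finset.range m, a n • (⟨x n, hmem n⟩ : X))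
      atTop (𝓝 y) ↔ Tendsto (fun m => ∑ n ∈ Finset.range m, a n • x n) atTop (𝓝 (y : E)) := by
    intro a
    rw [tendsto_subtype_rng]
    simp
  simp only [hco]
  obtain ⟨s, hs⟩ := hsub y.1 y.2
  obtain ⟨a, ha⟩ := convSums_repr s.2
  have hta : Tendsto (fun m => ∑ n ∈ Finset.range m, a n • x n) atTop (𝓝 (y : E)) := by
    have := convSums_tendsto s.1
    simp only [ha] at this
    rwa [← hL, hs] at this
  refine ⟨a, hta, fun b hb => ?_⟩
  have hd : Tendsto (fun m => ∑ n ∈ Finset.range m, (b n - a n) • x n) atTop (𝓝 (0 : E)) := by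
    have := hb.sub hta
    simpa [sub_smul] using this
  obtain ⟨t, ht, h1, h2⟩ := convSums_mk (x := x) (fun n => b n - a n) hd
  have h3 : ∀ n : ℕ, ∑ i ∈ Finset.range n, (b i - a i) • x i = 0 := by
    intro n
    have := hbd t ht n
    rw [h2, h1] at this
    simpa using this
  funext n
  have h4 := h3 (n + 1)
  rw [Finset.sum_range_succ, h3 n, zero_add] at h4
  rcases smul_eq_zero.1 h4 with h5 | h5
  · linarith
  · exact absurd h5 (hx n)

variable {F : Type*} [NormedAddCommGroup F] [NormedSpace ℝ F]

theorem ext_map [CompleteSpace F] {x : ℕ → E} (X : Submodule ℝ E)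
    (hX : X = (Submodule.span ℝ (Set.range x)).topologicalClosure) (hmem : ∀ i, x i ∈ X)
    (v : ℕ → F) (C : ℝ)
    (h : ∀ a : ℕ →₀ ℝ, ‖Finsupp.linearCombination ℝ v a‖ ≤
      C * ‖Finsupp.linearCombination ℝ x a‖) :
    ∃ T : X →L[ℝ] F, (∀ i, T ⟨x i, hmem i⟩ = v i) ∧ ∀ y, ‖T y‖ ≤ C * ‖y‖ := by
  let e : (ℕ →₀ ℝ) →ₗ[ℝ] X := Finsupp.linearCombination ℝ (fun i => (⟨x i, hmem i⟩ : X))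
  have he : ∀ a, (e a : E) = Finsupp.linearCombination ℝ x a := by
    intro a
    simp [e, Finsupp.linearCombination_apply, Finsupp.sum]
  have hden : DenseRange e := by
    intro y
    rw [Topology.IsInducing.subtypeVal.closure_eq_preimage_closure_image]
    rw [Set.mem_preimage]
    have hy : (y : E) ∈ (Submodule.span ℝ (Set.range x)).topologicalClosure := hX ▸ y.2
    rw [← SetLike.mem_coe, Submodule.topologicalClosure_coe] at hy
    convert hy using 2
    ext z
    rw [SetLike.mem_coe, Finsupp.mem_span_range_iff_exists_finsupp]
    constructor
    · rintro ⟨_, ⟨a, rfl⟩, rfl⟩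
      exact ⟨a, (he a).symm ▸ rfl⟩
    · rintro ⟨a, ha⟩
      exact ⟨e a, ⟨a, rfl⟩, (he a).trans ha⟩
  have hnorm : ∀ a, ‖Finsupp.linearCombination ℝ v a‖ ≤ C * ‖e a‖ := fun a => by
    have := h a
    rwa [← he a] at this
  refine ⟨(Finsupp.linearCombination ℝ v).extendOfNorm e, fun i => ?_, fun y => ?_⟩
  · have h1 := LinearMap.extendOfNorm_eq (f := Finsupp.linearCombination ℝ v) hden ⟨C, hnorm⟩
      (Finsupp.single i 1)
    simpa [e] using h1
  · exact LinearMap.norm_extendOfNorm_apply_le hden C hnorm y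

theorem ext_eq {G : Type*} [NormedAddCommGroup G] [NormedSpace ℝ G] {x : ℕ → E} (X : Submodule ℝ E)
    (hX : X = (Submodule.span ℝ (Set.range x)).topologicalClosure) (hmem : ∀ i, x i ∈ X)
    {S T : X →L[ℝ] G} (h : ∀ i, S ⟨x i, hmem i⟩ = T ⟨x i, hmem i⟩) : S = T := by
  have hk : IsClosed {y : X | S y = T y} := isClosed_eq S.continuous T.continuous
  let D : Submodule ℝ E := (LinearMap.eqLocus S.toLinearMap T.toLinearMap).map X.subtype
  have hXc : IsClosed (X : Set E) := hX ▸ Submodule.isClosed_topologicalClosure _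
  have hDc : IsClosed (D : Set E) := by
    have : (D : Set E) = Subtype.val '' {y : X | S y = T y} := by
      ext z; simp [D, LinearMap.mem_eqLocus]
    rw [this]
    exact hXc.isClosedEmbedding_subtypeVal.isClosedMap _ hk
  have h1 : Submodule.span ℝ (Set.range x) ≤ D := by
    rw [Submodule.span_le]
    rintro _ ⟨i, rfl⟩
    exact ⟨⟨x i, hmem i⟩, h i, rfl⟩
  have h2 := Submodule.topologicalClosure_minimal _ h1 hDc
  ext y
  obtain ⟨y', hy', he⟩ := h2 (hX ▸ y.2 : (y : E) ∈ _)
  have : y' = y := Subtype.ext he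
  subst this
  exact hy'

end SchauderPrelim

/-! ### Coding of the tree of finite sequences by natural numbers -/

/-- Code of the node `(σ 0, …, σ n)`. -/
def tc (σ : ℕ → ℕ) : ℕ → ℕ
  | 0 => Nat.pair 0 (σ 0)
  | n + 1 => Nat.pair (tc σ n + 1) (σ (n + 1))

theorem tc_lt_succ (σ : ℕ → ℕ) (n : ℕ) : tc σ n < tc σ (n + 1) :=
  Nat.lt_of_lt_of_le (Nat.lt_succ_self _) (Nat.left_le_pair _ _)

theorem tc_strictMono (σ : ℕ → ℕ) : StrictMono (tc σ) := strictMono_nat_of_lt_succ (tc_lt_succ σ)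

theorem tc_congr {σ τ : ℕ → ℕ} {n : ℕ} (h : ∀ i ≤ n, σ i = τ i) : tc σ n = tc τ n := by
  induction n with
  | zero => simp [tc, h 0 le_rfl]
  | succ n ih =>
    rw [tc, tc, ih fun i hi => h i (by omega), h (n + 1) le_rfl]

theorem tc_inj {σ τ : ℕ → ℕ} {n m : ℕ} (h : tc σ n = tc τ m) :
    n = m ∧ ∀ i ≤ n, σ i = τ i := by
  induction n generalizing m with
  | zero =>
    cases m with
    | zero =>
      simp only [tc, Nat.pair_eq_pair] at h
      refine ⟨rfl, fun i hi => ?_⟩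
      obtain rfl : i = 0 := by omega
      exact h.2
    | succ m =>
      simp only [tc, Nat.pair_eq_pair] at h
      omega
  | succ n ih =>
    cases m with
    | zero =>
      simp only [tc, Nat.pair_eq_pair] at h
      omega
    | succ m =>
      simp only [tc, Nat.pair_eq_pair] at h
      obtain ⟨h1, h2⟩ := ih (m := m) (by omega)
      refine ⟨by omega, fun i hi => ?_⟩
      rcases Nat.lt_or_ge n i with h3 | h3
      · obtain rfl : i = n + 1 := by omega
        rw [h.2, h1]
      · exact h2 i h3

theorem tc_surj (k : ℕ) : ∃ (σ : ℕ → ℕ) (n : ℕ), tc σ n = k := by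
  induction k using Nat.strong_induction_on with
  | _ k ih =>
    rcases hk : Nat.unpair k with ⟨a, b⟩
    have hk' : Nat.pair a b = k := by
      have := Nat.pair_unpair k
      rwa [hk] at this
    cases a with
    | zero => exact ⟨fun _ => b, 0, hk'⟩
    | succ a =>
      have : a < k := by
        have := Nat.left_le_pair (a + 1) b
        omega
      obtain ⟨σ, n, hσ⟩ := ih a this
      refine ⟨Function.update σ (n + 1) b, n + 1, ?_⟩
      rw [tc, tc_congr (τ := σ), hσ]
      · simpa using hk'
      · intro i hi
        exact Function.update_of_ne (by omega) _ _

/-- A branch through the node `k`. -/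
noncomputable def nbr (k : ℕ) : ℕ → ℕ := (tc_surj k).choose

/-- The level of the node `k`. -/
noncomputable def nlv (k : ℕ) : ℕ := (tc_surj k).choose_spec.choose

theorem tc_nbr_nlv (k : ℕ) : tc (nbr k) (nlv k) = k := (tc_surj k).choose_spec.choose_spec

theorem nlv_tc (σ : ℕ → ℕ) (n : ℕ) : nlv (tc σ n) = n := (tc_inj (tc_nbr_nlv (tc σ n))).1

theorem nbr_tc (σ : ℕ → ℕ) (n : ℕ) : ∀ i ≤ n, nbr (tc σ n) i = σ i := by
  have := (tc_inj (tc_nbr_nlv (tc σ n))).2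
  rwa [nlv_tc] at this

/-! ### Part 1: parametrising the family by a tree -/

theorem closed_retraction {s : Set (ℕ → ℕ)} (hs : IsClosed s) (hne : s.Nonempty) :
    ∃ r : (ℕ → ℕ) → (ℕ → ℕ), (∀ x ∈ s, r x = x) ∧ (∀ x, r x ∈ s) ∧
      ∀ x y n, (∀ i ≤ n, x i = y i) → r x n = r y n := by
  obtain ⟨r, h1, h2, h3⟩ := PiNat.exists_lipschitz_retraction_of_isClosed hs hne
  refine ⟨r, h1, fun x => h2 ▸ ⟨x, rfl⟩, fun x y n hxy => ?_⟩
  let : MetricSpace (ℕ → ℕ) := PiNat.metricSpace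
  have h4 := h3.dist_le_mul x y
  have h5 : x ∈ PiNat.cylinder y (n + 1) := by
    rw [PiNat.mem_cylinder_iff]
    intro i hi
    exact hxy i (by omega)
  have h6 := PiNat.mem_cylinder_iff_dist_le.1 h5
  have h7 : r x ∈ PiNat.cylinder (r y) (n + 1) := by
    rw [PiNat.mem_cylinder_iff_dist_le]
    refine h4.trans ?_
    simpa using h6
  exact PiNat.mem_cylinder_iff.1 h7 n (by omega)

/-- The basic constant condition. -/
def BasicConst {E : Type*} [NormedAddCommGroup E] [NormedSpace ℝ E] (x : ℕ → E) (K : ℝ) : Prop :=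
  ∀ (a : ℕ → ℝ) (n m : ℕ), n ≤ m →
      ‖∑ i ∈ Finset.range n, a i • x i‖ ≤ K * ‖∑ i ∈ Finset.range m, a i • x i‖

/-- Coefficient functionals of norm at most one. -/
def CoefBound {E : Type*} [NormedAddCommGroup E] [NormedSpace ℝ E] (x : ℕ → E) : Prop :=
  ∀ (a : ℕ → ℝ) (n m : ℕ), n < m → |a n| ≤ ‖∑ i ∈ Finset.range m, a i • x i‖

/-- The relation between a branch `σ` and a space `Y`. -/
def TRel (u : ℕ → CantorC) (σ : ℕ → ℕ) (Y : SB) : Prop :=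
  ∃ (x : ℕ → CantorC) (K : ℝ), Y.1 = (Submodule.span ℝ (Set.range x)).topologicalClosure ∧
    (∀ n, u (tc σ n) ≠ 0) ∧ BasicConst (fun n => u (tc σ n)) K ∧
    ∀ (a : ℕ → ℝ) (n : ℕ),
      (1 / 2) * ‖∑ i ∈ Finset.range n, a i • x i‖ ≤ ‖∑ i ∈ Finset.range n, a i • u (tc σ i)‖ ∧
      ‖∑ i ∈ Finset.range n, a i • u (tc σ i)‖ ≤ (3 / 2) * ‖∑ i ∈ Finset.range n, a i • x i‖

theorem perturb {x v : ℕ → CantorC} {K : ℝ} (hK : BasicConst x K) (hx : CoefBound x)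
    (hv : ∀ n, ‖v n - x n‖ ≤ (1 / 2) ^ n / 4) :
    (∀ n, v n ≠ 0) ∧ BasicConst v (3 * |K|) ∧
    ∀ (a : ℕ → ℝ) (n : ℕ),
      (1 / 2) * ‖∑ i ∈ Finset.range n, a i • x i‖ ≤ ‖∑ i ∈ Finset.range n, a i • v i‖ ∧
      ‖∑ i ∈ Finset.range n, a i • v i‖ ≤ (3 / 2) * ‖∑ i ∈ Finset.range n, a i • x i‖ := by
  have hd : ∀ (a : ℕ → ℝ) (n : ℕ),
      ‖∑ i ∈ Finset.range n, a i • v i - ∑ i ∈ Finset.range n, a i • x i‖ ≤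
        (1 / 2) * ‖∑ i ∈ Finset.range n, a i • x i‖ := by
    intro a n
    set M := ‖∑ i ∈ Finset.range n, a i • x i‖ with hM
    have hM0 : 0 ≤ M := norm_nonneg _
    rw [← Finset.sum_sub_distrib]
    have h1 : ‖∑ i ∈ Finset.range n, (a i • v i - a i • x i)‖ ≤
        ∑ i ∈ Finset.range n, M * ((1 / 2) ^ i / 4) := by
      refine norm_sum_le_of_le _ fun i hi => ?_
      rw [← smul_sub, norm_smul, Real.norm_eq_abs]
      exact mul_le_mul (hx a i n (Finset.mem_range.1 hi)) (hv i) (norm_nonneg _) hM0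
    refine h1.trans ?_
    rw [← Finset.mul_sum, ← Finset.sum_div]
    have h2 : ∑ i ∈ Finset.range n, ((1 : ℝ) / 2) ^ i ≤ 2 := by
      have := sum_geometric_two_le n
      simpa using this
    nlinarith
  have h3 : ∀ (a : ℕ → ℝ) (n : ℕ),
      (1 / 2) * ‖∑ i ∈ Finset.range n, a i • x i‖ ≤ ‖∑ i ∈ Finset.range n, a i • v i‖ ∧
      ‖∑ i ∈ Finset.range n, a i • v i‖ ≤ (3 / 2) * ‖∑ i ∈ Finset.range n, a i • x i‖ := by
    intro a n
    have h := hd a n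
    have h1 := norm_sub_norm_le (∑ i ∈ Finset.range n, a i • v i) (∑ i ∈ Finset.range n, a i • x i)
    have h2 := norm_sub_norm_le (∑ i ∈ Finset.range n, a i • x i) (∑ i ∈ Finset.range n, a i • v i)
    rw [norm_sub_rev] at h2
    constructor <;> linarith
  refine ⟨fun n h0 => ?_, fun a n m hnm => ?_, h3⟩
  · have h4 := (h3 (Pi.single n 1) (n + 1)).1
    have h5 := hx (Pi.single n 1) n (n + 1) (by omega)
    have h6 : ∑ i ∈ Finset.range (n + 1), (Pi.single n (1 : ℝ) : ℕ → ℝ) i • v i = 0 := by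
      refine Finset.sum_eq_zero fun i _ => ?_
      by_cases hi : i = n
      · subst hi; simp [h0]
      · simp [hi]
    rw [h6, norm_zero] at h4
    simp at h5
    linarith
  · have h4 := (h3 a n).2
    have h5 := (h3 a m).1
    have h6 := hK a n m hnm
    have h7 : K * ‖∑ i ∈ Finset.range m, a i • x i‖ ≤ |K| * ‖∑ i ∈ Finset.range m, a i • x i‖ :=
      mul_le_mul_of_nonneg_right (le_abs_self _) (norm_nonneg _)
    have h8 := mul_le_mul_of_nonneg_left h5 (abs_nonneg K)
    linarith

/-- Rescaling a Schauder basis. -/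
theorem exists_good_basis (Y : SB) (hY : HasSchauderBasis Y.1) :
    ∃ x : ℕ → CantorC, Y.1 = (Submodule.span ℝ (Set.range x)).topologicalClosure ∧
      (∃ K : ℕ, BasicConst x K) ∧ CoefBound x := by
  obtain ⟨y, hy⟩ := hY
  have : CompleteSpace Y.1 := Y.2.completeSpace_coe
  obtain ⟨K, hK⟩ := schauder_const hy
  have hy0 := schauder_ne_zero hy
  obtain ⟨M, hM⟩ := exists_nat_gt (max K 0)
  have hM0 : (0 : ℝ) < M := lt_of_le_of_lt (le_max_right _ _) hM
  have hKM : K ≤ M := (lt_of_le_of_lt (le_max_left _ _) hM).le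
  have hK' : ∀ (a : ℕ → ℝ) (n m : ℕ), n ≤ m →
      ‖∑ i ∈ Finset.range n, a i • (y i : CantorC)‖ ≤
        M * ‖∑ i ∈ Finset.range m, a i • (y i : CantorC)‖ := by
    intro a n m hnm
    have := (hK a n m hnm).trans (mul_le_mul_of_nonneg_right hKM (norm_nonneg _))
    have e : ∀ k, ∑ i ∈ Finset.range k, a i • (y i : CantorC) =
        ((∑ i ∈ Finset.range k, a i • y i : Y.1) : CantorC) := fun k => by simp
    rw [e, e]
    exact this
  have hn0 : ∀ n, 0 < ‖(y n : CantorC)‖ := fun n => norm_pos_iff.2 (by simpa using hy0 n)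
  let t : ℕ → ℝ := fun n => 2 * M / ‖(y n : CantorC)‖
  have ht : ∀ n, 0 < t n := fun n => by have := hn0 n; positivity
  let x : ℕ → CantorC := fun n => t n • (y n : CantorC)
  have hxn : ∀ n, ‖x n‖ = 2 * M := fun n => by
    have := hn0 n
    simp only [x, t, norm_smul]
    rw [Real.norm_of_nonneg (by positivity)]
    field_simp
  have hspan : Submodule.span ℝ (Set.range x) = Submodule.span ℝ (Set.range fun n => (y n : CantorC)) := by
    apply le_antisymm
    · rw [Submodule.span_le]
      rintro _ ⟨n, rfl⟩
      exact Submodule.smul_mem _ _ (Submodule.subset_span ⟨n, rfl⟩)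
    · rw [Submodule.span_le]
      rintro _ ⟨n, rfl⟩
      have : (y n : CantorC) = (t n)⁻¹ • x n := by
        simp only [x, smul_smul, inv_mul_cancel₀ (ht n).ne', one_smul]
      change (y n : CantorC) ∈ _
      rw [this]
      exact Submodule.smul_mem _ _ (Submodule.subset_span ⟨n, rfl⟩)
  have hbc : BasicConst x M := by
    intro a n m hnm
    have := hK' (fun i => a i * t i) n m hnm
    simpa [x, smul_smul] using this
  refine ⟨x, ?_, ⟨M, hbc⟩, ?_⟩
  · rw [hspan]
    apply le_antisymm
    · intro z hz
      obtain ⟨a, ha, -⟩ := hy ⟨z, hz⟩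
      have ha' : Tendsto (fun m => ∑ n ∈ Finset.range m, a n • (y n : CantorC)) atTop (𝓝 z) := by
        rw [tendsto_subtype_rng] at ha
        simpa using ha
      rw [← SetLike.mem_coe, Submodule.topologicalClosure_coe]
      refine mem_closure_of_tendsto ha' (Eventually.of_forall fun m => ?_)
      refine Submodule.sum_mem _ fun i _ => Submodule.smul_mem _ _ (Submodule.subset_span ⟨i, rfl⟩)
    · refine Submodule.topologicalClosure_minimal _ ?_ Y.2
      rw [Submodule.span_le]
      rintro _ ⟨n, rfl⟩
      exact (y n).2
  · intro a n m hnm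
    have h1 := hbc a n m hnm.le
    have h2 := hbc a (n + 1) m hnm
    have h3 : ‖a n • x n‖ ≤ 2 * M * ‖∑ i ∈ Finset.range m, a i • x i‖ := by
      have : a n • x n = ∑ i ∈ Finset.range (n + 1), a i • x i - ∑ i ∈ Finset.range n, a i • x i := by
        rw [Finset.sum_range_succ]; abel
      rw [this]
      refine (norm_sub_le _ _).trans ?_
      linarith
    rw [norm_smul, hxn, Real.norm_eq_abs] at h3
    have h4 : (0:ℝ) < 2 * M := by positivity
    rw [mul_comm] at h3
    exact le_of_mul_le_mul_left h3 h4

theorem submodule_eq_iff_basis (Y : SB) (x : ℕ → CantorC) :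
    Y.1 = (Submodule.span ℝ (Set.range x)).topologicalClosure ↔
      ∀ U ∈ TopologicalSpace.countableBasis CantorC, (((Y.1 : Set CantorC) ∩ U).Nonempty ↔
        ∃ c : ℕ →₀ ℝ, Finsupp.linearCombination ℝ x c ∈ U) := by
  have hB := TopologicalSpace.isBasis_countableBasis CantorC
  have h1 : ∀ U ∈ TopologicalSpace.countableBasis CantorC,
      ((∃ c : ℕ →₀ ℝ, Finsupp.linearCombination ℝ x c ∈ U) ↔
        ((Submodule.span ℝ (Set.range x) : Set CantorC) ∩ U).Nonempty) := by
    intro U hU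
    constructor
    · rintro ⟨c, hc⟩
      refine ⟨_, ?_, hc⟩
      rw [SetLike.mem_coe, Finsupp.mem_span_range_iff_exists_finsupp]
      exact ⟨c, rfl⟩
    · rintro ⟨z, hz, hzU⟩
      rw [SetLike.mem_coe, Finsupp.mem_span_range_iff_exists_finsupp] at hz
      obtain ⟨c, rfl⟩ := hz
      exact ⟨c, hzU⟩
  constructor
  · intro h U hU
    rw [h1 U hU, h, Submodule.topologicalClosure_coe]
    have hUo := hB.isOpen hU
    constructor
    · rintro ⟨z, hz, hzU⟩
      obtain ⟨w, hw, hw'⟩ := mem_closure_iff.1 hz U hUo hzU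
      exact ⟨w, hw', hw⟩
    · rintro ⟨z, hz, hzU⟩
      exact ⟨z, subset_closure hz, hzU⟩
  · intro h
    have h2 : closure (Y.1 : Set CantorC) = closure (Submodule.span ℝ (Set.range x) : Set CantorC) := by
      ext z
      rw [hB.mem_closure_iff, hB.mem_closure_iff]
      refine forall_congr' fun U => forall_congr' fun hU => forall_congr' fun _ => ?_
      rw [Set.inter_comm, h U hU, h1 U hU, Set.inter_comm]
    rw [Y.2.closure_eq] at h2
    apply SetLike.coe_injective
    rw [h2, Submodule.topologicalClosure_coe]

theorem exists_cont_param (A : Set SB) (hA : IsAnalyticIn A)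
    (hb : ∀ Y ∈ A, HasSchauderBasis Y.1) :
    ∃ h : (ℕ → ℕ) → (ℕ → CantorC), Continuous h ∧ ∀ x, x ∈ Set.range h ↔
      ∃ Y ∈ A, Y.1 = (Submodule.span ℝ (Set.range x)).topologicalClosure ∧
      (∃ K : ℕ, BasicConst x K) ∧ CoefBound x := by
  obtain ⟨f, hf, rfl⟩ := hA
  let : MeasurableSpace CantorC := borel CantorC
  have : BorelSpace CantorC := ⟨rfl⟩
  let G : Set ((ℕ → ℕ) × (ℕ → CantorC)) := {p |
    (∀ U ∈ TopologicalSpace.countableBasis CantorC, ((((f p.1).1 : Set CantorC) ∩ U).Nonempty ↔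
        ∃ c : ℕ →₀ ℝ, Finsupp.linearCombination ℝ p.2 c ∈ U)) ∧
    (∃ K : ℕ, BasicConst p.2 K) ∧ CoefBound p.2}
  have hG : MeasurableSet G := by
    have e : G = (⋂ U ∈ TopologicalSpace.countableBasis CantorC,
        {p : (ℕ → ℕ) × (ℕ → CantorC) | ((((f p.1).1 : Set CantorC) ∩ U).Nonempty ↔
          ∃ c : ℕ →₀ ℝ, Finsupp.linearCombination ℝ p.2 c ∈ U)}) ∩
        ((⋃ K : ℕ, {p | BasicConst p.2 K}) ∩ {p | CoefBound p.2}) := by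
      ext p
      simp [G]
    rw [e]
    refine MeasurableSet.inter ?_ (MeasurableSet.inter ?_ ?_)
    · refine MeasurableSet.biInter (TopologicalSpace.countable_countableBasis _) fun U hU => ?_
      have hUo := (TopologicalSpace.isBasis_countableBasis CantorC).isOpen hU
      refine MeasurableSet.iff ?_ ?_
      · have : MeasurableSet {Y : SB | ((Y.1 : Set CantorC) ∩ U).Nonempty} :=
          MeasurableSpace.measurableSet_generateFrom ⟨U, hUo, rfl⟩
        exact (hf.comp measurable_fst) this
      · have e2 : {p : (ℕ → ℕ) × (ℕ → CantorC) |
            ∃ c : ℕ →₀ ℝ, Finsupp.linearCombination ℝ p.2 c ∈ U} =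
            ⋃ c : ℕ →₀ ℝ, {p | Finsupp.linearCombination ℝ p.2 c ∈ U} := by
          ext p; simp
        rw [e2]
        refine (isOpen_iUnion fun c => ?_).measurableSet
        refine IsOpen.preimage (f := fun p : (ℕ → ℕ) × (ℕ → CantorC) =>
          Finsupp.linearCombination ℝ p.2 c) ?_ hUo
        simp only [Finsupp.linearCombination_apply, Finsupp.sum]
        fun_prop
    · refine MeasurableSet.iUnion fun K => IsClosed.measurableSet ?_
      simp only [BasicConst, Set.ofPred_forall]
      refine isClosed_iInter fun a => isClosed_iInter fun n => isClosed_iInter fun m =>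
        isClosed_iInter fun _ => isClosed_le (by fun_prop) (by fun_prop)
    · refine IsClosed.measurableSet ?_
      simp only [CoefBound, Set.ofPred_forall]
      refine isClosed_iInter fun a => isClosed_iInter fun n => isClosed_iInter fun m =>
        isClosed_iInter fun _ => isClosed_le (by fun_prop) (by fun_prop)
  have hpol : TopologicalSpace.IsCompletelyMetrizableSpace (ℕ → CantorC) :=
    TopologicalSpace.IsCompletelyMetrizableSpace.pi_countable
  have hGa : AnalyticSet (Prod.snd '' G) := hG.analyticSet.image_of_continuous continuous_snd
  have hmem : ∀ x, x ∈ Prod.snd '' G ↔ ∃ Y ∈ Set.range f,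
      Y.1 = (Submodule.span ℝ (Set.range x)).topologicalClosure ∧
      (∃ K : ℕ, BasicConst x K) ∧ CoefBound x := by
    intro x
    constructor
    · rintro ⟨⟨α, x'⟩, ⟨h1, h2⟩, rfl⟩
      exact ⟨f α, ⟨α, rfl⟩, (submodule_eq_iff_basis _ _).2 h1, h2⟩
    · rintro ⟨_, ⟨α, rfl⟩, h1, h2⟩
      exact ⟨⟨α, x⟩, ⟨(submodule_eq_iff_basis _ _).1 h1, h2⟩, rfl⟩
  rw [AnalyticSet] at hGa
  rcases hGa with h | ⟨h, hc, hr⟩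
  · exfalso
    obtain ⟨x, hx⟩ := exists_good_basis (f 0) (hb _ ⟨0, rfl⟩)
    have : x ∈ Prod.snd '' G := (hmem x).2 ⟨f 0, ⟨0, rfl⟩, hx⟩
    rw [h] at this
    exact this
  · exact ⟨h, hc, fun x => by rw [hr]; exact hmem x⟩

theorem exists_tree_param (A : Set SB) (hA : IsAnalyticIn A)
    (hb : ∀ Y ∈ A, HasSchauderBasis Y.1) :
    ∃ u : ℕ → CantorC, (∀ σ, ∃ Y ∈ A, TRel u σ Y) ∧ ∀ Y ∈ A, ∃ σ, TRel u σ Y := by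
  obtain ⟨h, hc, hr⟩ := exists_cont_param A hA hb
  obtain ⟨d, hd⟩ := TopologicalSpace.exists_dense_seq CantorC
  let dl : ℕ → ℝ := fun n => (1 / 2) ^ n / 4
  have hdl : ∀ n, 0 < dl n := fun n => by positivity
  let P : (ℕ → ℕ) → (ℕ → ℕ) := fun γ m => (γ m).unpair.2
  have hP : Continuous P := by
    refine continuous_pi fun m => ?_
    exact (continuous_of_discreteTopology (f := fun k : ℕ => k.unpair.2)).comp (continuous_apply m)
  let S : Set (ℕ → ℕ) := {γ | ∀ n, ‖d ((γ n).unpair.1) - h (P γ) n‖ ≤ dl n}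
  have hS : IsClosed S := by
    simp only [S, Set.ofPred_forall]
    refine isClosed_iInter fun n => isClosed_le (Continuous.norm (Continuous.sub ?_ ?_))
      continuous_const
    · exact (continuous_of_discreteTopology (f := fun k : ℕ => d k.unpair.1)).comp
        (continuous_apply n)
    · exact (continuous_apply n).comp (hc.comp hP)
  have hex : ∀ β : ℕ → ℕ, ∃ γ ∈ S, P γ = β := by
    intro β
    have : ∀ n, ∃ i, ‖d i - h β n‖ ≤ dl n := by
      intro n
      obtain ⟨_, h1, i, rfl⟩ := hd.inter_open_nonempty _ (Metric.isOpen_ball (x := h β n) (ε := dl n))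
        ⟨h β n, Metric.mem_ball_self (hdl n)⟩
      refine ⟨i, ?_⟩
      rw [Metric.mem_ball, dist_eq_norm] at h1
      exact h1.le
    choose i hi using this
    have hPe : P (fun n => Nat.pair (i n) (β n)) = β := by
      funext n; simp [P]
    refine ⟨fun n => Nat.pair (i n) (β n), fun n => ?_, hPe⟩
    rw [hPe]
    simpa using hi n
  obtain ⟨r, hr1, hr2, hr3⟩ := closed_retraction hS (by
    obtain ⟨γ, hγ, -⟩ := hex 0
    exact ⟨γ, hγ⟩)
  let u : ℕ → CantorC := fun k => d ((r (nbr k) (nlv k)).unpair.1)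
  have hu : ∀ σ n, u (tc σ n) = d ((r σ n).unpair.1) := by
    intro σ n
    simp only [u, nlv_tc]
    rw [hr3 _ σ n (nbr_tc σ n)]
  have key : ∀ σ (Y : SB), Y.1 = (Submodule.span ℝ (Set.range (h (P (r σ))))).topologicalClosure →
      (∃ K : ℕ, BasicConst (h (P (r σ))) K) → CoefBound (h (P (r σ))) → TRel u σ Y := by
    rintro σ Y h1 ⟨K, hK⟩ h3
    obtain ⟨k1, k2, k3⟩ := perturb (v := fun n => u (tc σ n)) hK h3 (fun n => by
      have := hr2 σ n
      simpa only [hu] using this)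
    exact ⟨_, _, h1, k1, k2, k3⟩
  refine ⟨u, ?_, ?_⟩
  · intro σ
    obtain ⟨Y, hY, h1, h2, h3⟩ := (hr (h (P (r σ)))).1 ⟨_, rfl⟩
    exact ⟨Y, hY, key σ Y h1 h2 h3⟩
  · intro Y hY
    obtain ⟨x, hx, h2, h3⟩ := exists_good_basis Y (hb Y hY)
    obtain ⟨β, hβ⟩ := (hr x).2 ⟨Y, hY, hx, h2, h3⟩
    obtain ⟨γ, hγ, hγ2⟩ := hex β
    refine ⟨γ, ?_⟩
    have e : h (P (r γ)) = x := by rw [hr1 γ hγ, hγ2, hβ]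
    exact key γ Y (by rwa [e]) (by rwa [e]) (by rwa [e])

/-! ### Part 2: every seminorm on `ℕ →₀ ℝ` is realised in `C(2^ℕ)` -/

theorem exists_norming (p : Seminorm ℝ (ℕ →₀ ℝ)) (a : ℕ →₀ ℝ) :
    ∃ φ : (ℕ →₀ ℝ) →ₗ[ℝ] ℝ, (∀ b, |φ b| ≤ p b) ∧ φ a = p a := by
  by_cases ha : a = 0
  · exact ⟨0, fun b => by simp, by simp [ha]⟩
  let e := LinearEquiv.toSpanNonzeroSingleton ℝ (ℕ →₀ ℝ) a ha
  let f : Module.Dual ℝ (Submodule.span ℝ {a}) := (p a) • e.symm.toLinearMap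
  have hf : ∀ c : ℝ, ∀ h, f ⟨c • a, h⟩ = c * p a := by
    intro c h
    have : e.symm ⟨c • a, h⟩ = c := by
      rw [LinearEquiv.symm_apply_eq]
      rfl
    simp [f, this, mul_comm]
  obtain ⟨g, hg1, hg2⟩ := Module.Dual.exists_extension_of_le_seminorm_real
    (Submodule.span ℝ {a}) f (p := p) (by
      rintro ⟨x, hx⟩
      obtain ⟨c, rfl⟩ := Submodule.mem_span_singleton.1 hx
      rw [hf, map_smul_eq_mul]
      exact mul_le_mul_of_nonneg_right (le_abs_self c) (apply_nonneg _ _))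
  refine ⟨g, hg2, ?_⟩
  have h1 := hg1 ⟨(1 : ℝ) • a, Submodule.mem_span_singleton.2 ⟨1, rfl⟩⟩
  rw [hf] at h1
  simpa using h1

theorem exists_realisation (p : Seminorm ℝ (ℕ →₀ ℝ)) :
    ∃ z : ℕ → CantorC, ∀ a, ‖Finsupp.linearCombination ℝ z a‖ = p a := by
  let K : Set (ℕ → ℝ) := {φ | ∀ a : ℕ →₀ ℝ, |∑ k ∈ a.support, a k * φ k| ≤ p a}
  have hKc : IsCompact K := by
    refine IsCompact.of_isClosed_subset
      (isCompact_univ_pi fun k : ℕ => isCompact_Icc (a := -p (Finsupp.single k 1))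
        (b := p (Finsupp.single k 1))) ?_ ?_
    · simp only [K, Set.ofPred_forall]
      exact isClosed_iInter fun a => isClosed_le (by fun_prop) continuous_const
    · intro φ hφ k _
      have := hφ (Finsupp.single k 1)
      rw [Finsupp.support_single k one_ne_zero] at this
      simpa [abs_le] using this
  have hne : Nonempty K := ⟨⟨0, fun a => by simp⟩⟩
  have hcs : CompactSpace K := isCompact_iff_compactSpace.1 hKc
  let mK : MetricSpace K := TopologicalSpace.metrizableSpaceMetric K
  obtain ⟨q, hq, hqs⟩ := exists_nat_bool_continuous_surjective_of_compact K
  let z : ℕ → CantorC := fun k => ⟨fun t => (q t).1 k,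
    (continuous_apply k).comp (continuous_subtype_val.comp hq)⟩
  have hz : ∀ (a : ℕ →₀ ℝ) (t : CantorSet), Finsupp.linearCombination ℝ z a t =
      ∑ k ∈ a.support, a k * (q t).1 k := by
    intro a t
    simp [Finsupp.linearCombination_apply, Finsupp.sum, z]
  refine ⟨z, fun a => le_antisymm ?_ ?_⟩
  · refine (ContinuousMap.norm_le _ (apply_nonneg _ _)).2 fun t => ?_
    rw [hz]
    exact (q t).2 a
  · obtain ⟨φ, h1, h2⟩ := exists_norming p a
    have h3 : ∀ b : ℕ →₀ ℝ, φ b = ∑ k ∈ b.support, b k * φ (Finsupp.single k 1) := by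
      intro b
      conv_lhs => rw [← Finsupp.sum_single b]
      rw [Finsupp.sum, map_sum]
      refine Finset.sum_congr rfl fun k _ => ?_
      rw [← smul_eq_mul, ← map_smul]
      simp
    obtain ⟨t, ht⟩ := hqs ⟨fun k => φ (Finsupp.single k 1), fun b => by rw [← h3]; exact h1 b⟩
    have h4 := (Finsupp.linearCombination ℝ z a).norm_coe_le_norm t
    rw [hz, ht] at h4
    simp only at h4
    rw [← h3, h2] at h4
    exact (le_abs_self _).trans h4

/-! ### Segments and the tree norm -/

/-- A segment of the tree: the nodes of levels in `[lo, hi)` on the branch `br`. -/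
structure TSeg where
  br : ℕ → ℕ
  lo : ℕ
  hi : ℕ

/-- Incomparability of segments. -/
def TIncomp (P Q : TSeg) : Prop := ∃ m, m ≤ P.lo ∧ m ≤ Q.lo ∧ P.br m ≠ Q.br m

theorem TIncomp.symm {P Q : TSeg} (h : TIncomp P Q) : TIncomp Q P := by
  obtain ⟨m, h1, h2, h3⟩ := h
  exact ⟨m, h2, h1, h3.symm⟩

/-- Pairwise incomparable. -/
def TAnti (G : Finset TSeg) : Prop := ∀ P ∈ G, ∀ Q ∈ G, P ≠ Q → TIncomp P Q

theorem TIncomp.absurd_branch {P Q : TSeg} (h : TIncomp P Q) {τ : ℕ → ℕ} {i j i' j' : ℕ}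
    (hi : P.lo ≤ i) (hj : Q.lo ≤ j) (hi' : tc P.br i = tc τ i') (hj' : tc Q.br j = tc τ j') :
    False := by
  obtain ⟨m, h1, h2, h3⟩ := h
  have e1 := (tc_inj hi').2 m (by omega)
  have e2 := (tc_inj hj').2 m (by omega)
  exact h3 (e1.trans e2.symm)

section TreeNorm

variable {V : Type*} [NormedAddCommGroup V] [NormedSpace ℝ V] (u : ℕ → V)

/-- Sum along a segment. -/
noncomputable def segS (P : TSeg) : (ℕ →₀ ℝ) →ₗ[ℝ] V :=
  ∑ j ∈ Finset.Ico P.lo P.hi, (Finsupp.lapply (tc P.br j)).smulRight (u (tc P.br j))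

theorem segS_apply (P : TSeg) (z : ℕ →₀ ℝ) :
    segS u P z = ∑ j ∈ Finset.Ico P.lo P.hi, z (tc P.br j) • u (tc P.br j) := by
  simp [segS, LinearMap.sum_apply]

theorem exists_of_segS_ne {P : TSeg} {z : ℕ →₀ ℝ} (h : segS u P z ≠ 0) :
    ∃ j, P.lo ≤ j ∧ j < P.hi ∧ z (tc P.br j) ≠ 0 := by
  rw [segS_apply] at h
  obtain ⟨j, hj, h1⟩ := Finset.exists_ne_zero_of_sum_ne_zero h
  rw [Finset.mem_Ico] at hj
  refine ⟨j, hj.1, hj.2, fun h0 => h1 (by simp [h0])⟩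

theorem segS_bound (P : TSeg) (z : ℕ →₀ ℝ) :
    ‖segS u P z‖ ≤ ∑ k ∈ z.support, |z k| * ‖u k‖ := by
  classical
  rw [segS_apply]
  have h1 : ‖∑ j ∈ Finset.Ico P.lo P.hi, z (tc P.br j) • u (tc P.br j)‖ ≤
      ∑ j ∈ Finset.Ico P.lo P.hi, |z (tc P.br j)| * ‖u (tc P.br j)‖ :=
    norm_sum_le_of_le _ fun j _ => by rw [norm_smul, Real.norm_eq_abs]
  refine h1.trans ?_
  rw [← Finset.sum_image (f := fun k => |z k| * ‖u k‖) (g := tc P.br)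
    (fun i _ j _ h => (tc_strictMono P.br).injective h)]
  rw [← Finset.sum_filter_ne_zero]
  refine Finset.sum_le_sum_of_subset_of_nonneg ?_ fun k _ _ => by positivity
  intro k hk
  rw [Finset.mem_filter] at hk
  rw [Finsupp.mem_support_iff]
  intro h0
  exact hk.2 (by simp [h0])

open Classical in
theorem card_meet {G : Finset TSeg} (hG : TAnti G) (z : ℕ →₀ ℝ) :
    (G.filter fun P => segS u P z ≠ 0).card ≤ z.support.card := by
  have h : ∀ P : TSeg, segS u P z ≠ 0 → ∃ j, P.lo ≤ j ∧ j < P.hi ∧ z (tc P.br j) ≠ 0 :=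
    fun P hP => exists_of_segS_ne u hP
  choose! j h1 h2 h3 using h
  refine Finset.card_le_card_of_injOn (fun P => tc P.br (j P)) ?_ ?_
  · intro P hP
    simp only [Finset.coe_filter, Set.mem_ofPred_eq] at hP
    simpa using h3 P hP.2
  · intro P hP Q hQ hPQ
    simp only [Finset.coe_filter, Set.mem_ofPred_eq] at hP hQ
    by_contra hne
    exact (hG P hP.1 Q hQ.1 hne).absurd_branch (h1 P hP.2) (h1 Q hQ.2) hPQ rfl

/-- Sum of squares over a family of segments. -/
noncomputable def qn (G : Finset TSeg) (z : ℕ →₀ ℝ) : ℝ := ∑ P ∈ G, ‖segS u P z‖ ^ 2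

theorem qn_nonneg (G : Finset TSeg) (z : ℕ →₀ ℝ) : 0 ≤ qn u G z :=
  Finset.sum_nonneg fun _ _ => by positivity

theorem qn_le_card {G : Finset TSeg} (hG : TAnti G) (z : ℕ →₀ ℝ) {M : ℝ}
    (hM : ∀ P ∈ G, ‖segS u P z‖ ≤ M) : qn u G z ≤ z.support.card * M ^ 2 := by
  classical
  have e : qn u G z = ∑ P ∈ G.filter (fun P => segS u P z ≠ 0), ‖segS u P z‖ ^ 2 := by
    rw [qn, Finset.sum_filter_of_ne]
    intro P _ h h0
    simp [h0] at h
  rw [e]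
  have h1 := Finset.sum_le_card_nsmul (G.filter (fun P => segS u P z ≠ 0))
    (fun P => ‖segS u P z‖ ^ 2) (M ^ 2) (fun P hP =>
      pow_le_pow_left₀ (norm_nonneg _) (hM P (Finset.mem_filter.1 hP).1) 2)
  refine h1.trans ?_
  rw [nsmul_eq_mul]
  exact mul_le_mul_of_nonneg_right (by exact_mod_cast card_meet u hG z) (sq_nonneg M)

/-- The tree norm. -/
noncomputable def tN (z : ℕ →₀ ℝ) : ℝ := ⨆ G : {G : Finset TSeg // TAnti G}, √(qn u G.1 z)

theorem tN_bdd (z : ℕ →₀ ℝ) :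
    BddAbove (Set.range fun G : {G : Finset TSeg // TAnti G} => √(qn u G.1 z)) := by
  refine ⟨√(z.support.card * (∑ k ∈ z.support, |z k| * ‖u k‖) ^ 2), ?_⟩
  rintro _ ⟨G, rfl⟩
  exact Real.sqrt_le_sqrt (qn_le_card u G.2 z fun P _ => segS_bound u P z)

theorem tanti_empty : TAnti ∅ := by intro P hP; simp at hP

instance : Nonempty {G : Finset TSeg // TAnti G} := ⟨⟨∅, tanti_empty⟩⟩

theorem tN_nonneg (z : ℕ →₀ ℝ) : 0 ≤ tN u z := Real.iSup_nonneg fun _ => Real.sqrt_nonneg _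

theorem qn_le_tN {G : Finset TSeg} (hG : TAnti G) (z : ℕ →₀ ℝ) : qn u G z ≤ tN u z ^ 2 := by
  have := le_ciSup (tN_bdd u z) ⟨G, hG⟩
  exact (Real.sqrt_le_left (tN_nonneg u z)).1 this

theorem tN_le {z : ℕ →₀ ℝ} {M : ℝ} (hM : 0 ≤ M) (h : ∀ G, TAnti G → qn u G z ≤ M ^ 2) :
    tN u z ≤ M :=
  ciSup_le fun G => (Real.sqrt_le_left hM).2 (h G.1 G.2)

theorem fam_le_tN {ι : Type*} (s : Finset ι) (P : ι → TSeg)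
    (hP : ∀ i ∈ s, ∀ j ∈ s, i ≠ j → TIncomp (P i) (P j)) (z : ℕ →₀ ℝ) :
    ∑ i ∈ s, ‖segS u (P i) z‖ ^ 2 ≤ tN u z ^ 2 := by
  classical
  have hinj : Set.InjOn P s := by
    intro i hi j hj h
    by_contra hne
    obtain ⟨m, -, -, h3⟩ := hP i hi j hj hne
    exact h3 (by rw [h])
  have hG : TAnti (s.image P) := by
    intro A hA B hB hne
    obtain ⟨i, hi, rfl⟩ := Finset.mem_image.1 hA
    obtain ⟨j, hj, rfl⟩ := Finset.mem_image.1 hB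
    exact hP i hi j hj (fun h => hne (by rw [h]))
  have := qn_le_tN u hG z
  rwa [qn, Finset.sum_image hinj] at this

theorem segS_le_tN (P : TSeg) (z : ℕ →₀ ℝ) : ‖segS u P z‖ ≤ tN u z := by
  have := fam_le_tN u {()} (fun _ => P) (by simp) z
  simp only [Finset.sum_const, Finset.card_singleton, one_smul] at this
  exact le_of_sq_le_sq this (tN_nonneg u z)

theorem tN_add (z w : ℕ →₀ ℝ) : tN u (z + w) ≤ tN u z + tN u w := by
  refine tN_le u (add_nonneg (tN_nonneg u z) (tN_nonneg u w)) fun G hG => ?_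
  have h1 := qn_le_tN u hG z
  have h2 := qn_le_tN u hG w
  have h3 : ∑ P ∈ G, ‖segS u P z‖ * ‖segS u P w‖ ≤ tN u z * tN u w := by
    refine (Real.sum_mul_le_sqrt_mul_sqrt G _ _).trans ?_
    exact mul_le_mul ((Real.sqrt_le_left (tN_nonneg u z)).2 h1)
      ((Real.sqrt_le_left (tN_nonneg u w)).2 h2) (Real.sqrt_nonneg _) (tN_nonneg u z)
  have h4 : qn u G (z + w) ≤ ∑ P ∈ G, (‖segS u P z‖ ^ 2 + 2 * (‖segS u P z‖ * ‖segS u P w‖) +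
      ‖segS u P w‖ ^ 2) := by
    refine Finset.sum_le_sum fun P _ => ?_
    rw [map_add]
    have := norm_add_le (segS u P z) (segS u P w)
    have h0 := norm_nonneg (segS u P z + segS u P w)
    calc _ ≤ (‖segS u P z‖ + ‖segS u P w‖) ^ 2 := pow_le_pow_left₀ h0 this 2
      _ = _ := by ring
  rw [Finset.sum_add_distrib, Finset.sum_add_distrib, ← Finset.mul_sum] at h4
  simp only [qn] at h1 h2 h4 ⊢
  nlinarith

/-- The tree norm as a seminorm. -/
noncomputable def tSN : Seminorm ℝ (ℕ →₀ ℝ) :=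
  Seminorm.ofSMulLE (tN u)
    (le_antisymm (tN_le u le_rfl fun G _ => by simp [qn]) (tN_nonneg u 0)) (tN_add u)
    (fun r z => tN_le u (mul_nonneg (norm_nonneg r) (tN_nonneg u z)) fun G hG => by
      have h1 := qn_le_tN u hG z
      have : qn u G (r • z) = ‖r‖ ^ 2 * qn u G z := by
        simp only [qn, map_smul, norm_smul, mul_pow, Finset.mul_sum]
      rw [this, mul_pow]
      exact mul_le_mul_of_nonneg_left h1 (sq_nonneg _))

theorem tSN_apply (z : ℕ →₀ ℝ) : tSN u z = tN u z := rfl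

theorem segS_filter (T : ℕ → Prop) [DecidablePred T] (P : TSeg)
    (hT : ({j | T (tc P.br j)} : Set ℕ).OrdConnected) (z : ℕ →₀ ℝ) :
    ∃ lo hi, P.lo ≤ lo ∧ segS u P (z.filter T) = segS u ⟨P.br, lo, hi⟩ z ∧
      (∀ j, lo ≤ j → j < hi → T (tc P.br j)) := by
  classical
  have e1 : segS u P (z.filter T) =
      ∑ j ∈ (Finset.Ico P.lo P.hi).filter (fun j => T (tc P.br j)),
        z (tc P.br j) • u (tc P.br j) := by
    rw [segS_apply, Finset.sum_filter]
    refine Finset.sum_congr rfl fun j _ => ?_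
    rw [Finsupp.filter_apply]
    split_ifs <;> simp
  set F := (Finset.Ico P.lo P.hi).filter (fun j => T (tc P.br j)) with hF
  rcases F.eq_empty_or_nonempty with h0 | h0
  · refine ⟨P.lo, P.lo, le_rfl, ?_, fun j h1 h2 => by omega⟩
    rw [e1, h0, segS_apply]
    simp
  · have hmin := F.min'_mem h0
    have hmax := F.max'_mem h0
    have hmin' := Finset.mem_filter.1 hmin
    have hmax' := Finset.mem_filter.1 hmax
    rw [Finset.mem_Ico] at hmin' hmax'
    have hTj : ∀ j, F.min' h0 ≤ j → j < F.max' h0 + 1 → T (tc P.br j) := fun j h1 h2 =>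
      hT.out hmin'.2 hmax'.2 ⟨h1, by omega⟩
    refine ⟨F.min' h0, F.max' h0 + 1, hmin'.1.1, ?_, hTj⟩
    rw [e1, segS_apply]
    refine Finset.sum_congr ?_ fun _ _ => rfl
    ext j
    rw [Finset.mem_Ico]
    constructor
    · intro hj
      exact ⟨F.min'_le j hj, Nat.lt_succ_of_le (F.le_max' j hj)⟩
    · rintro ⟨h1, h2⟩
      simp only at h1 h2
      rw [hF, Finset.mem_filter, Finset.mem_Ico]
      exact ⟨⟨by omega, by omega⟩, hTj j h1 h2⟩

theorem tN_filter (T : ℕ → Prop) [DecidablePred T]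
    (hT : ∀ τ, ({j | T (tc τ j)} : Set ℕ).OrdConnected) (z : ℕ →₀ ℝ) :
    tN u (z.filter T) ≤ tN u z := by
  refine tN_le u (tN_nonneg u z) fun G hG => ?_
  have h : ∀ P : TSeg, ∃ lo hi, P.lo ≤ lo ∧ segS u P (z.filter T) = segS u ⟨P.br, lo, hi⟩ z :=
    fun P => by
      obtain ⟨lo, hi, h1, h2, -⟩ := segS_filter u T P (hT P.br) z
      exact ⟨lo, hi, h1, h2⟩
  choose lo hi h1 h2 using h
  have := fam_le_tN u G (fun P => ⟨P.br, lo P, hi P⟩) (by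
    intro P hP Q hQ hne
    obtain ⟨m, k1, k2, k3⟩ := hG P hP Q hQ hne
    exact ⟨m, k1.trans (h1 P), k2.trans (h1 Q), k3⟩) z
  simp only [qn, h2]
  exact this

/-- On functions supported by a branch, segments can be moved to the branch. -/
theorem segS_branch {σ : ℕ → ℕ} {b : ℕ →₀ ℝ} (hb : ∀ k, b k ≠ 0 → ∃ j, k = tc σ j) (P : TSeg) :
    ∃ hi, segS u P b = segS u ⟨σ, P.lo, hi⟩ b := by
  by_cases h : ∀ i, P.br i = σ i
  · have : P.br = σ := funext h
    exact ⟨P.hi, by rw [← this]⟩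
  · push Not at h
    classical
    let m := Nat.find h
    have hm : P.br m ≠ σ m := Nat.find_spec h
    have hm' : ∀ i < m, P.br i = σ i := fun i hi => not_not.1 (Nat.find_min h hi)
    refine ⟨min P.hi m, ?_⟩
    rw [segS_apply, segS_apply]
    simp only
    symm
    have e : ∑ j ∈ Finset.Ico P.lo (min P.hi m), b (tc σ j) • u (tc σ j) =
        ∑ j ∈ Finset.Ico P.lo (min P.hi m), b (tc P.br j) • u (tc P.br j) := by
      refine Finset.sum_congr rfl fun j hj => ?_
      rw [Finset.mem_Ico] at hj
      rw [tc_congr (σ := P.br) (τ := σ) fun i hi => hm' i (by omega)]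
    rw [e]
    refine Finset.sum_subset ?_ ?_
    · intro j
      simp only [Finset.mem_Ico]
      omega
    · intro j hj hj'
      simp only [Finset.mem_Ico] at hj hj'
      have : b (tc P.br j) = 0 := by
        by_contra h0
        obtain ⟨i, hi⟩ := hb _ h0
        exact hm ((tc_inj hi).2 m (by omega))
      simp [this]

theorem tN_branch {σ : ℕ → ℕ} {b : ℕ →₀ ℝ} (hb : ∀ k, b k ≠ 0 → ∃ j, k = tc σ j) {M : ℝ}
    (hM : ∀ p q, ‖segS u ⟨σ, p, q⟩ b‖ ≤ M) : tN u b ≤ M := by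
  classical
  have hM0 : 0 ≤ M := (norm_nonneg _).trans (hM 0 0)
  refine tN_le u hM0 fun G hG => ?_
  have hP : ∀ P : TSeg, ‖segS u P b‖ ^ 2 ≤ M ^ 2 := by
    intro P
    obtain ⟨hi, h⟩ := segS_branch u hb P
    rw [h]
    exact pow_le_pow_left₀ (norm_nonneg _) (hM _ _) 2
  by_cases h : ∃ P ∈ G, segS u P b ≠ 0
  · obtain ⟨P, hPG, hP0⟩ := h
    rw [qn, Finset.sum_eq_single P]
    · exact hP P
    · intro Q hQ hne
      by_contra h0
      have hQ0 : segS u Q b ≠ 0 := fun h => h0 (by simp [h])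
      obtain ⟨i, h1, -, h2⟩ := exists_of_segS_ne u hP0
      obtain ⟨j, h3, -, h4⟩ := exists_of_segS_ne u hQ0
      obtain ⟨i', h5⟩ := hb _ h2
      obtain ⟨j', h6⟩ := hb _ h4
      exact (hG P hPG Q hQ hne.symm).absurd_branch h1 h3 h5 h6
    · intro h; exact absurd hPG h
  · push Not at h
    rw [qn, Finset.sum_eq_zero]
    · positivity
    · intro P hP
      simp [h P hP]

theorem tN_single_pos {k : ℕ} (hk : u k ≠ 0) : 0 < tN u (Finsupp.single k 1) := by
  have h := segS_le_tN u ⟨nbr k, nlv k, nlv k + 1⟩ (Finsupp.single k 1)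
  rw [segS_apply] at h
  simp only [Nat.Ico_succ_singleton, Finset.sum_singleton, tc_nbr_nlv, Finsupp.single_eq_same,
    one_smul] at h
  exact (norm_pos_iff.2 hk).trans_le h

end TreeNorm

/-! ### Part 3: branch functionals are norm dense -/

/-- The tree order on (codes of) nodes. -/
def tle (q k : ℕ) : Prop := nlv q ≤ nlv k ∧ ∀ i ≤ nlv q, nbr q i = nbr k i

theorem tle_refl (q : ℕ) : tle q q := ⟨le_rfl, fun _ _ => rfl⟩

theorem tle_trans {p q k : ℕ} (h1 : tle p q) (h2 : tle q k) : tle p k :=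
  ⟨h1.1.trans h2.1, fun i hi => (h1.2 i hi).trans (h2.2 i (hi.trans h1.1))⟩

theorem tle_tc {q : ℕ} {τ : ℕ → ℕ} {j : ℕ} :
    tle q (tc τ j) ↔ nlv q ≤ j ∧ ∀ i ≤ nlv q, nbr q i = τ i := by
  simp only [tle, nlv_tc]
  refine and_congr_right fun h => forall_congr' fun i => forall_congr' fun hi => ?_
  rw [nbr_tc τ j i (hi.trans h)]

theorem tle_tc_iff {q : ℕ} {τ : ℕ → ℕ} {j : ℕ} :
    tle q (tc τ j) ↔ ∃ i ≤ j, tc τ i = q := by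
  rw [tle_tc]
  constructor
  · rintro ⟨h1, h2⟩
    refine ⟨nlv q, h1, ?_⟩
    rw [← tc_congr h2, tc_nbr_nlv]
  · rintro ⟨i, hi, rfl⟩
    rw [nlv_tc]
    exact ⟨hi, nbr_tc τ i⟩

theorem tle_comparable {p q k : ℕ} (h1 : tle p k) (h2 : tle q k) : tle p q ∨ tle q p := by
  rcases le_total (nlv p) (nlv q) with h | h
  · exact Or.inl ⟨h, fun i hi => (h1.2 i hi).trans (h2.2 i (hi.trans h)).symm⟩
  · exact Or.inr ⟨h, fun i hi => (h2.2 i hi).trans (h1.2 i (hi.trans h)).symm⟩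

theorem tle_incomp {p q : ℕ} (h1 : ¬ tle p q) (h2 : ¬ tle q p) :
    ∃ m, m ≤ nlv p ∧ m ≤ nlv q ∧ nbr p m ≠ nbr q m := by
  by_contra! h
  rcases le_total (nlv p) (nlv q) with h3 | h3
  · exact h1 ⟨h3, fun i hi => h i hi (hi.trans h3)⟩
  · exact h2 ⟨h3, fun i hi => (h i (hi.trans h3) hi).symm⟩

theorem chain_branch (S : Set ℕ) (hS : ∀ k ∈ S, ∀ l ∈ S, tle k l ∨ tle l k) :
    ∃ σ : ℕ → ℕ, ∀ k ∈ S, ∃ j, k = tc σ j := by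
  classical
  let σ : ℕ → ℕ := fun n => if h : ∃ k ∈ S, n ≤ nlv k then nbr h.choose n else 0
  refine ⟨σ, fun k hk => ⟨nlv k, ?_⟩⟩
  conv_lhs => rw [← tc_nbr_nlv k]
  refine tc_congr fun i hi => ?_
  have h : ∃ k ∈ S, i ≤ nlv k := ⟨k, hk, hi⟩
  simp only [σ, dif_pos h]
  obtain ⟨h1, h2⟩ := h.choose_spec
  rcases hS k hk _ h1 with h3 | h3
  · exact h3.2 i hi
  · exact (h3.2 i h2).symm

/-- Finite antichains of nodes. -/
def NAnti (Q : Finset ℕ) : Prop := ∀ p ∈ Q, ∀ q ∈ Q, p ≠ q → ¬ tle p q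

theorem cover_branches (H : Set ℕ) (M : ℕ)
    (hM : ∀ Q : Finset ℕ, NAnti Q → (∀ q ∈ Q, q ∈ H) → Q.card ≤ M) :
    ∃ s : Finset (ℕ → ℕ), ∀ k ∈ H, ∃ σ ∈ s, ∃ j, k = tc σ j := by
  classical
  let p : ℕ → Prop := fun n => ∃ Q : Finset ℕ, NAnti Q ∧ (∀ q ∈ Q, q ∈ H) ∧ Q.card = n
  have hp0 : p 0 := ⟨∅, by intro q hq; simp at hq, by simp, rfl⟩
  obtain ⟨Q, hQ1, hQ2, hQ3⟩ := Nat.findGreatest_spec (P := p) (n := M) (Nat.zero_le _) hp0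
  have hmax : ∀ R : Finset ℕ, NAnti R → (∀ q ∈ R, q ∈ H) → R.card ≤ Q.card := by
    intro R hR1 hR2
    rw [hQ3]
    exact Nat.le_findGreatest (hM R hR1 hR2) ⟨R, hR1, hR2, rfl⟩
  have hchain : ∀ q ∈ Q, ∀ k ∈ {k | k ∈ H ∧ tle q k}, ∀ l ∈ {k | k ∈ H ∧ tle q k},
      tle k l ∨ tle l k := by
    rintro q hq k ⟨hk, hqk⟩ l ⟨hl, hql⟩
    by_contra! hkl
    have hne : k ≠ l := fun h => hkl.1 (h ▸ tle_refl k)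
    have hout : ∀ r ∈ Q.erase q, ∀ m, tle q m → ¬ tle r m ∧ ¬ tle m r := by
      intro r hr m hm
      rw [Finset.mem_erase] at hr
      constructor
      · intro h
        rcases tle_comparable h hm with h' | h'
        · exact hQ1 r hr.2 q hq hr.1 h'
        · exact hQ1 q hq r hr.2 hr.1.symm h'
      · intro h
        exact hQ1 q hq r hr.2 hr.1.symm (tle_trans hm h)
    have hkQ : k ∉ Q.erase q := fun h => (hout k h k hqk).1 (tle_refl k)
    have hlQ : l ∉ Q.erase q := fun h => (hout l h l hql).1 (tle_refl l)
    have h1 := hmax (insert k (insert l (Q.erase q))) (by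
      intro a ha b hb hab
      simp only [Finset.mem_insert] at ha hb
      rcases ha with rfl | rfl | ha <;> rcases hb with rfl | rfl | hb
      · exact absurd rfl hab
      · exact hkl.1
      · exact (hout b hb _ hqk).2
      · exact hkl.2
      · exact absurd rfl hab
      · exact (hout b hb _ hql).2
      · exact (hout a ha _ hqk).1
      · exact (hout a ha _ hql).1
      · exact hQ1 a (Finset.mem_of_mem_erase ha) b (Finset.mem_of_mem_erase hb) hab) (by
      intro a ha
      simp only [Finset.mem_insert] at ha
      rcases ha with rfl | rfl | ha
      · exact hk
      · exact hl
      · exact hQ2 a (Finset.mem_of_mem_erase ha))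
    rw [Finset.card_insert_of_notMem (by simp only [Finset.mem_insert, not_or]; exact ⟨hne, hkQ⟩),
      Finset.card_insert_of_notMem hlQ, Finset.card_erase_of_mem hq] at h1
    have := Finset.card_pos.2 ⟨q, hq⟩
    omega
  have hb : ∀ q, ∃ σ : ℕ → ℕ, q ∈ Q → ∀ k ∈ {k | k ∈ H ∧ tle q k}, ∃ j, k = tc σ j := by
    intro q
    by_cases hq : q ∈ Q
    · obtain ⟨σ, hσ⟩ := chain_branch _ (hchain q hq)
      exact ⟨σ, fun _ => hσ⟩
    · exact ⟨0, fun h => absurd h hq⟩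
  choose σ hσ using hb
  refine ⟨Q.image σ, fun k hk => ?_⟩
  have : ∃ q ∈ Q, tle q k ∨ tle k q := by
    by_contra! h
    have hkQ : k ∉ Q := fun hk' => (h k hk').1 (tle_refl k)
    have h1 := hmax (insert k Q) (by
      intro a ha b hb hab
      simp only [Finset.mem_insert] at ha hb
      rcases ha with rfl | ha <;> rcases hb with rfl | hb
      · exact absurd rfl hab
      · exact (h b hb).2
      · exact (h a ha).1
      · exact hQ1 a ha b hb hab) (by
      intro a ha
      simp only [Finset.mem_insert] at ha
      rcases ha with rfl | ha
      · exact hk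
      · exact hQ2 a ha)
    rw [Finset.card_insert_of_notMem hkQ] at h1
    omega
  obtain ⟨q, hq, h⟩ := this
  refine ⟨σ q, Finset.mem_image_of_mem _ hq, ?_⟩
  rcases h with h | h
  · exact hσ q hq k ⟨hk, h⟩
  · obtain ⟨j, hj⟩ := hσ q hq q ⟨hQ2 q hq, tle_refl q⟩
    rw [hj, tle_tc_iff] at h
    obtain ⟨i, -, hi⟩ := h
    exact ⟨i, hi.symm⟩

section LemmaC

variable {V : Type*} [NormedAddCommGroup V] [NormedSpace ℝ V] (u : ℕ → V)

/-- Step C1: flat vectors are almost annihilated. -/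
theorem flat_small (φ : (ℕ →₀ ℝ) →ₗ[ℝ] ℝ) {C : ℝ} (hφ : ∀ a, |φ a| ≤ C * tN u a) {η : ℝ}
    (hη : 0 < η) :
    ∃ κ > 0, ∀ a, tN u a ≤ 1 → (∀ P, ‖segS u P a‖ ≤ κ) → φ a ≤ η := by
  classical
  by_contra! hcon
  have key : ∀ n : ℕ, ∃ b, tN u b ^ 2 ≤ 2 * n ∧ n * η ≤ φ b := by
    intro n
    induction n with
    | zero =>
      refine ⟨0, ?_, by simp⟩
      have : tN u 0 = 0 := map_zero (tSN u)
      simp [this]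
    | succ n ih =>
      obtain ⟨b, hb1, hb2⟩ := ih
      set s : ℝ := (b.support.card : ℝ) with hs
      have hs0 : 0 ≤ s := Nat.cast_nonneg _
      have hN0 := tN_nonneg u b
      have hD : 0 < 2 * s * tN u b + 1 := by positivity
      obtain ⟨a, ha1, ha2, ha3⟩ := hcon (1 / (2 * s * tN u b + 1)) (by positivity)
      set κ : ℝ := 1 / (2 * s * tN u b + 1) with hκ
      have hκ0 : 0 < κ := by positivity
      have hκ1 : 2 * s * tN u b * κ ≤ 1 := by
        rw [hκ, mul_one_div, div_le_one hD]
        linarith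
      refine ⟨b + a, ?_, ?_⟩
      · have h2 : tN u (b + a) ≤ √(2 * n + 2) := by
          refine tN_le u (Real.sqrt_nonneg _) fun G hG => ?_
          rw [Real.sq_sqrt (by positivity)]
          have hqb := qn_le_tN u hG b
          have hqa := qn_le_tN u hG a
          have hqa' : tN u a ^ 2 ≤ 1 := by
            have := tN_nonneg u a
            nlinarith
          have h3 : qn u G (b + a) ≤ ∑ P ∈ G, (‖segS u P b‖ ^ 2 + ‖segS u P a‖ ^ 2 +
              if segS u P b ≠ 0 then 2 * tN u b * κ else 0) := by
            refine Finset.sum_le_sum fun P _ => ?_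
            rw [map_add]
            split_ifs with h0
            · have e1 := norm_add_le (segS u P b) (segS u P a)
              have e2 := segS_le_tN u P b
              have e3 := ha2 P
              have e4 := norm_nonneg (segS u P b)
              have e5 := norm_nonneg (segS u P a)
              have e6 : ‖segS u P b‖ * ‖segS u P a‖ ≤ tN u b * κ := mul_le_mul e2 e3 e5 hN0
              calc ‖segS u P b + segS u P a‖ ^ 2 ≤ (‖segS u P b‖ + ‖segS u P a‖) ^ 2 :=
                    pow_le_pow_left₀ (norm_nonneg _) e1 2
                _ ≤ _ := by nlinarith
            · push Not at h0
              simp [h0]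
          rw [Finset.sum_add_distrib, Finset.sum_add_distrib, ← Finset.sum_filter,
            Finset.sum_const, nsmul_eq_mul] at h3
          have h4 : ((G.filter fun P => segS u P b ≠ 0).card : ℝ) ≤ s := by
            rw [hs]
            exact_mod_cast card_meet u hG b
          have h5 := mul_le_mul_of_nonneg_right h4 (show 0 ≤ 2 * tN u b * κ by positivity)
          simp only [qn] at hqa hqb h3 ⊢
          nlinarith
        have h3 := pow_le_pow_left₀ (tN_nonneg u _) h2 2
        rw [Real.sq_sqrt (by positivity)] at h3
        push_cast
        linarith
      · rw [map_add]
        push_cast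
        linarith
  obtain ⟨n, hn⟩ := exists_nat_gt (2 * C ^ 2 / η ^ 2)
  obtain ⟨b, hb1, hb2⟩ := key (n + 1)
  have h1 := (le_abs_self _).trans (hφ b)
  have h2 : ((n + 1 : ℕ) : ℝ) * η ≤ C * tN u b := hb2.trans h1
  have h3 : (((n + 1 : ℕ) : ℝ) * η) ^ 2 ≤ (C * tN u b) ^ 2 := pow_le_pow_left₀ (by positivity) h2 2
  rw [div_lt_iff₀ (by positivity)] at hn
  push_cast at *
  have h4 : (C * tN u b) ^ 2 ≤ C ^ 2 * (2 * (n + 1)) := by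
    rw [mul_pow]
    exact mul_le_mul_of_nonneg_left hb1 (sq_nonneg _)
  have h5 : ((n : ℝ) + 1) * (((n : ℝ) + 1) * η ^ 2) ≤ ((n : ℝ) + 1) * (2 * C ^ 2) := by
    nlinarith
  have h6 := le_of_mul_le_mul_left h5 (by positivity)
  nlinarith [sq_nonneg η]

/-- Step C2: antichains of heavy nodes are bounded. -/
theorem heavy_card (φ : (ℕ →₀ ℝ) →ₗ[ℝ] ℝ) {C : ℝ} (hφ : ∀ a, |φ a| ≤ C * tN u a) {ε : ℝ}
    (hε : 0 < ε) (Q : Finset ℕ) (hQ : NAnti Q)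
    (hH : ∀ q ∈ Q, ∃ a : ℕ →₀ ℝ, (∀ k, a k ≠ 0 → tle q k) ∧ tN u a ≤ 1 ∧ ε < φ a) :
    Q.card * ε ^ 2 ≤ C ^ 2 := by
  classical
  choose! a ha1 ha2 ha3 using hH
  have hsum : Q.card * ε ≤ φ (∑ q ∈ Q, a q) := by
    rw [map_sum, ← nsmul_eq_mul]
    exact Finset.card_nsmul_le_sum _ _ _ fun q hq => (ha3 q hq).le
  have hN : tN u (∑ q ∈ Q, a q) ≤ √(Q.card) := by
    refine tN_le u (Real.sqrt_nonneg _) fun G hG => ?_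
    rw [Real.sq_sqrt (Nat.cast_nonneg _)]
    have h1 : ∀ P : TSeg, ‖segS u P (∑ q ∈ Q, a q)‖ ^ 2 ≤ ∑ q ∈ Q, ‖segS u P (a q)‖ ^ 2 := by
      intro P
      rw [map_sum]
      by_cases h : ∃ q ∈ Q, segS u P (a q) ≠ 0
      · obtain ⟨q, hq, hq0⟩ := h
        rw [Finset.sum_eq_single q]
        · exact Finset.single_le_sum (f := fun q => ‖segS u P (a q)‖ ^ 2)
            (fun _ _ => by positivity) hq
        · intro r hr hrq
          by_contra hr0
          obtain ⟨i, -, -, hi⟩ := exists_of_segS_ne u hq0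
          obtain ⟨j, -, -, hj⟩ := exists_of_segS_ne u hr0
          have h2 := ha1 q hq _ hi
          have h3 := ha1 r hr _ hj
          have h4 : tle q (tc P.br (max i j)) :=
            tle_trans h2 (tle_tc_iff.2 ⟨i, le_max_left _ _, rfl⟩)
          have h5 : tle r (tc P.br (max i j)) :=
            tle_trans h3 (tle_tc_iff.2 ⟨j, le_max_right _ _, rfl⟩)
          rcases tle_comparable h4 h5 with h | h
          · exact hQ q hq r hr hrq.symm h
          · exact hQ r hr q hq hrq h
        · intro h; exact absurd hq h
      · push Not at h
        rw [Finset.sum_eq_zero h]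
        rw [norm_zero, zero_pow two_ne_zero]
        exact Finset.sum_nonneg fun _ _ => by positivity
    calc qn u G (∑ q ∈ Q, a q) ≤ ∑ P ∈ G, ∑ q ∈ Q, ‖segS u P (a q)‖ ^ 2 :=
          Finset.sum_le_sum fun P _ => h1 P
      _ = ∑ q ∈ Q, ∑ P ∈ G, ‖segS u P (a q)‖ ^ 2 := Finset.sum_comm
      _ ≤ ∑ q ∈ Q, (1 : ℝ) := Finset.sum_le_sum fun q hq => by
          have h3 := qn_le_tN u hG (a q)
          have h4 := tN_nonneg u (a q)
          have h5 := ha2 q hq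
          simp only [qn] at h3
          nlinarith
      _ = Q.card := by simp
  rcases Q.eq_empty_or_nonempty with rfl | hne
  · simp only [Finset.card_empty, Nat.cast_zero, zero_mul]
    positivity
  have hc : (0 : ℝ) < Q.card := by exact_mod_cast Finset.card_pos.2 hne
  have h1 := hsum.trans ((le_abs_self _).trans (hφ _))
  have h2 : (Q.card * ε) ^ 2 ≤ (C * tN u (∑ q ∈ Q, a q)) ^ 2 :=
    pow_le_pow_left₀ (by positivity) h1 2
  have h3 : tN u (∑ q ∈ Q, a q) ^ 2 ≤ Q.card := by
    have := pow_le_pow_left₀ (tN_nonneg u _) hN 2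
    rwa [Real.sq_sqrt (Nat.cast_nonneg _)] at this
  rw [mul_pow, mul_pow] at h2
  have h4 := mul_le_mul_of_nonneg_left h3 (sq_nonneg C)
  have h5 : (Q.card : ℝ) * (Q.card * ε ^ 2) ≤ Q.card * C ^ 2 := by nlinarith
  exact le_of_mul_le_mul_left h5 hc

end LemmaC

instance : Inhabited TSeg := ⟨⟨0, 0, 0⟩⟩

section LemmaC2

variable {V : Type*} [NormedAddCommGroup V] [NormedSpace ℝ V] (u : ℕ → V)

/-- The set of nodes on the branches of `s`. -/
def onBr (s : Finset (ℕ → ℕ)) (k : ℕ) : Prop := ∃ σ ∈ s, ∃ j, k = tc σ j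

theorem onBr_down {s : Finset (ℕ → ℕ)} {q k : ℕ} (h : tle q k) (hk : onBr s k) : onBr s q := by
  obtain ⟨σ, hσ, j, rfl⟩ := hk
  obtain ⟨i, -, hi⟩ := tle_tc_iff.1 h
  exact ⟨σ, hσ, i, hi.symm⟩

theorem tle_tc_mono (τ : ℕ → ℕ) {i j : ℕ} (h : i ≤ j) : tle (tc τ i) (tc τ j) :=
  tle_tc_iff.2 ⟨i, h, rfl⟩

/-- Minimal node off the branches. -/
def minOff (s : Finset (ℕ → ℕ)) (q : ℕ) : Prop := ¬ onBr s q ∧ ∀ p, tle p q → p ≠ q → onBr s p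

theorem exists_minOff {s : Finset (ℕ → ℕ)} {k : ℕ} (hk : ¬ onBr s k) :
    ∃ q, minOff s q ∧ tle q k := by
  classical
  rw [← tc_nbr_nlv k] at hk
  have hex : ∃ i, ¬ onBr s (tc (nbr k) i) := ⟨_, hk⟩
  have hle : Nat.find hex ≤ nlv k := Nat.find_min' hex hk
  refine ⟨tc (nbr k) (Nat.find hex), ⟨Nat.find_spec hex, fun p hp hne => ?_⟩, ?_⟩
  · obtain ⟨i, hi, rfl⟩ := tle_tc_iff.1 hp
    have : i ≠ Nat.find hex := fun h => hne (by rw [← h])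
    exact not_not.1 (Nat.find_min hex (lt_of_le_of_ne hi this))
  · conv_rhs => rw [← tc_nbr_nlv k]
    exact tle_tc_mono _ hle

theorem minOff_anti {s : Finset (ℕ → ℕ)} {p q : ℕ} (hp : minOff s p) (hq : minOff s q)
    (hne : p ≠ q) : ¬ tle p q := fun h => hp.1 (hq.2 p h hne)

open Classical in
/-- Step C4. -/
theorem off_small (φ : (ℕ →₀ ℝ) →ₗ[ℝ] ℝ) {κ η : ℝ}
    (hκ : 0 < κ) (hη : 0 < η)
    (hflat : ∀ a, tN u a ≤ 1 → (∀ P, ‖segS u P a‖ ≤ κ) → φ a ≤ η)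
    (s : Finset (ℕ → ℕ))
    (hs : ∀ q, (∃ a : ℕ →₀ ℝ, (∀ k, a k ≠ 0 → tle q k) ∧ tN u a ≤ 1 ∧ κ ^ 2 * η < φ a) → onBr s q)
    (a : ℕ →₀ ℝ) (ha : ∀ k, a k ≠ 0 → ¬ onBr s k) (haN : tN u a ≤ 1) : φ a ≤ 2 * η := by
  let B : Set ℕ := {q | minOff s q ∧ ∃ P : TSeg, tle q (tc P.br P.lo) ∧ κ < ‖segS u P a‖}
  have hcard : ∀ B' : Finset ℕ, (∀ q ∈ B', q ∈ B) → B'.card * κ ^ 2 ≤ 1 := by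
    intro B' hB'
    have h1 : ∀ q ∈ B', ∃ P : TSeg, tle q (tc P.br P.lo) ∧ κ < ‖segS u P a‖ :=
      fun q hq => (hB' q hq).2
    choose! P hP1 hP2 using h1
    have h2 := fam_le_tN u B' P (by
      intro p hp q hq hne
      obtain ⟨m, k1, k2, k3⟩ := tle_incomp (minOff_anti (hB' p hp).1 (hB' q hq).1 hne)
        (minOff_anti (hB' q hq).1 (hB' p hp).1 hne.symm)
      have e1 := tle_tc.1 (hP1 p hp)
      have e2 := tle_tc.1 (hP1 q hq)
      refine ⟨m, k1.trans e1.1, k2.trans e2.1, ?_⟩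
      rw [← e1.2 m k1, ← e2.2 m k2]
      exact k3) a
    have h3 : (B'.card : ℝ) * κ ^ 2 ≤ ∑ q ∈ B', ‖segS u (P q) a‖ ^ 2 := by
      rw [← nsmul_eq_mul]
      exact Finset.card_nsmul_le_sum _ _ _ fun q hq =>
        pow_le_pow_left₀ hκ.le (hP2 q hq).le 2
    have := tN_nonneg u a
    nlinarith
  have hfin : B.Finite := by
    by_contra hinf
    obtain ⟨n, hn⟩ := exists_nat_gt (1 / κ ^ 2)
    obtain ⟨B', hB'1, hB'2⟩ := Set.Infinite.exists_subset_card_eq hinf n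
    have := hcard B' fun q hq => hB'1 hq
    rw [hB'2] at this
    rw [div_lt_iff₀ (by positivity)] at hn
    linarith
  obtain ⟨B', hB'⟩ := hfin.exists_finset
  have hBc := hcard B' fun q hq => (hB' q).1 hq
  let T : ℕ → Prop := fun k => ¬ onBr s k ∧ ¬ ∃ q ∈ B', tle q k
  have hT : ∀ τ, ({j | T (tc τ j)} : Set ℕ).OrdConnected := by
    intro τ
    refine ⟨fun i hi j hj l hl => ⟨fun h => hi.1 (onBr_down (tle_tc_mono τ hl.1) h), ?_⟩⟩
    rintro ⟨q, hq, hql⟩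
    exact hj.2 ⟨q, hq, tle_trans hql (tle_tc_mono τ hl.2)⟩
  have hU : ∀ q τ, ({j | tle q (tc τ j)} : Set ℕ).OrdConnected := by
    intro q τ
    exact ⟨fun i hi j hj l hl => tle_trans hi (tle_tc_mono τ hl.1)⟩
  have hdec : a = a.filter T + ∑ q ∈ B', a.filter (tle q) := by
    ext k
    rw [Finsupp.add_apply, Finsupp.finsetSum_apply]
    by_cases h0 : a k = 0
    · simp [Finsupp.filter_apply, h0]
    by_cases hk : ∃ q ∈ B', tle q k
    · obtain ⟨q, hq, hqk⟩ := hk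
      rw [Finset.sum_eq_single q, Finsupp.filter_apply_neg, Finsupp.filter_apply_pos _ _ hqk,
        zero_add]
      · exact fun h => h.2 ⟨q, hq, hqk⟩
      · intro r hr hrq
        refine Finsupp.filter_apply_neg _ _ fun h => ?_
        have e1 := ((hB' q).1 hq).1
        have e2 := ((hB' r).1 hr).1
        rcases tle_comparable hqk h with h' | h'
        · exact minOff_anti e1 e2 hrq.symm h'
        · exact minOff_anti e2 e1 hrq h'
      · intro h; exact absurd hq h
    · rw [Finset.sum_eq_zero, add_zero, Finsupp.filter_apply_pos]
      · exact ⟨ha k h0, hk⟩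
      · intro q hq
        exact Finsupp.filter_apply_neg _ _ fun h => hk ⟨q, hq, h⟩
  have h1 : φ (a.filter T) ≤ η := by
    refine hflat _ ((tN_filter u T hT a).trans haN) fun P => ?_
    obtain ⟨lo, hi, -, h2, h3⟩ := segS_filter u T P (hT P.br) a
    rw [h2]
    by_contra! hcon
    have hlt : lo < hi := by
      by_contra! hle
      rw [segS_apply] at hcon
      simp only [Finset.Ico_eq_empty_of_le hle, Finset.sum_empty, norm_zero] at hcon
      linarith
    have h4 := h3 lo le_rfl hlt
    obtain ⟨q, hq1, hq2⟩ := exists_minOff h4.1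
    exact h4.2 ⟨q, (hB' q).2 ⟨hq1, ⟨P.br, lo, hi⟩, hq2, hcon⟩, hq2⟩
  have h2 : ∀ q ∈ B', φ (a.filter (tle q)) ≤ κ ^ 2 * η := by
    intro q hq
    by_contra! hcon
    refine ((hB' q).1 hq).1.1 (hs q ⟨a.filter (tle q), fun k hk => ?_, ?_, hcon⟩)
    · by_contra h
      exact hk (Finsupp.filter_apply_neg _ _ h)
    · exact (tN_filter u _ (hU q) a).trans haN
  have h3 : ∑ q ∈ B', φ (a.filter (tle q)) ≤ B'.card * (κ ^ 2 * η) := by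
    rw [← nsmul_eq_mul]
    exact Finset.sum_le_card_nsmul _ _ _ h2
  have h4 : φ a = φ (a.filter T) + ∑ q ∈ B', φ (a.filter (tle q)) := by
    conv_lhs => rw [hdec]
    rw [map_add, map_sum]
  have h5 : (B'.card : ℝ) * (κ ^ 2 * η) ≤ 1 * η := by
    rw [← mul_assoc]
    exact mul_le_mul_of_nonneg_right hBc hη.le
  linarith

/-- Bounded functionals supported on one branch. -/
def branchF : Set ((ℕ →₀ ℝ) →ₗ[ℝ] ℝ) :=
  {φ | (∃ σ : ℕ → ℕ, ∀ k, (∀ j, k ≠ tc σ j) → φ (Finsupp.single k 1) = 0) ∧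
    ∃ C, ∀ a, |φ a| ≤ C * tN u a}

open Classical in
/-- Composition with the restriction to a set of nodes. -/
noncomputable def restrF (φ : (ℕ →₀ ℝ) →ₗ[ℝ] ℝ) (T : ℕ → Prop) : (ℕ →₀ ℝ) →ₗ[ℝ] ℝ where
  toFun a := φ (a.filter T)
  map_add' a b := by rw [Finsupp.filter_add, map_add]
  map_smul' c a := by rw [Finsupp.filter_smul, map_smul]; rfl

open Classical in
theorem restrF_apply (φ : (ℕ →₀ ℝ) →ₗ[ℝ] ℝ) (T : ℕ → Prop) (a : ℕ →₀ ℝ) :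
    restrF φ T a = φ (a.filter T) := by
  simp only [restrF, LinearMap.coe_mk, AddHom.coe_mk]

theorem restrF_mem_span (φ : (ℕ →₀ ℝ) →ₗ[ℝ] ℝ) {C : ℝ} (hC : 0 ≤ C)
    (hφ : ∀ a, |φ a| ≤ C * tN u a)
    (s : Finset (ℕ → ℕ)) : restrF φ (onBr s) ∈ Submodule.span ℝ (branchF u) := by
  classical
  induction s using Finset.induction_on with
  | empty =>
    have : restrF φ (onBr ∅) = 0 := by
      ext k
      simp [restrF_apply, onBr]
    rw [this]
    exact Submodule.zero_mem _
  | insert σ s hσ ih =>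
    let T : ℕ → Prop := fun k => (∃ j, k = tc σ j) ∧ ¬ onBr s k
    have hT : ∀ τ, ({j | T (tc τ j)} : Set ℕ).OrdConnected := by
      intro τ
      refine ⟨fun i hi j hj l hl => ⟨?_, fun h => hi.2 (onBr_down (tle_tc_mono τ hl.1) h)⟩⟩
      obtain ⟨m, hm⟩ := hj.1
      have := tle_tc_mono τ hl.2
      rw [hm, tle_tc_iff] at this
      obtain ⟨i', -, hi'⟩ := this
      exact ⟨i', hi'.symm⟩
    have e : restrF φ (onBr (insert σ s)) = restrF φ (onBr s) + restrF φ T := by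
      refine LinearMap.ext fun a => ?_
      rw [LinearMap.add_apply, restrF_apply, restrF_apply, restrF_apply, ← map_add]
      congr 1
      ext k
      rw [Finsupp.add_apply]
      simp only [Finsupp.filter_apply]
      have hi : onBr (insert σ s) k ↔ (∃ j, k = tc σ j) ∨ onBr s k := by
        simp only [onBr, Finset.mem_insert]
        constructor
        · rintro ⟨τ, rfl | h, h2⟩
          · exact Or.inl h2
          · exact Or.inr ⟨τ, h, h2⟩
        · rintro (h | ⟨τ, h, h2⟩)
          · exact ⟨σ, Or.inl rfl, h⟩
          · exact ⟨τ, Or.inr h, h2⟩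
      by_cases h1 : onBr s k
      · rw [if_pos (hi.2 (Or.inr h1)), if_pos h1, if_neg (fun h => h.2 h1), add_zero]
      · by_cases h2 : ∃ j, k = tc σ j
        · rw [if_pos (hi.2 (Or.inl h2)), if_neg h1, if_pos ⟨h2, h1⟩, zero_add]
        · rw [if_neg (fun h => (hi.1 h).elim h2 h1), if_neg h1, if_neg (fun h => h2 h.1), add_zero]
    rw [e]
    refine Submodule.add_mem _ ih (Submodule.subset_span ⟨⟨σ, fun k hk => ?_⟩, C, fun a => ?_⟩)
    · rw [restrF_apply, Finsupp.filter_single_of_neg, map_zero]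
      rintro ⟨⟨j, hj⟩, -⟩
      exact hk j hj
    · rw [restrF_apply]
      refine (hφ _).trans (mul_le_mul_of_nonneg_left ?_ hC)
      have hh := tN_filter u T hT a
      convert hh
      rfl

/-- Lemma C: branch functionals span a norm dense subspace. -/
theorem branch_dense (φ : (ℕ →₀ ℝ) →ₗ[ℝ] ℝ) {C : ℝ} (hC : 0 ≤ C) (hφ : ∀ a, |φ a| ≤ C * tN u a)
    {η : ℝ} (hη : 0 < η) :
    ∃ ψ ∈ Submodule.span ℝ (branchF u), ∀ a, |φ a - ψ a| ≤ 2 * η * tN u a := by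
  classical
  obtain ⟨κ, hκ, hflat⟩ := flat_small u φ hφ hη
  let H : Set ℕ := {q | ∃ a : ℕ →₀ ℝ, (∀ k, a k ≠ 0 → tle q k) ∧ tN u a ≤ 1 ∧ κ ^ 2 * η < φ a}
  have hε : 0 < κ ^ 2 * η := by positivity
  obtain ⟨M, hM⟩ := exists_nat_gt (C ^ 2 / (κ ^ 2 * η) ^ 2)
  obtain ⟨s, hs⟩ := cover_branches H M (fun Q hQ hQH => by
    have := heavy_card u φ hφ hε Q hQ hQH
    have h2 : (Q.card : ℝ) ≤ C ^ 2 / (κ ^ 2 * η) ^ 2 := by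
      rwa [le_div_iff₀ (by positivity)]
    exact_mod_cast h2.trans hM.le)
  have hoff := off_small u φ hκ hη hflat s (fun q hq => hs q hq)
  have hoff2 : ∀ a : ℕ →₀ ℝ, (∀ k, a k ≠ 0 → ¬ onBr s k) → φ a ≤ 2 * η * tN u a := by
    intro a ha
    rcases (tN_nonneg u a).eq_or_lt with h0 | h0
    · have := (le_abs_self _).trans (hφ a)
      rw [← h0] at this ⊢
      simpa using this
    · have h1 := hoff ((tN u a)⁻¹ • a) (fun k hk => ha k (fun h => hk (by simp [h]))) (by
        have : tN u ((tN u a)⁻¹ • a) = ‖(tN u a)⁻¹‖ * tN u a := map_smul_eq_mul (tSN u) _ _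
        rw [this, norm_inv, Real.norm_of_nonneg h0.le, inv_mul_cancel₀ h0.ne'])
      rw [map_smul, smul_eq_mul, inv_mul_le_iff₀ h0] at h1
      linarith
  refine ⟨restrF φ (onBr s), restrF_mem_span u φ hC hφ s, fun a => ?_⟩
  have e : φ a - restrF φ (onBr s) a = φ (a.filter fun k => ¬ onBr s k) := by
    rw [restrF_apply, ← map_sub]
    congr 1
    rw [sub_eq_iff_eq_add]
    conv_lhs => rw [← Finsupp.filter_add_filter_not a (onBr s)]
    rw [add_comm]
  rw [e]
  have hN : tN u (a.filter fun k => ¬ onBr s k) ≤ tN u a := by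
    refine tN_filter u _ (fun τ => ?_) a
    exact ⟨fun i hi j hj l hl h => hi (onBr_down (tle_tc_mono τ hl.1) h)⟩
  have h1 := hoff2 (a.filter fun k => ¬ onBr s k) (fun k hk h => hk (by
    rw [Finsupp.filter_apply_neg]; exact not_not.2 h))
  have h2 := hoff2 (-(a.filter fun k => ¬ onBr s k)) (fun k hk h => hk (by
    rw [Finsupp.neg_apply, Finsupp.filter_apply_neg, neg_zero]; exact not_not.2 h))
  have h3 : tN u (-(a.filter fun k => ¬ onBr s k)) = tN u (a.filter fun k => ¬ onBr s k) :=
    map_neg_eq_map (tSN u) _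
  rw [h3, map_neg] at h2
  have h4 : 2 * η * tN u (a.filter fun k => ¬ onBr s k) ≤ 2 * η * tN u a :=
    mul_le_mul_of_nonneg_left hN (by positivity)
  rw [abs_le]
  constructor <;> linarith

end LemmaC2

section LemmaR

/-- Cylinders in the Cantor set. -/
def cyl (x : CantorSet) (k : ℕ) : Set CantorSet := {y | ∀ i < k, y i = x i}

theorem cyl_clopen (x : CantorSet) (k : ℕ) : IsClopen (cyl x k) := by
  have : cyl x k = ⋂ i ∈ Finset.range k, {y : CantorSet | y i = x i} := by
    ext y; simp [cyl]
  rw [this]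
  refine isClopen_biInter_finset fun i _ => ?_
  exact (isClopen_discrete ({x i} : Set Bool)).preimage (continuous_apply i)

theorem mem_cyl_self (x : CantorSet) (k : ℕ) : x ∈ cyl x k := fun _ _ => rfl

theorem cyl_anti (x : CantorSet) {k l : ℕ} (h : k ≤ l) : cyl x l ⊆ cyl x k :=
  fun _ hy i hi => hy i (hi.trans_le h)

theorem cyl_eq {x y : CantorSet} {k : ℕ} (h : y ∈ cyl x k) : cyl y k = cyl x k := by
  ext z
  constructor
  · intro hz i hi; rw [hz i hi, h i hi]
  · intro hz i hi; rw [hz i hi, h i hi]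

theorem exists_not_mem_cyl {x y : CantorSet} (h : y ≠ x) : ∃ k, ∀ l, k ≤ l → y ∉ cyl x l := by
  obtain ⟨i, hi⟩ := Function.ne_iff.1 h
  exact ⟨i + 1, fun l hl hy => hi (hy i (by omega))⟩

open Classical in
/-- Indicator function of a clopen set, as an element of `C(2^ℕ)`. -/
noncomputable def indC (A : Set CantorSet) : CantorC :=
  if h : IsClopen A then ⟨fun x => if x ∈ A then 1 else 0, by
    refine IsLocallyConstant.continuous ?_
    rw [IsLocallyConstant.iff_exists_open]
    intro x
    by_cases hx : x ∈ A
    · exact ⟨A, h.isOpen, hx, fun y hy => by simp [hx, hy]⟩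
    · exact ⟨Aᶜ, h.compl.isOpen, hx, fun y hy => by
        have : y ∉ A := hy
        simp [hx, this]⟩⟩
  else 0

theorem indC_mem {A : Set CantorSet} (h : IsClopen A) {x} (hx : x ∈ A) : indC A x = 1 := by
  simp [indC, h, hx]

theorem indC_not_mem {A : Set CantorSet} {x} (hx : x ∉ A) : indC A x = 0 := by
  by_cases h : IsClopen A <;> simp [indC, h, hx]

theorem indC_norm (A : Set CantorSet) : ‖indC A‖ ≤ 1 := by
  rw [ContinuousMap.norm_le _ zero_le_one]
  intro x
  by_cases h : IsClopen A
  · by_cases hx : x ∈ A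
    · rw [indC_mem h hx]; simp
    · rw [indC_not_mem hx]; simp
  · simp [indC, h]

theorem norm_indC_mul (A : Set CantorSet) (f : CantorC) : ‖indC A * f‖ ≤ ‖f‖ :=
  (norm_mul_le _ _).trans (by
    have := mul_le_mul_of_nonneg_right (indC_norm A) (norm_nonneg f); linarith)

/-- Disjointly supported functions: the sum of values of a functional is bounded. -/
theorem sum_disj_le {ι : Type*} (ν : CantorC →L[ℝ] ℝ) (s : Finset ι) (f : ι → CantorC)
    (hf : ∀ i ∈ s, ‖f i‖ ≤ 1)
    (hd : ∀ i ∈ s, ∀ j ∈ s, i ≠ j → ∀ x, f i x = 0 ∨ f j x = 0) :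
    ∑ i ∈ s, |ν (f i)| ≤ ‖ν‖ := by
  classical
  let g : CantorC := ∑ i ∈ s, (SignType.sign (ν (f i)) : ℝ) • f i
  have hg : ‖g‖ ≤ 1 := by
    rw [ContinuousMap.norm_le _ zero_le_one]
    intro x
    simp only [g, ContinuousMap.coe_sum, Finset.sum_apply, ContinuousMap.coe_smul, Pi.smul_apply]
    by_cases h : ∃ i ∈ s, f i x ≠ 0
    · obtain ⟨i, hi, hix⟩ := h
      rw [Finset.sum_eq_single_of_mem i hi]
      · rw [smul_eq_mul, norm_mul]
        have h1 : ‖((SignType.sign (ν (f i)) : SignType) : ℝ)‖ ≤ 1 := by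
          rcases SignType.sign (ν (f i)) <;> simp
        have h2 := (f i).norm_coe_le_norm x
        have h3 := hf i hi
        have := mul_le_mul h1 (h2.trans h3) (norm_nonneg _) zero_le_one
        linarith
      · intro j hj hne
        rcases hd j hj i hi hne x with h | h
        · rw [h, smul_zero]
        · exact absurd h hix
    · push Not at h
      rw [Finset.sum_eq_zero fun i hi => by rw [h i hi, smul_zero]]
      simp
  have h1 : ν g = ∑ i ∈ s, |ν (f i)| := by
    simp only [g, map_sum, map_smul, smul_eq_mul, sign_mul_self]
  rw [← h1]
  refine (le_abs_self _).trans ((ν.le_opNorm g).trans ?_)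
  have := mul_le_mul_of_nonneg_left hg (norm_nonneg ν)
  linarith

/-- `ν` is `η`-small on `V`. -/
def SmallOn (ν : CantorC →L[ℝ] ℝ) (V : Set CantorSet) (η : ℝ) : Prop :=
  ∀ f : CantorC, (∀ x, x ∉ V → f x = 0) → |ν f| ≤ η * ‖f‖

theorem SmallOn.mono {ν : CantorC →L[ℝ] ℝ} {V V' : Set CantorSet} {η : ℝ} (h : SmallOn ν V η)
    (hV : V' ⊆ V) : SmallOn ν V' η :=
  fun f hf => h f fun x hx => hf x fun h' => hx (hV h')

theorem not_smallOn {ν : CantorC →L[ℝ] ℝ} {V : Set CantorSet} {η : ℝ} (hη : 0 < η)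
    (h : ¬ SmallOn ν V η) : ∃ f : CantorC, (∀ x, x ∉ V → f x = 0) ∧ ‖f‖ ≤ 1 ∧ η < |ν f| := by
  simp only [SmallOn] at h
  push Not at h
  obtain ⟨f, hf, h⟩ := h
  have hn : 0 < ‖f‖ := by
    rcases (norm_nonneg f).eq_or_lt with h0 | h0
    · rw [norm_eq_zero.1 h0.symm] at h; simp at h
    · exact h0
  refine ⟨‖f‖⁻¹ • f, fun x hx => by simp [hf x hx], ?_, ?_⟩
  · rw [norm_smul, norm_inv, norm_norm, inv_mul_cancel₀ hn.ne']
  · rw [map_smul, smul_eq_mul, abs_mul, abs_inv, abs_norm, inv_mul_eq_div, lt_div_iff₀ hn]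
    exact h

theorem smallOn_union {ν : CantorC →L[ℝ] ℝ} {V V' : Set CantorSet} {η η' : ℝ}
    (hV : IsClopen V) (hη' : 0 ≤ η') (hη : 0 ≤ η)
    (h : SmallOn ν V η) (h' : SmallOn ν V' η') : SmallOn ν (V ∪ V') (η + η') := by
  intro f hf
  have e : f = indC V * f + indC Vᶜ * f := by
    ext x
    by_cases hx : x ∈ V
    · have : x ∉ Vᶜ := fun h => h hx
      simp [indC_mem hV hx, indC_not_mem this]
    · simp [indC_not_mem hx, indC_mem hV.compl (show x ∈ Vᶜ from hx)]
  have h1 := h (indC V * f) (fun x hx => by simp [indC_not_mem hx])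
  have h2 := h' (indC Vᶜ * f) (fun x hx => by
    by_cases hx2 : x ∈ V
    · have : x ∉ Vᶜ := fun h => h hx2
      simp [indC_not_mem this]
    · simp [hf x (fun h => h.elim hx2 hx)])
  have h3 := mul_le_mul_of_nonneg_left (norm_indC_mul V f) hη
  have h4 := mul_le_mul_of_nonneg_left (norm_indC_mul Vᶜ f) hη'
  calc |ν f| = |ν (indC V * f) + ν (indC Vᶜ * f)| := by rw [← map_add, ← e]
    _ ≤ _ := abs_add_le _ _
    _ ≤ _ := by linarith

theorem eventually_smallOn (ν : CantorC →L[ℝ] ℝ) (V : ℕ → Set CantorSet)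
    (hV : ∀ i j, i ≠ j → Disjoint (V i) (V j)) {η : ℝ} (hη : 0 < η) :
    ∃ N, ∀ n, N ≤ n → SmallOn ν (V n) η := by
  have hfin : {n | ¬ SmallOn ν (V n) η}.Finite := by
    by_contra hinf
    obtain ⟨n, hn⟩ := exists_nat_gt (‖ν‖ / η)
    obtain ⟨s, hs, hcard⟩ := Set.Infinite.exists_subset_card_eq hinf n
    have : ∀ i, ∃ f : CantorC, i ∈ s → (∀ x, x ∉ V i → f x = 0) ∧ ‖f‖ ≤ 1 ∧ η < |ν f| := by
      intro i
      by_cases hi : i ∈ s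
      · obtain ⟨f, hf⟩ := not_smallOn hη (hs hi)
        exact ⟨f, fun _ => hf⟩
      · exact ⟨0, fun h => absurd h hi⟩
    choose f hf using this
    have h1 := sum_disj_le ν s f (fun i hi => (hf i hi).2.1) (fun i hi j hj hne x => by
      by_cases hx : x ∈ V i
      · exact Or.inr ((hf j hj).1 x (Set.disjoint_left.1 (hV i j hne) hx))
      · exact Or.inl ((hf i hi).1 x hx))
    have h2 : (s.card : ℝ) * η ≤ ∑ i ∈ s, |ν (f i)| := by
      rw [← nsmul_eq_mul]
      exact Finset.card_nsmul_le_sum _ _ _ fun i hi => (hf i hi).2.2.le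
    rw [hcard] at h2
    rw [div_lt_iff₀ hη] at hn
    linarith
  obtain ⟨N, hN⟩ := hfin.bddAbove
  refine ⟨N + 1, fun n hn => ?_⟩
  by_contra h
  have := hN h
  omega

/-- The ring between successive cylinders. -/
theorem cyl_diff_disj (y : CantorSet) (k : ℕ → ℕ) (hk : StrictMono k) (i j : ℕ) (h : i ≠ j) :
    Disjoint (cyl y (k i) \ cyl y (k (i + 1))) (cyl y (k j) \ cyl y (k (j + 1))) := by
  rw [Set.disjoint_left]
  rintro x ⟨h1, h2⟩ ⟨h3, h4⟩
  rcases lt_or_gt_of_ne h with h | h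
  · exact h2 (cyl_anti y (hk.monotone h) h3)
  · exact h4 (cyl_anti y (hk.monotone h) h1)

theorem cyl_lim_exists (μ : CantorC →L[ℝ] ℝ) (y : CantorSet) :
    ∃ c, Tendsto (fun k => μ (indC (cyl y k))) atTop (𝓝 c) := by
  have h1 : Summable fun k => |μ (indC (cyl y k \ cyl y (k + 1)))| := by
    refine summable_of_sum_le (fun _ => abs_nonneg _) (c := ‖μ‖) fun s => ?_
    refine sum_disj_le μ s _ (fun i _ => indC_norm _) fun i _ j _ hne x => ?_
    by_cases hx : x ∈ cyl y i \ cyl y (i + 1)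
    · exact Or.inr (indC_not_mem (Set.disjoint_left.1 (cyl_diff_disj y id strictMono_id i j hne) hx))
    · exact Or.inl (indC_not_mem hx)
  have h2 := (h1.of_abs).hasSum.tendsto_sum_nat
  have h3 : ∀ n, ∑ i ∈ Finset.range n, μ (indC (cyl y i \ cyl y (i + 1))) =
      μ (indC (cyl y 0)) - μ (indC (cyl y n)) := by
    intro n
    rw [← Finset.sum_range_sub' (fun k => μ (indC (cyl y k)))]
    refine Finset.sum_congr rfl fun i _ => ?_
    rw [← map_sub]
    congr 1
    ext x
    by_cases hx1 : x ∈ cyl y (i + 1)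
    · have hx0 := cyl_anti y (Nat.le_succ i) hx1
      rw [indC_not_mem (fun h => h.2 hx1)]
      simp [indC_mem (cyl_clopen y _) hx1, indC_mem (cyl_clopen y _) hx0]
    · by_cases hx0 : x ∈ cyl y i
      · rw [indC_mem ((cyl_clopen y _).diff (cyl_clopen y _)) ⟨hx0, hx1⟩]
        simp [indC_not_mem hx1, indC_mem (cyl_clopen y _) hx0]
      · rw [indC_not_mem (fun h => hx0 h.1)]
        simp [indC_not_mem hx1, indC_not_mem hx0]
  simp only [h3] at h2
  have h4 := (tendsto_const_nhds (x := μ (indC (cyl y 0)))).sub h2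
  simp only [sub_sub_cancel] at h4
  exact ⟨_, h4⟩

/-- Separating finitely many points by cylinders. -/
theorem cyl_sep (s : Finset CantorSet) :
    ∃ N, ∀ x ∈ s, ∀ y ∈ s, x ≠ y → ∀ k, N ≤ k → ∀ z, z ∈ cyl x k → z ∉ cyl y k := by
  classical
  have : ∀ p : CantorSet × CantorSet, ∃ N, p.1 ≠ p.2 →
      ∀ k, N ≤ k → ∀ z, z ∈ cyl p.1 k → z ∉ cyl p.2 k := by
    intro p
    by_cases h : p.1 = p.2
    · exact ⟨0, fun h' => absurd h h'⟩
    · obtain ⟨N, hN⟩ := exists_not_mem_cyl h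
      refine ⟨N, fun _ k hk z h1 h2 => hN k hk ?_⟩
      rw [← cyl_eq h2, cyl_eq h1]
      exact mem_cyl_self _ _
  choose N hN using this
  refine ⟨(s ×ˢ s).sup N, fun x hx y hy hne k hk => hN (x, y) hne k ?_⟩
  exact (Finset.le_sup (f := N) (Finset.mk_mem_product hx hy)).trans hk

theorem cyl_lim_countable (μ : CantorC →L[ℝ] ℝ) :
    {x | ¬ Tendsto (fun k => μ (indC (cyl x k))) atTop (𝓝 0)}.Countable := by
  choose c hc using cyl_lim_exists μ
  have hsub : {x | ¬ Tendsto (fun k => μ (indC (cyl x k))) atTop (𝓝 0)} ⊆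
      ⋃ m : ℕ, {x | 1 / ((m : ℝ) + 1) < |c x|} := by
    intro x hx
    have : c x ≠ 0 := fun h => hx (h ▸ hc x)
    obtain ⟨m, hm⟩ := exists_nat_one_div_lt (abs_pos.2 this)
    exact Set.mem_iUnion.2 ⟨m, hm⟩
  refine Set.Countable.mono hsub (Set.countable_iUnion fun m => Set.Finite.countable ?_)
  by_contra hinf
  have hp : (0 : ℝ) < 1 / ((m : ℝ) + 1) := by positivity
  obtain ⟨n, hn⟩ := exists_nat_gt (‖μ‖ / (1 / ((m : ℝ) + 1)))
  obtain ⟨s, hs, hcard⟩ := Set.Infinite.exists_subset_card_eq hinf n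
  obtain ⟨N, hN⟩ := cyl_sep s
  have hev : ∀ᶠ k in atTop, ∀ x ∈ s, 1 / ((m : ℝ) + 1) < |μ (indC (cyl x k))| := by
    rw [Filter.eventually_all_finset]
    intro x hx
    exact (hc x).abs.eventually (lt_mem_nhds (hs hx))
  obtain ⟨k, hk1, hk2⟩ := (hev.and (eventually_ge_atTop N)).exists
  have h1 := sum_disj_le μ s (fun x => indC (cyl x k)) (fun i _ => indC_norm _)
    (fun x hx y hy hne z => by
      by_cases hz : z ∈ cyl x k
      · exact Or.inr (indC_not_mem (hN x hx y hy hne k hk2 z hz))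
      · exact Or.inl (indC_not_mem hz))
  have h2 : (s.card : ℝ) * (1 / ((m : ℝ) + 1)) ≤ ∑ x ∈ s, |μ (indC (cyl x k))| := by
    rw [← nsmul_eq_mul]
    exact Finset.card_nsmul_le_sum _ _ _ fun i hi => (hk1 i hi).le
  rw [hcard] at h2
  rw [div_lt_iff₀ hp] at hn
  linarith

/-- Uniform continuity along cylinders. -/
theorem cyl_unif (h : CantorC) {δ : ℝ} (hδ : 0 < δ) :
    ∃ n, ∀ t t' : CantorSet, t' ∈ cyl t n → |h t' - h t| ≤ δ := by
  have hloc : ∀ t : CantorSet, ∃ n, ∀ t' ∈ cyl t n, |h t' - h t| < δ / 2 := by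
    intro t
    have : {t' : CantorSet | |h t' - h t| < δ / 2} ∈ 𝓝 t := by
      refine IsOpen.mem_nhds ?_ (by simp [hδ])
      exact isOpen_lt (by fun_prop) continuous_const
    obtain ⟨s, hs, hs2⟩ := mem_nhds_iff.1 this
    obtain ⟨I, u, hIu, hsub⟩ := isOpen_pi_iff.1 hs2.1 t hs2.2
    refine ⟨I.sup id + 1, fun t' ht' => hs (hsub fun i hi => ?_)⟩
    rw [ht' i (Nat.lt_succ_of_le (Finset.le_sup (f := id) hi))]
    exact (hIu i hi).2
  choose n hn using hloc
  obtain ⟨s, hs⟩ := isCompact_univ.elim_finite_subcover (fun t => cyl t (n t))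
    (fun t => (cyl_clopen t _).isOpen) (fun t _ => Set.mem_iUnion.2 ⟨t, mem_cyl_self _ _⟩)
  refine ⟨s.sup n, fun t t' ht' => ?_⟩
  obtain ⟨r, hr, htr⟩ := Set.mem_iUnion₂.1 (hs (Set.mem_univ t))
  have h1 := hn r t htr
  have h2 := hn r t' (by
    rw [← cyl_eq htr]; exact cyl_anti t (Finset.le_sup hr) ht')
  have := abs_sub_le (h t') (h r) (h t)
  rw [abs_sub_comm (h r) (h t)] at this
  linarith

theorem smallOn_cyl (ν : CantorC →L[ℝ] ℝ) (y : CantorSet)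
    (hν : Tendsto (fun k => ν (indC (cyl y k))) atTop (𝓝 0)) {η : ℝ} (hη : 0 < η) :
    ∃ k, SmallOn ν (cyl y k) η := by
  by_contra hcon
  push Not at hcon
  have step : ∀ k, ∃ m, k < m ∧ ¬ SmallOn ν (cyl y k \ cyl y m) (η / 2) := by
    intro k
    obtain ⟨f, hf, hf1, hf2⟩ := not_smallOn hη (hcon k)
    obtain ⟨m0, hm0⟩ := cyl_unif f (δ := η / (8 * (‖ν‖ + 1))) (by positivity)
    have hev : ∀ᶠ m in atTop, |ν (indC (cyl y m))| < η / 8 := by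
      have := hν.abs
      rw [abs_zero] at this
      exact this.eventually (gt_mem_nhds (by positivity))
    obtain ⟨m, hm1, hm2⟩ := (hev.and (eventually_ge_atTop (max m0 (k + 1)))).exists
    refine ⟨m, by have := le_max_right m0 (k+1); omega, fun hs => ?_⟩
    have e : f = indC (cyl y m) * f + indC (cyl y m)ᶜ * f := by
      ext x
      by_cases hx : x ∈ cyl y m
      · have : x ∉ (cyl y m)ᶜ := fun h => h hx
        simp [indC_mem (cyl_clopen y m) hx, indC_not_mem this]
      · simp [indC_not_mem hx, indC_mem (cyl_clopen y m).compl (show x ∈ (cyl y m)ᶜ from hx)]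
    have h1 := hs (indC (cyl y m)ᶜ * f) (fun x hx => by
      by_cases hx2 : x ∈ cyl y m
      · have : x ∉ (cyl y m)ᶜ := fun h => h hx2
        simp [indC_not_mem this]
      · simp [hf x (fun h => hx ⟨h, hx2⟩)])
    have h1' : |ν (indC (cyl y m)ᶜ * f)| ≤ η / 2 := by
      refine h1.trans ?_
      have := mul_le_mul_of_nonneg_left ((norm_indC_mul (cyl y m)ᶜ f).trans hf1) (by positivity : 0 ≤ η / 2)
      linarith
    have h2 : ‖indC (cyl y m) * f - f y • indC (cyl y m)‖ ≤ η / (8 * (‖ν‖ + 1)) := by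
      rw [ContinuousMap.norm_le _ (by positivity)]
      intro x
      by_cases hx : x ∈ cyl y m
      · simp only [ContinuousMap.coe_sub, ContinuousMap.coe_mul, ContinuousMap.coe_smul, Pi.sub_apply,
          Pi.mul_apply, Pi.smul_apply, indC_mem (cyl_clopen y m) hx, one_mul, smul_eq_mul, mul_one]
        exact hm0 y x (cyl_anti y ((le_max_left _ _).trans hm2) hx)
      · simp [indC_not_mem hx]
        positivity
    have h3 : |ν (indC (cyl y m) * f - f y • indC (cyl y m))| ≤ η / 8 := by
      refine (ν.le_opNorm _).trans ((mul_le_mul_of_nonneg_left h2 (norm_nonneg _)).trans ?_)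
      rw [mul_div_assoc', div_le_div_iff₀ (by positivity) (by positivity)]
      nlinarith [norm_nonneg ν]
    have h4 : |f y * ν (indC (cyl y m))| ≤ η / 8 := by
      rw [abs_mul]
      have h5 : |f y| ≤ 1 := (f.norm_coe_le_norm y).trans hf1
      have := mul_le_mul h5 hm1.le (abs_nonneg _) zero_le_one
      linarith
    have h6 : ν f = ν (indC (cyl y m) * f - f y • indC (cyl y m)) + f y * ν (indC (cyl y m))
        + ν (indC (cyl y m)ᶜ * f) := by
      conv_lhs => rw [e]
      simp only [map_add, map_sub, map_smul, smul_eq_mul]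
      ring
    rw [h6] at hf2
    have := abs_add_le (ν (indC (cyl y m) * f - f y • indC (cyl y m)) + f y * ν (indC (cyl y m)))
      (ν (indC (cyl y m)ᶜ * f))
    have := abs_add_le (ν (indC (cyl y m) * f - f y • indC (cyl y m))) (f y * ν (indC (cyl y m)))
    linarith
  choose m hm1 hm2 using step
  let k : ℕ → ℕ := fun i => Nat.rec 0 (fun _ r => m r) i
  have hk : StrictMono k := strictMono_nat_of_lt_succ fun i => hm1 (k i)
  obtain ⟨N, hN⟩ := eventually_smallOn ν (fun i => cyl y (k i) \ cyl y (k (i + 1)))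
    (fun i j h => cyl_diff_disj y k hk i j h) (half_pos hη)
  exact hm2 (k N) (hN N le_rfl)

end LemmaR

section LemmaR2

theorem exists_condensation {W : Set CantorSet} (hW : ¬ W.Countable) :
    ∃ y, ∀ l, ¬ (W ∩ cyl y l).Countable := by
  by_contra hcon
  push Not at hcon
  have : (W ∩ Set.univ).Countable := by
    refine isCompact_univ.induction_on (p := fun s => (W ∩ s).Countable) ?_ ?_ ?_ ?_
    · simp
    · intro s t hst ht
      exact ht.mono (Set.inter_subset_inter_right _ hst)
    · intro s t hs ht
      rw [Set.inter_union_distrib_left]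
      exact hs.union ht
    · intro x _
      obtain ⟨l, hl⟩ := hcon x
      exact ⟨cyl x l, mem_nhdsWithin_of_mem_nhds
        ((cyl_clopen x l).isOpen.mem_nhds (mem_cyl_self x l)), hl⟩
  rw [Set.inter_univ] at this
  exact hW this

theorem exists_ring_uncountable {W : Set CantorSet} {y : CantorSet}
    (hy : ∀ l, ¬ (W ∩ cyl y l).Countable) (N : ℕ) :
    ∃ l, N ≤ l ∧ ¬ (W ∩ (cyl y l \ cyl y (l + 1))).Countable := by
  by_contra hcon
  push Not at hcon
  refine hy N (Set.Countable.mono (s₂ := {y} ∪ ⋃ l : ℕ, W ∩ (cyl y (N + l) \ cyl y (N + l + 1)))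
    ?_ ((Set.countable_singleton y).union (Set.countable_iUnion fun l => hcon (N + l) (by omega))))
  rintro x ⟨hxW, hx⟩
  by_cases hxy : x = y
  · exact Or.inl hxy
  · right
    obtain ⟨k, hk⟩ := exists_not_mem_cyl hxy
    have hex : ∃ l, x ∉ cyl y (N + l) := ⟨k, hk _ (by omega)⟩
    classical
    have h1 := Nat.find_spec hex
    obtain ⟨m, hm⟩ : ∃ m, Nat.find hex = m + 1 := by
      refine Nat.exists_eq_succ_of_ne_zero fun h0 => ?_
      rw [h0] at h1
      exact h1 hx
    have h2 := Nat.find_min hex (m := m) (by omega)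
    rw [hm] at h1
    exact Set.mem_iUnion.2 ⟨m, hxW, not_not.1 h2, h1⟩

/-- pigeonhole for uncountable sets -/
theorem exists_uncountable_nat {W : Set CantorSet} (hW : ¬ W.Countable) (p : CantorSet → ℕ → Prop)
    (hp : ∀ w ∈ W, ∃ n, p w n) : ∃ n, ¬ {w | w ∈ W ∧ p w n}.Countable := by
  by_contra hcon
  push Not at hcon
  refine hW ((Set.countable_iUnion hcon).mono fun w hw => ?_)
  obtain ⟨n, hn⟩ := hp w hw
  exact Set.mem_iUnion.2 ⟨n, hw, hn⟩

variable (ν : CantorSet → CantorC →L[ℝ] ℝ)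

theorem split_one {ι : Type*} [Fintype ι] (W : ι → Set CantorSet) (hW : ∀ i, ¬ (W i).Countable)
    (hS : ∀ i, ∀ y ∈ W i, ∀ η : ℝ, 0 < η → ∃ k, SmallOn (ν y) (cyl y k) η) (i0 : ι) {η : ℝ}
    (hη : 0 < η) :
    ∃ (A : Set CantorSet) (W' : ι → Set CantorSet) (W1 : Set CantorSet), IsClopen A ∧
      (∀ i, ¬ (W' i).Countable ∧ W' i ⊆ W i ∧ ∀ y ∈ W' i, y ∉ A ∧ SmallOn (ν y) A η) ∧
      ¬ W1.Countable ∧ W1 ⊆ W i0 ∧ ∀ y ∈ W1, y ∈ A ∧ SmallOn (ν y) A η := by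
  obtain ⟨k, hk⟩ := exists_uncountable_nat (hW i0) (fun y k => SmallOn (ν y) (cyl y k) η)
    (fun y hy => hS i0 y hy η hη)
  obtain ⟨y, hy⟩ := exists_condensation hk
  let D : ℕ → Set CantorSet := fun l => cyl y l \ cyl y (l + 1)
  have hD : ∀ i j, i ≠ j → Disjoint (D i) (D j) := fun i j h =>
    cyl_diff_disj y id strictMono_id i j h
  have h1 : ∀ i, ∃ n, ¬ {w | w ∈ W i ∧ ∀ l, n ≤ l → w ∉ D l ∧ SmallOn (ν w) (D l) η}.Countable := by
    intro i
    refine exists_uncountable_nat (hW i) (fun w n => ∀ l, n ≤ l → w ∉ D l ∧ SmallOn (ν w) (D l) η)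
      fun w _ => ?_
    obtain ⟨N, hN⟩ := eventually_smallOn (ν w) D hD hη
    by_cases hex : ∃ j, w ∈ D j
    · obtain ⟨j, hj⟩ := hex
      refine ⟨max N (j + 1), fun l hl => ⟨fun hw => ?_, hN l ((le_max_left _ _).trans hl)⟩⟩
      have : j ≠ l := by have := (le_max_right N (j + 1)).trans hl; omega
      exact Set.disjoint_left.1 (hD j l this) hj hw
    · push Not at hex
      exact ⟨N, fun l hl => ⟨hex l, hN l hl⟩⟩
  choose n hn using h1
  obtain ⟨l, hl1, hl2⟩ := exists_ring_uncountable hy (max k (Finset.univ.sup n))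
  refine ⟨D l, fun i => {w | w ∈ W i ∧ ∀ l, n i ≤ l → w ∉ D l ∧ SmallOn (ν w) (D l) η}, _,
    (cyl_clopen _ _).diff (cyl_clopen _ _), fun i => ⟨hn i, fun w hw => hw.1, fun w hw => ?_⟩,
    hl2, fun w hw => hw.1.1, fun w hw => ⟨hw.2, ?_⟩⟩
  · exact hw.2 l ((Finset.le_sup (Finset.mem_univ i)).trans ((le_max_right _ _).trans hl1))
  · refine hw.1.2.mono fun x hx => ?_
    have hkl := (le_max_left _ _).trans hl1
    rw [cyl_eq (cyl_anti y hkl hw.2.1)]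
    exact cyl_anti y hkl hx.1

theorem split_all {ι : Type*} [Fintype ι] (W : ι → Set CantorSet) (hW : ∀ i, ¬ (W i).Countable)
    (hS : ∀ i, ∀ y ∈ W i, ∀ η : ℝ, 0 < η → ∃ k, SmallOn (ν y) (cyl y k) η) (s : Finset ι) :
    ∀ η : ℝ, 0 < η →
    ∃ (A : Set CantorSet) (V : ι × Bool → Set CantorSet), IsClopen A ∧
      (∀ p, ¬ (V p).Countable ∧ V p ⊆ W p.1) ∧
      (∀ i, ∀ y ∈ V (i, false), y ∉ A ∧ SmallOn (ν y) A η) ∧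
      (∀ i ∈ s, ∀ y ∈ V (i, true), y ∈ A ∧ SmallOn (ν y) A η) := by
  classical
  induction s using Finset.induction_on with
  | empty =>
    intro η hη
    refine ⟨∅, fun p => W p.1, isClopen_empty, fun p => ⟨hW _, subset_rfl⟩, fun i y _ =>
      ⟨fun h => h, fun f hf => ?_⟩, by simp⟩
    have : f = 0 := by ext x; exact hf x (fun h => h)
    simp [this]
  | insert i s hi ih =>
    intro η hη
    obtain ⟨A, V, hA, hV, hVf, hVt⟩ := ih (η / 2) (half_pos hη)
    obtain ⟨A', V', W1, hA', hV', hW1, hW1s, hW1A⟩ := split_one ν V (fun p => (hV p).1)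
      (fun p y hy => hS p.1 y ((hV p).2 hy)) (i, false) (half_pos hη)
    have hsm : ∀ y, SmallOn (ν y) A (η / 2) → SmallOn (ν y) A' (η / 2) → SmallOn (ν y) (A ∪ A') η := by
      intro y h1 h2
      have := smallOn_union hA (half_pos hη).le (half_pos hη).le h1 h2
      rwa [add_halves] at this
    refine ⟨A ∪ A', Function.update V' (i, true) W1, hA.union hA', fun p => ?_, fun j y hy => ?_,
      fun j hj y hy => ?_⟩
    · by_cases hp : p = (i, true)
      · subst hp
        rw [Function.update_self]
        exact ⟨hW1, hW1s.trans (hV (i, false)).2⟩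
      · rw [Function.update_of_ne hp]
        exact ⟨(hV' p).1, (hV' p).2.1.trans (hV p).2⟩
    · rw [Function.update_of_ne (by simp)] at hy
      have h1 := (hV' (j, false)).2.2 y hy
      have h2 := hVf j y ((hV' (j, false)).2.1 hy)
      exact ⟨fun h => h.elim h2.1 h1.1, hsm y h2.2 h1.2⟩
    · by_cases hji : j = i
      · subst hji
        rw [Function.update_self] at hy
        have h1 := hW1A y hy
        have h2 := hVf j y (hW1s hy)
        exact ⟨Or.inr h1.1, hsm y h2.2 h1.2⟩
      · rw [Function.update_of_ne (by simp [hji])] at hy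
        have hjs : j ∈ s := (Finset.mem_insert.1 hj).resolve_left hji
        have h1 := (hV' (j, true)).2.2 y hy
        have h2 := hVt j hjs y ((hV' (j, true)).2.1 hy)
        exact ⟨Or.inl h2.1, hsm y h2.2 h1.2⟩

/-- The independent sequence of clopen sets. -/
theorem exists_indep (W : Set CantorSet) (hW : ¬ W.Countable)
    (hS : ∀ y ∈ W, ∀ η : ℝ, 0 < η → ∃ k, SmallOn (ν y) (cyl y k) η) (η : ℕ → ℝ)
    (hη : ∀ n, 0 < η n) :
    ∃ A : ℕ → Set CantorSet, (∀ n, IsClopen (A n)) ∧ ∀ (s : CantorSet) (n : ℕ), ∃ y ∈ W,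
      ∀ i < n, (y ∈ A i ↔ s i = true) ∧ SmallOn (ν y) (A i) (η i) := by
  let St : ℕ → Type := fun n => {V : (Fin n → Bool) → Set CantorSet //
    ∀ s, ¬ (V s).Countable ∧ V s ⊆ W}
  have step : ∀ (n : ℕ) (V : St n), ∃ (A : Set CantorSet) (V' : St (n + 1)), IsClopen A ∧
      ∀ s : Fin (n + 1) → Bool, V'.1 s ⊆ V.1 (Fin.init s) ∧
        ∀ y ∈ V'.1 s, (y ∈ A ↔ s (Fin.last n) = true) ∧ SmallOn (ν y) A (η n) := by
    intro n V
    obtain ⟨A, V', hA, hV', hf, ht⟩ := split_all ν V.1 (fun s => (V.2 s).1)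
      (fun s y hy => hS y ((V.2 s).2 hy)) Finset.univ (η n) (hη n)
    refine ⟨A, ⟨fun s => V' (Fin.init s, s (Fin.last n)), fun s => ⟨(hV' _).1,
      (hV' _).2.trans (V.2 _).2⟩⟩, hA, fun s => ⟨(hV' _).2, fun y hy => ?_⟩⟩
    change y ∈ V' (Fin.init s, s (Fin.last n)) at hy
    rcases hb : s (Fin.last n) with _ | _
    · rw [hb] at hy
      have := hf _ y hy
      simp [this.1, this.2]
    · rw [hb] at hy
      have := ht _ (Finset.mem_univ _) y hy
      simp [this.1, this.2]
  choose A V' hA hV' using step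
  let V : ∀ n, St n := fun n => Nat.rec (motive := St) ⟨fun _ => W, fun _ => ⟨hW, subset_rfl⟩⟩
    (fun n V => V' n V) n
  refine ⟨fun n => A n (V n), fun n => hA n (V n), fun s n => ?_⟩
  have key : ∀ n, ∀ y ∈ (V n).1 (fun i => s i), ∀ i < n, (y ∈ A i (V i) ↔ s i = true) ∧
      SmallOn (ν y) (A i (V i)) (η i) := by
    intro n
    induction n with
    | zero => intro y _ i hi; omega
    | succ n ih =>
      intro y hy i hi
      have h := hV' n (V n) (fun i => s i)
      rcases Nat.lt_succ_iff_lt_or_eq.1 hi with h' | rfl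
      · exact ih y (h.1 hy) i h'
      · exact h.2 y hy
  have hne : ((V n).1 (fun i => s i)).Nonempty := by
    by_contra h
    rw [Set.not_nonempty_iff_eq_empty] at h
    exact ((V n).2 (fun i => s i)).1 (by rw [h]; exact Set.countable_empty)
  obtain ⟨y, hy⟩ := hne
  exact ⟨y, ((V n).2 _).2 hy, key n y hy⟩

open Classical in
/-- Lemma R. -/
theorem exists_Q (W : Set CantorSet) (hW : ¬ W.Countable) (μ : CantorSet → CantorC →L[ℝ] ℝ)
    {C ε : ℝ} (hμ : ∀ y ∈ W, ‖μ y‖ ≤ C) (c : CantorSet → ℝ)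
    (hc : ∀ y ∈ W, Tendsto (fun k => μ y (indC (cyl y k))) atTop (𝓝 (c y)))
    (hε : 0 < ε) (hcε : ∀ y ∈ W, ε ≤ |c y|) :
    ∃ (Q : CantorC →L[ℝ] CantorC), ∀ (h : CantorC) (B : ℝ), (∀ y ∈ W, |μ y (Q h)| ≤ B) →
      ε / 2 * ‖h‖ ≤ B := by
  let ν : CantorSet → CantorC →L[ℝ] ℝ := fun y => μ y - c y • ContinuousMap.evalCLM ℝ y
  have hν : ∀ y f, ν y f = μ y f - c y * f y := fun y f => by simp [ν]
  have hcC : ∀ y ∈ W, |c y| ≤ C := by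
    intro y hy
    refine le_of_tendsto (hc y hy).abs (Eventually.of_forall fun k => ?_)
    refine ((μ y).le_opNorm _).trans ?_
    have := mul_le_mul (hμ y hy) (indC_norm (cyl y k)) (norm_nonneg _)
      ((norm_nonneg (μ y)).trans (hμ y hy))
    linarith
  have hS : ∀ y ∈ W, ∀ η : ℝ, 0 < η → ∃ k, SmallOn (ν y) (cyl y k) η := by
    intro y hy η hη
    refine smallOn_cyl (ν y) y ?_ hη
    have h1 : ∀ k, ν y (indC (cyl y k)) = μ y (indC (cyl y k)) - c y := by
      intro k
      rw [hν, indC_mem (cyl_clopen y k) (mem_cyl_self y k), mul_one]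
    simp only [h1]
    have := (hc y hy).sub (tendsto_const_nhds (x := c y))
    rwa [sub_self] at this
  obtain ⟨k, hk⟩ := exists_uncountable_nat hW (fun y k => SmallOn (ν y) (cyl y k) (ε / 8))
    (fun y hy => hS y hy _ (by positivity))
  obtain ⟨y0, hy0⟩ := exists_condensation hk
  let U := cyl y0 k
  have hU : IsClopen U := cyl_clopen _ _
  obtain ⟨A, hA, hind⟩ := exists_indep ν _ (hy0 k) (fun y hy => hS y hy.1.1)
    (fun n => ε / 16 * (1 / 2) ^ n) (fun n => by positivity)
  let q : C(CantorSet, CantorSet) := ⟨fun x n => decide (x ∈ A n), by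
    refine continuous_pi fun n => ?_
    refine IsLocallyConstant.continuous ?_
    rw [IsLocallyConstant.iff_exists_open]
    intro x
    by_cases hx : x ∈ A n
    · exact ⟨A n, (hA n).isOpen, hx, fun y hy => by simp [hx, hy]⟩
    · exact ⟨(A n)ᶜ, (hA n).compl.isOpen, hx, fun y hy => by
        have : y ∉ A n := hy
        simp [hx, this]⟩⟩
  have hq : ∀ x n, q x n = decide (x ∈ A n) := fun x n => rfl
  let Q : CantorC →L[ℝ] CantorC := LinearMap.mkContinuous
    { toFun := fun h => indC U * h.comp q
      map_add' := fun f g => by ext x; simp [mul_add]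
      map_smul' := fun r f => by ext x; simp } 1 (fun h => by
        refine (norm_indC_mul _ _).trans ?_
        rw [ContinuousMap.norm_le _ (by positivity), one_mul]
        exact fun x => h.norm_coe_le_norm _)
  have hQ : ∀ h, Q h = indC U * h.comp q := fun h => rfl
  refine ⟨Q, fun h B hB => ?_⟩
  -- truncations
  let tr : ℕ → C(CantorSet, CantorSet) := fun i => ⟨fun t j => if j < i then t j else false, by
    refine continuous_pi fun j => ?_
    by_cases hj : j < i
    · simp only [hj, if_true]; exact continuous_apply j
    · simp only [hj, if_false]; exact continuous_const⟩
  have htr : ∀ i t j, tr i t j = if j < i then t j else false := fun i t j => rfl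
  let ψ : ℕ → CantorC := fun i => indC U * (h.comp (tr i)).comp q
  have hψ : ∀ i x, ψ i x = indC U x * h (tr i (q x)) := fun i x => rfl
  obtain ⟨s, hs⟩ : ∃ s, |h s| = ‖h‖ := by
    obtain ⟨s, -, hs⟩ := isCompact_univ.exists_isMaxOn Set.univ_nonempty
      (f := fun x => ‖h x‖) (by fun_prop : Continuous fun x => ‖h x‖).continuousOn
    refine ⟨s, le_antisymm (h.norm_coe_le_norm s) ?_⟩
    rw [ContinuousMap.norm_le _ (abs_nonneg _)]
    exact fun x => hs (Set.mem_univ x)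
  have main : ∀ δ : ℝ, 0 < δ → ε / 2 * ‖h‖ ≤ B + δ * (3 * C) := by
    intro δ hδ
    obtain ⟨n, hn⟩ := cyl_unif h hδ
    obtain ⟨y, hy, hyn⟩ := hind s n
    have hyW : y ∈ W := hy.1.1
    have hyU : y ∈ U := hy.2
    have hUs : SmallOn (ν y) U (ε / 8) := by
      have := hy.1.2
      rwa [cyl_eq hyU] at this
    have hC : 0 ≤ C := (abs_nonneg _).trans (hcC y hyW)
    have hνn : ‖ν y‖ ≤ 2 * C := by
      refine ContinuousLinearMap.opNorm_le_bound _ (by positivity) fun f => ?_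
      rw [hν]
      refine (norm_sub_le _ _).trans ?_
      have h1 := ((μ y).le_opNorm f).trans (mul_le_mul_of_nonneg_right (hμ y hyW) (norm_nonneg f))
      have h2 : ‖c y * f y‖ ≤ C * ‖f‖ := by
        rw [norm_mul]
        exact mul_le_mul (hcC y hyW) (f.norm_coe_le_norm y) (norm_nonneg _) hC
      linarith
    have e1 : ‖Q h - ψ n‖ ≤ δ := by
      have : Q h - ψ n = indC U * ((h.comp q) - (h.comp (tr n)).comp q) := by
        rw [hQ]; simp only [ψ]; ring
      rw [this]
      refine (norm_indC_mul _ _).trans ?_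
      rw [ContinuousMap.norm_le _ hδ.le]
      intro x
      refine hn (tr n (q x)) (q x) fun i hi => ?_
      rw [htr, if_pos hi]
    have e2 : |ν y (Q h - ψ n)| ≤ 2 * C * δ :=
      ((ν y).le_opNorm _).trans (mul_le_mul hνn e1 (norm_nonneg _) (by positivity))
    have hψn : ∀ i, ‖ψ i‖ ≤ ‖h‖ := by
      intro i
      refine (norm_indC_mul _ _).trans ?_
      rw [ContinuousMap.norm_le _ (norm_nonneg _)]
      exact fun x => h.norm_coe_le_norm _
    have e3 : |ν y (ψ 0)| ≤ ε / 8 * ‖h‖ := by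
      refine (hUs (ψ 0) fun x hx => ?_).trans (mul_le_mul_of_nonneg_left (hψn 0) (by positivity))
      rw [hψ, indC_not_mem hx, zero_mul]
    have e4 : ∀ i < n, |ν y (ψ (i + 1) - ψ i)| ≤ ε / 16 * (1 / 2) ^ i * (2 * ‖h‖) := by
      intro i hi
      refine ((hyn i hi).2 _ fun x hx => ?_).trans (mul_le_mul_of_nonneg_left ?_ (by positivity))
      · have : tr (i + 1) (q x) = tr i (q x) := by
          funext j
          rw [htr, htr]
          rcases lt_trichotomy j i with h | rfl | h
          · rw [if_pos (by omega), if_pos h]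
          · simp [hq, hx]
          · rw [if_neg (by omega), if_neg (by omega)]
        rw [ContinuousMap.sub_apply, hψ, hψ, this, sub_self]
      · refine (norm_sub_le _ _).trans ?_
        have := hψn i
        have := hψn (i + 1)
        linarith
    have e5 : ν y (ψ n) = ν y (ψ 0) + ∑ i ∈ Finset.range n, ν y (ψ (i + 1) - ψ i) := by
      simp only [map_sub]
      rw [Finset.sum_range_sub (fun i => ν y (ψ i))]
      ring
    have e6 : |∑ i ∈ Finset.range n, ν y (ψ (i + 1) - ψ i)| ≤ ε / 4 * ‖h‖ := by
      refine (Finset.abs_sum_le_sum_abs _ _).trans ?_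
      refine (Finset.sum_le_sum fun i hi => e4 i (Finset.mem_range.1 hi)).trans ?_
      rw [← Finset.sum_mul, ← Finset.mul_sum]
      have hg : ∑ i ∈ Finset.range n, (1 / 2 : ℝ) ^ i ≤ 2 := by
        exact sum_le_hasSum _ (fun i _ => by positivity) hasSum_geometric_two
      have := mul_le_mul_of_nonneg_left hg (by positivity : 0 ≤ ε * ‖h‖)
      nlinarith
    have e7 : |h (q y) - h s| ≤ δ := by
      refine hn s (q y) fun i hi => ?_
      have := (hyn i hi).1
      rw [hq]
      by_cases hsi : s i = true
      · rw [hsi, decide_eq_true (this.2 hsi)]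
      · rw [Bool.not_eq_true] at hsi
        rw [hsi, decide_eq_false]
        intro h'
        rw [this.1 h'] at hsi
        exact absurd hsi (by simp)
    have e8 : μ y (Q h) = ν y (Q h - ψ n) + ν y (ψ n) + c y * h (q y) := by
      have : (Q h) y = h (q y) := by
        rw [hQ, ContinuousMap.mul_apply, indC_mem hU hyU, one_mul]; rfl
      rw [map_sub, hν y (Q h), this]
      ring
    have e9 := hB y hyW
    have e10 : |c y * h (q y)| ≤ B + 2 * C * δ + ε / 8 * ‖h‖ + ε / 4 * ‖h‖ := by
      have : c y * h (q y) = μ y (Q h) - ν y (Q h - ψ n) - ν y (ψ 0) -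
          ∑ i ∈ Finset.range n, ν y (ψ (i + 1) - ψ i) := by
        rw [e8, e5]; ring
      rw [this, abs_le]
      rw [abs_le] at e9 e2 e3 e6
      constructor <;> linarith [e9.1, e9.2, e2.1, e2.2, e3.1, e3.2, e6.1, e6.2]
    have e11 : ‖h‖ - δ ≤ |h (q y)| := by
      rw [← hs]
      have := abs_sub_abs_le_abs_sub (h s) (h (q y))
      rw [abs_sub_comm] at this
      linarith
    have e12 : |c y| * ‖h‖ - C * δ ≤ |c y * h (q y)| := by
      rw [abs_mul]
      have h1 := mul_le_mul_of_nonneg_left e11 (abs_nonneg (c y))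
      have h2 := mul_le_mul_of_nonneg_right (hcC y hyW) hδ.le
      linarith
    have e13 := mul_le_mul_of_nonneg_right (hcε y hyW) (norm_nonneg h)
    have : 0 ≤ ε * ‖h‖ := by positivity
    linarith
  have hC : 0 ≤ C := by
    obtain ⟨y, hy⟩ : W.Nonempty := by
      by_contra h
      rw [Set.not_nonempty_iff_eq_empty] at h
      exact hW (by rw [h]; exact Set.countable_empty)
    exact (abs_nonneg _).trans (hcC y hy)
  refine le_of_forall_pos_le_add fun e he => ?_
  have := main (e / (3 * C + 1)) (by positivity)
  refine this.trans ?_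
  have : e / (3 * C + 1) * (3 * C) ≤ e := by
    rw [div_mul_eq_mul_div, div_le_iff₀ (by positivity)]
    nlinarith
  linarith

end LemmaR2

section PartFive

variable {E : Type*} [NormedAddCommGroup E] [NormedSpace ℝ E]
variable {u : ℕ → CantorC} {lc : (ℕ →₀ ℝ) →ₗ[ℝ] E}

theorem lc_ext (hd : DenseRange lc) {G : Type*} [NormedAddCommGroup G] [NormedSpace ℝ G]
    {S T : E →L[ℝ] G} (h : ∀ k, S (lc (Finsupp.single k 1)) = T (lc (Finsupp.single k 1))) :
    S = T := by
  have h1 : S.toLinearMap ∘ₗ lc = T.toLinearMap ∘ₗ lc := by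
    refine Finsupp.lhom_ext fun k c => ?_
    have e : Finsupp.single k c = c • Finsupp.single k (1 : ℝ) := by simp
    have := h k
    rw [e, map_smul, map_smul]
    simp only [LinearMap.comp_apply, ContinuousLinearMap.coe_coe]
    rw [this]
  ext y
  refine hd.induction_on (p := fun y => S y = T y) y (isClosed_eq S.continuous T.continuous) fun a => ?_
  exact LinearMap.congr_fun h1 a

theorem lc_extend {F : Type*} [NormedAddCommGroup F] [NormedSpace ℝ F] [CompleteSpace F]
    (hn : ∀ a, ‖lc a‖ = tN u a) (hd : DenseRange lc)
    (φ : (ℕ →₀ ℝ) →ₗ[ℝ] F) (C : ℝ) (h : ∀ a, ‖φ a‖ ≤ C * tN u a) :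
    ∃ T : E →L[ℝ] F, (∀ a, T (lc a) = φ a) ∧ ∀ y, ‖T y‖ ≤ C * ‖y‖ := by
  have hnorm : ∀ a, ‖φ a‖ ≤ C * ‖lc a‖ := fun a => by rw [hn]; exact h a
  exact ⟨φ.extendOfNorm lc, fun a => LinearMap.extendOfNorm_eq hd ⟨C, hnorm⟩ a,
    fun y => LinearMap.norm_extendOfNorm_apply_le hd C hnorm y⟩

theorem lincomb_branch {F : Type*} [AddCommGroup F] [Module ℝ F] (v : ℕ → F) {σ : ℕ → ℕ}
    (hv : ∀ k, (∀ j, k ≠ tc σ j) → v k = 0) (a : ℕ →₀ ℝ) :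
    ∃ q0, ∀ q, q0 ≤ q → Finsupp.linearCombination ℝ v a =
      ∑ i ∈ Finset.range q, a (tc σ i) • v (tc σ i) := by
  induction a using Finsupp.induction_linear with
  | zero => exact ⟨0, fun q _ => by simp⟩
  | add a b ha hb =>
    obtain ⟨q1, h1⟩ := ha
    obtain ⟨q2, h2⟩ := hb
    refine ⟨max q1 q2, fun q hq => ?_⟩
    rw [map_add, h1 q ((le_max_left _ _).trans hq), h2 q ((le_max_right _ _).trans hq),
      ← Finset.sum_add_distrib]
    simp [add_smul]
  | single k c =>
    by_cases hk : ∃ n, k = tc σ n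
    · obtain ⟨n, rfl⟩ := hk
      refine ⟨n + 1, fun q hq => ?_⟩
      rw [Finset.sum_eq_single_of_mem n (Finset.mem_range.2 (by omega))]
      · simp
      · intro j _ hj
        rw [Finsupp.single_eq_of_ne, zero_smul]
        exact fun h => hj (tc_inj h).1
    · push Not at hk
      refine ⟨0, fun q _ => ?_⟩
      rw [Finset.sum_eq_zero]
      · simp [hv k hk]
      · intro j _
        rw [Finsupp.single_eq_of_ne (hk j).symm, zero_smul]

/-- A functional supported on the branch `σ`. -/
def BSupp (lc : (ℕ →₀ ℝ) →ₗ[ℝ] E) (σ : ℕ → ℕ) (g : E →L[ℝ] ℝ) : Prop :=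
  ∀ k, (∀ j, k ≠ tc σ j) → g (lc (Finsupp.single k 1)) = 0

theorem exists_IR_aux [CompleteSpace E] (hn : ∀ a, ‖lc a‖ = tN u a) (hd : DenseRange lc)
    {σ : ℕ → ℕ}
    (Y : Submodule ℝ CantorC) (hYc : IsClosed (Y : Set CantorC)) (x : ℕ → CantorC) (K : ℝ)
    (hYx : Y = (Submodule.span ℝ (Set.range x)).topologicalClosure) (hu0 : ∀ n, u (tc σ n) ≠ 0)
    (hK : BasicConst (fun n => u (tc σ n)) K)
    (hxu : ∀ (a : ℕ → ℝ) (n : ℕ),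
      1 / 2 * ‖∑ i ∈ Finset.range n, a i • x i‖ ≤ ‖∑ i ∈ Finset.range n, a i • u (tc σ i)‖ ∧
      ‖∑ i ∈ Finset.range n, a i • u (tc σ i)‖ ≤ 3 / 2 * ‖∑ i ∈ Finset.range n, a i • x i‖) :
    ∃ (I : Y →L[ℝ] E) (R : E →L[ℝ] Y), R.comp I = ContinuousLinearMap.id ℝ Y ∧
      ∀ g : E →L[ℝ] ℝ, BSupp lc σ g → g = g.comp (I.comp R) := by
  classical
  have hmem : ∀ i, x i ∈ Y := fun i => by
    rw [hYx]; exact Submodule.le_topologicalClosure _ (Submodule.subset_span ⟨i, rfl⟩)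
  have hcomp : CompleteSpace Y := hYc.completeSpace_coe
  have hK1 : 1 ≤ K := by
    have h1 := hK (fun _ => 1) 1 1 le_rfl
    simp only [Finset.sum_range_one, one_smul] at h1
    have h2 := norm_pos_iff.2 (hu0 0)
    by_contra h
    push Not at h
    nlinarith
  -- R
  let v : ℕ → Y := fun k => if k = tc σ (nlv k) then ⟨x (nlv k), hmem _⟩ else 0
  have hv1 : ∀ n, v (tc σ n) = ⟨x n, hmem n⟩ := by
    intro n
    have : nlv (tc σ n) = n := nlv_tc σ n
    simp only [v, this, if_true]
  have hv0 : ∀ k, (∀ j, k ≠ tc σ j) → v k = 0 := fun k hk => if_neg (hk _)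
  obtain ⟨R, hR, -⟩ := lc_extend hn hd (Finsupp.linearCombination ℝ v) 2 (fun a => by
    obtain ⟨q, hq⟩ := lincomb_branch v hv0 a
    rw [hq q le_rfl]
    have e1 : ‖∑ i ∈ Finset.range q, a (tc σ i) • v (tc σ i)‖ =
        ‖∑ i ∈ Finset.range q, a (tc σ i) • x i‖ := by
      rw [Submodule.coe_norm]
      congr 1
      simp [hv1]
    have h1 := (hxu (fun i => a (tc σ i)) q).1
    have h2 := segS_le_tN u ⟨σ, 0, q⟩ a
    rw [segS_apply] at h2
    simp only [Nat.Ico_zero_eq_range] at h2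
    refine (le_of_eq e1).trans ?_
    linarith)
  -- I
  obtain ⟨I, hI, -⟩ := ext_map Y hYx hmem (fun i => lc (Finsupp.single (tc σ i) 1)) (3 * K) (fun b => by
    have e0 : Finsupp.linearCombination ℝ (fun i => lc (Finsupp.single (tc σ i) 1)) b =
        lc (b.mapDomain (tc σ)) := by
      rw [Finsupp.mapDomain, Finsupp.linearCombination_apply, Finsupp.sum, Finsupp.sum, map_sum]
      refine Finset.sum_congr rfl fun i _ => ?_
      rw [← map_smul]; simp
    have hinj : Function.Injective (tc σ) := (tc_strictMono σ).injective
    rw [e0, hn]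
    refine tN_branch u (σ := σ) (fun k hk => ?_) fun p q => ?_
    · by_contra hcon
      refine hk (Finsupp.mapDomain_of_notMem_range _ _ ?_)
      rintro ⟨j, hj⟩
      exact hcon ⟨j, hj.symm⟩
    · rw [segS_apply]
      simp only [Finsupp.mapDomain_apply hinj]
      obtain ⟨m0, hm0⟩ : ∃ m0, ∀ m, m0 ≤ m → Finsupp.linearCombination ℝ x b =
          ∑ i ∈ Finset.range m, b i • x i := by
        refine ⟨b.support.sup id + 1, fun m hm => ?_⟩
        rw [Finsupp.linearCombination_apply, Finsupp.sum]
        refine Finset.sum_subset (fun i hi => ?_) (fun i _ hi => ?_)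
        · have := Finset.le_sup (f := id) hi
          simp only [id] at this
          exact Finset.mem_range.2 (by omega)
        · rw [Finsupp.notMem_support_iff.1 hi, zero_smul]
      let m := max m0 (max p q)
      have h1 := hK b p m ((le_max_left _ _).trans (le_max_right _ _))
      have h2 := hK b q m ((le_max_right _ _).trans (le_max_right _ _))
      have h3 := (hxu b m).2
      rw [← hm0 m (le_max_left _ _)] at h3
      have h4 : K * ‖∑ i ∈ Finset.range m, b i • u (tc σ i)‖ ≤
          K * (3 / 2 * ‖Finsupp.linearCombination ℝ x b‖) :=
        mul_le_mul_of_nonneg_left h3 (by linarith)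
      rcases le_total p q with hpq | hpq
      · rw [Finset.sum_Ico_eq_sub _ hpq]
        refine (norm_sub_le _ _).trans ?_
        linarith
      · rw [Finset.Ico_eq_empty_of_le hpq, Finset.sum_empty, norm_zero]
        positivity)
  refine ⟨I, R, ?_, fun g hg => ?_⟩
  · refine ext_eq (G := Y) (S := R.comp I) (T := ContinuousLinearMap.id ℝ Y) Y hYx hmem fun i => ?_
    rw [ContinuousLinearMap.comp_apply, hI, hR]
    simp [hv1]
  · refine lc_ext hd fun k => ?_
    simp only [ContinuousLinearMap.comp_apply]
    rw [hR, Finsupp.linearCombination_single, one_smul]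
    by_cases hk : ∃ n, k = tc σ n
    · obtain ⟨n, rfl⟩ := hk
      rw [hv1, hI]
    · push Not at hk
      rw [hv0 k hk, map_zero, map_zero, hg k hk]

theorem exists_IR [CompleteSpace E] (hn : ∀ a, ‖lc a‖ = tN u a) (hd : DenseRange lc)
    {σ : ℕ → ℕ} {Y : SB} (hY : TRel u σ Y) :
    ∃ (I : Y.1 →L[ℝ] E) (R : E →L[ℝ] Y.1), R.comp I = ContinuousLinearMap.id ℝ Y.1 ∧
      ∀ g : E →L[ℝ] ℝ, BSupp lc σ g → g = g.comp (I.comp R) := by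
  obtain ⟨x, K, hYx, hu0, hK, hxu⟩ := hY
  exact exists_IR_aux hn hd Y.1 Y.2 x K hYx hu0 hK hxu

/-- Density of the span of branch supported functionals. -/
theorem dual_dense (hn : ∀ a, ‖lc a‖ = tN u a) (hd : DenseRange lc) (g : E →L[ℝ] ℝ) {η : ℝ}
    (hη : 0 < η) :
    ∃ g' ∈ Submodule.span ℝ {g : E →L[ℝ] ℝ | ∃ σ, BSupp lc σ g}, ∀ y, |g y - g' y| ≤ 2 * η * ‖y‖ := by
  obtain ⟨ψ, hψ, hφ⟩ := branch_dense u (g.toLinearMap ∘ₗ lc) (norm_nonneg g)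
    (fun a => by rw [← hn]; exact g.le_opNorm _) hη
  have lift : ∀ ψ ∈ Submodule.span ℝ (branchF u),
      ∃ g' ∈ Submodule.span ℝ {g : E →L[ℝ] ℝ | ∃ σ, BSupp lc σ g}, ∀ a, g' (lc a) = ψ a := by
    intro ψ hψ
    induction hψ using Submodule.span_induction with
    | mem ψ h =>
      obtain ⟨⟨σ, hσ⟩, C, hC⟩ := h
      obtain ⟨T, hT, -⟩ := lc_extend hn hd ψ C hC
      exact ⟨T, Submodule.subset_span ⟨σ, fun k hk => by rw [hT, hσ k hk]⟩, hT⟩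
    | zero => exact ⟨0, Submodule.zero_mem _, fun a => by simp⟩
    | add ψ₁ ψ₂ _ _ h1 h2 =>
      obtain ⟨g1, m1, e1⟩ := h1
      obtain ⟨g2, m2, e2⟩ := h2
      exact ⟨g1 + g2, Submodule.add_mem _ m1 m2, fun a => by simp [e1, e2]⟩
    | smul r ψ _ h =>
      obtain ⟨g1, m1, e1⟩ := h
      exact ⟨r • g1, Submodule.smul_mem _ _ m1, fun a => by simp [e1]⟩
  obtain ⟨g', hg', he⟩ := lift ψ hψ
  refine ⟨g', hg', fun y => ?_⟩
  refine hd.induction_on (p := fun y => |g y - g' y| ≤ 2 * η * ‖y‖) y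
    (isClosed_le (by fun_prop) (by fun_prop)) fun a => ?_
  have := hφ a
  rw [hn, he]
  exact this

/-- Hahn-Banach step. -/
theorem exists_delta_ext (J : CantorC →L[ℝ] E) {c : ℝ} (hc : 0 < c)
    (hJ : ∀ f, c * ‖f‖ ≤ ‖J f‖) (x : CantorSet) : ∃ g : E →L[ℝ] ℝ, ∀ f, g (J f) = f x := by
  have hinj : Function.Injective J := by
    refine (injective_iff_map_eq_zero J).2 fun f hf => ?_
    have := hJ f
    rw [hf, norm_zero] at this
    have h0 : ‖f‖ ≤ 0 := by
      by_contra h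
      push Not at h
      nlinarith
    exact norm_le_zero_iff.1 h0
  let e := LinearEquiv.ofInjective J.toLinearMap hinj
  have he : ∀ f, ((e f : LinearMap.range J.toLinearMap) : E) = J f := fun f => rfl
  let φ : LinearMap.range J.toLinearMap →L[ℝ] ℝ := LinearMap.mkContinuous
    ((ContinuousMap.evalCLM ℝ x).toLinearMap ∘ₗ e.symm.toLinearMap) c⁻¹ (fun y => by
      obtain ⟨f, rfl⟩ := e.surjective y
      simp only [LinearMap.comp_apply, LinearEquiv.coe_coe, LinearEquiv.symm_apply_apply]
      have h1 : ‖f x‖ ≤ ‖f‖ := f.norm_coe_le_norm x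
      have h2 := hJ f
      rw [Submodule.coe_norm, he]
      change ‖f x‖ ≤ _
      rw [inv_mul_eq_div, le_div_iff₀ hc]
      nlinarith)
  obtain ⟨g, hg, -⟩ := exists_extension_norm_eq (LinearMap.range J.toLinearMap) φ
  refine ⟨g, fun f => ?_⟩
  have := hg (e f)
  rw [he] at this
  rw [this]
  change (e.symm (e f)) x = f x
  rw [LinearEquiv.symm_apply_apply]

/-- Claim 1. -/
theorem exists_branch_nonnull (hn : ∀ a, ‖lc a‖ = tN u a) (hd : DenseRange lc)
    (J : CantorC →L[ℝ] E) {c : ℝ} (hc : 0 < c) (hJ : ∀ f, c * ‖f‖ ≤ ‖J f‖) (x : CantorSet) :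
    ∃ (σ : ℕ → ℕ) (g : E →L[ℝ] ℝ), BSupp lc σ g ∧ ‖g‖ ≤ 1 ∧
      ¬ Tendsto (fun k => g (J (indC (cyl x k)))) atTop (𝓝 0) := by
  by_contra hcon
  push Not at hcon
  have h0 : ∀ σ (g : E →L[ℝ] ℝ), BSupp lc σ g →
      Tendsto (fun k => g (J (indC (cyl x k)))) atTop (𝓝 0) := by
    intro σ g hg
    have h1 := hcon σ ((‖g‖ + 1)⁻¹ • g) (fun k hk => by simp [hg k hk]) (by
      rw [norm_smul, norm_inv, Real.norm_of_nonneg (by positivity), inv_mul_le_iff₀ (by positivity)]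
      linarith)
    have h2 := h1.const_mul (‖g‖ + 1)
    simp only [smul_apply, smul_eq_mul, mul_zero] at h2
    refine h2.congr fun k => ?_
    rw [← mul_assoc, mul_inv_cancel₀ (by positivity), one_mul]
  have h1 : ∀ g ∈ Submodule.span ℝ {g : E →L[ℝ] ℝ | ∃ σ, BSupp lc σ g},
      Tendsto (fun k => g (J (indC (cyl x k)))) atTop (𝓝 0) := by
    intro g hg
    induction hg using Submodule.span_induction with
    | mem g h => obtain ⟨σ, h⟩ := h; exact h0 σ g h
    | zero => simp
    | add g₁ g₂ _ _ h1 h2 => simpa using h1.add h2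
    | smul r g _ h => simpa using h.const_mul r
  obtain ⟨g, hg⟩ := exists_delta_ext J hc hJ x
  obtain ⟨g', hg', hgg⟩ := dual_dense hn hd g (η := 1 / (8 * (‖J‖ + 1))) (by positivity)
  have h2 := (h1 g' hg').abs
  rw [abs_zero] at h2
  obtain ⟨k, hk⟩ := (h2.eventually (gt_mem_nhds (by norm_num : (0 : ℝ) < 1 / 2))).exists
  have h3 := hgg (J (indC (cyl x k)))
  rw [hg, indC_mem (cyl_clopen x k) (mem_cyl_self x k)] at h3
  have h4 : ‖J (indC (cyl x k))‖ ≤ ‖J‖ := by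
    have := (J.le_opNorm (indC (cyl x k))).trans (mul_le_mul_of_nonneg_left (indC_norm _) (norm_nonneg J))
    linarith
  have h5 : 2 * (1 / (8 * (‖J‖ + 1))) * ‖J (indC (cyl x k))‖ ≤ 1 / 4 := by
    refine (mul_le_mul_of_nonneg_left h4 (by positivity)).trans ?_
    rw [mul_one_div, div_mul_eq_mul_div, div_le_div_iff₀ (by positivity) (by norm_num)]
    linarith
  have := abs_sub_abs_le_abs_sub 1 (g' (J (indC (cyl x k))))
  rw [abs_one] at this
  linarith

theorem exists_signs {ι κ : Type*} (s : Finset ι) (t : Finset κ) (M : κ → ι → ℝ) :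
    ∃ θ : ι → ℝ, (∀ i, |θ i| = 1) ∧
      ∑ j ∈ s, ∑ i ∈ t, M i j ^ 2 ≤ ∑ i ∈ t, (∑ j ∈ s, θ j * M i j) ^ 2 := by
  classical
  induction s using Finset.induction_on with
  | empty => exact ⟨fun _ => 1, by simp, by simp⟩
  | insert j s hj ih =>
    obtain ⟨θ, hθ, h⟩ := ih
    let D := ∑ i ∈ t, (∑ j ∈ s, θ j * M i j) * M i j
    obtain ⟨e, he, he2⟩ : ∃ e : ℝ, |e| = 1 ∧ 0 ≤ e * D := by
      rcases le_total 0 D with h | h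
      · exact ⟨1, by simp, by simpa using h⟩
      · exact ⟨-1, by simp, by simpa using h⟩
    refine ⟨Function.update θ j e, fun i => ?_, ?_⟩
    · by_cases hi : i = j
      · subst hi; simpa using he
      · simpa [hi] using hθ i
    · rw [Finset.sum_insert hj]
      have e1 : ∀ i, ∑ j' ∈ insert j s, Function.update θ j e j' * M i j' =
          e * M i j + ∑ j' ∈ s, θ j' * M i j' := by
        intro i
        rw [Finset.sum_insert hj, Function.update_self]
        congr 1
        refine Finset.sum_congr rfl fun j' hj' => ?_
        rw [Function.update_of_ne (fun h : j' = j => hj (h ▸ hj'))]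
      have e2 : e ^ 2 = 1 := by rw [← sq_abs, he]; norm_num
      have e3 : ∑ i ∈ t, (∑ j' ∈ insert j s, Function.update θ j e j' * M i j') ^ 2 =
          ∑ i ∈ t, M i j ^ 2 + 2 * (e * D) + ∑ i ∈ t, (∑ j' ∈ s, θ j' * M i j') ^ 2 := by
        have eD : 2 * (e * D) = ∑ i ∈ t, 2 * (e * ((∑ j ∈ s, θ j * M i j) * M i j)) := by
          simp only [D]
          rw [Finset.mul_sum, Finset.mul_sum]
        rw [eD, ← Finset.sum_add_distrib, ← Finset.sum_add_distrib]
        refine Finset.sum_congr rfl fun i _ => ?_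
        rw [e1]
        have : (e * M i j) ^ 2 = M i j ^ 2 := by rw [mul_pow, e2, one_mul]
        rw [add_sq, this]
        ring
      rw [e3]
      linarith

end PartFive

section PartSix

variable {E : Type*} [NormedAddCommGroup E] [NormedSpace ℝ E]
variable {u : ℕ → CantorC} {lc : (ℕ →₀ ℝ) →ₗ[ℝ] E}

/-- The part of a branch functional beyond level `L`. -/
noncomputable def tailF (lc : (ℕ →₀ ℝ) →ₗ[ℝ] E) (ec : ℕ → E →L[ℝ] ℝ) (L : ℕ) (σ : ℕ → ℕ)
    (g : E →L[ℝ] ℝ) : E →L[ℝ] ℝ :=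
  g - ∑ j ∈ Finset.range L, g (lc (Finsupp.single (tc σ j) 1)) • ec (tc σ j)

theorem tailF_seg (hn : ∀ a, ‖lc a‖ = tN u a) {ec : ℕ → E →L[ℝ] ℝ} (hec : ∀ k a, ec k (lc a) = a k)
    (L : ℕ) {σ : ℕ → ℕ} {g : E →L[ℝ] ℝ} (hg : BSupp lc σ g) (hg1 : ‖g‖ ≤ 1) (a : ℕ →₀ ℝ) :
    ∃ P : TSeg, P.br = σ ∧ L ≤ P.lo ∧ |tailF lc ec L σ g (lc a)| ≤ 2 * ‖segS u P a‖ := by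
  classical
  let T : ℕ → Prop := fun k => ∃ j, L ≤ j ∧ k = tc σ j
  let b := a.filter T
  have e1 : tailF lc ec L σ g (lc a) = g (lc b) := by
    let fl : (ℕ →₀ ℝ) →ₗ[ℝ] (ℕ →₀ ℝ) :=
      { toFun := fun a => a.filter T
        map_add' := fun _ _ => Finsupp.filter_add
        map_smul' := fun _ _ => Finsupp.filter_smul }
    have hfl : ∀ a, fl a = a.filter T := fun _ => rfl
    have hlin : (tailF lc ec L σ g).toLinearMap ∘ₗ lc = g.toLinearMap ∘ₗ lc ∘ₗ fl := by
      refine Finsupp.lhom_ext fun k c => ?_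
      simp only [LinearMap.comp_apply, ContinuousLinearMap.coe_coe, hfl]
      have hsum : tailF lc ec L σ g (lc (Finsupp.single k c)) = c * g (lc (Finsupp.single k 1)) -
          ∑ j ∈ Finset.range L, g (lc (Finsupp.single (tc σ j) 1)) *
            (Finsupp.single k c : ℕ →₀ ℝ) (tc σ j) := by
        have e : Finsupp.single k c = c • Finsupp.single k (1 : ℝ) := by simp
        have e2 : g (lc (Finsupp.single k c)) = c * g (lc (Finsupp.single k 1)) := by
          rw [e, map_smul, map_smul, smul_eq_mul]
        simp [tailF, e2, hec]
      rw [hsum]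
      by_cases hk : ∃ n, k = tc σ n
      · obtain ⟨n, rfl⟩ := hk
        by_cases hL : L ≤ n
        · rw [Finsupp.filter_single_of_pos _ (show T (tc σ n) from ⟨n, hL, rfl⟩), Finset.sum_eq_zero]
          · have e : Finsupp.single (tc σ n) c = c • Finsupp.single (tc σ n) (1 : ℝ) := by simp
            rw [e, map_smul, map_smul, smul_eq_mul, sub_zero]
          · intro j hj
            rw [Finsupp.single_eq_of_ne, mul_zero]
            intro h
            have := (tc_inj h).1
            have := Finset.mem_range.1 hj
            omega
        · rw [Finsupp.filter_single_of_neg, map_zero, map_zero,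
            Finset.sum_eq_single_of_mem n (Finset.mem_range.2 (by omega))]
          · rw [Finsupp.single_eq_same]; ring
          · intro j _ hj
            rw [Finsupp.single_eq_of_ne, mul_zero]
            exact fun h => hj (tc_inj h).1
          · rintro ⟨j, hj, h⟩
            have := (tc_inj h).1
            omega
      · push Not at hk
        rw [Finsupp.filter_single_of_neg, map_zero, map_zero, hg k hk, Finset.sum_eq_zero]
        · ring
        · intro j _
          rw [Finsupp.single_eq_of_ne (hk j).symm, mul_zero]
        · rintro ⟨j, -, h⟩
          exact hk j h
    exact LinearMap.congr_fun hlin a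
  have e2 : |g (lc b)| ≤ tN u b := by
    have h1 := g.le_opNorm (lc b)
    rw [hn] at h1
    have h2 := mul_le_mul_of_nonneg_right hg1 (tN_nonneg u b)
    rw [Real.norm_eq_abs] at h1
    linarith
  have e3 : ∀ p q, segS u ⟨σ, p, q⟩ b = segS u ⟨σ, max p L, q⟩ a := by
    intro p q
    rw [segS_apply, segS_apply]
    symm
    have hsub : Finset.Ico (max p L) q ⊆ Finset.Ico p q :=
      Finset.Ico_subset_Ico (le_max_left _ _) le_rfl
    rw [← Finset.sum_subset hsub]
    · refine Finset.sum_congr rfl fun j hj => ?_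
      have hj' := (Finset.mem_Ico.1 hj).1
      have : T (tc σ j) := ⟨j, (le_max_right _ _).trans hj', rfl⟩
      simp only [b]
      rw [Finsupp.filter_apply_pos _ _ this]
    · intro j hj hj2
      have : ¬ T (tc σ j) := by
        rintro ⟨i, hi, h⟩
        have hij := (tc_inj h).1
        refine hj2 (Finset.mem_Ico.2 ⟨max_le (Finset.mem_Ico.1 hj).1 ?_, (Finset.mem_Ico.1 hj).2⟩)
        change L ≤ j
        omega
      simp only [b]
      rw [Finsupp.filter_apply_neg _ _ this, zero_smul]
  by_contra hcon
  push Not at hcon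
  have h0 : ∀ p q, ‖segS u ⟨σ, p, q⟩ b‖ ≤ |g (lc b)| / 2 := by
    intro p q
    have := hcon ⟨σ, max p L, q⟩ rfl (le_max_right _ _)
    rw [e3]
    rw [e1] at this
    linarith
  have h1 := tN_branch u (σ := σ) (b := b) (fun k hk => by
    by_contra hne
    refine hk (Finsupp.filter_apply_neg _ _ ?_)
    rintro ⟨j, -, h⟩
    exact hne ⟨j, h⟩) h0
  have h2 := hcon ⟨σ, L, L⟩ rfl le_rfl
  rw [e1] at h2
  have := norm_nonneg (segS u ⟨σ, L, L⟩ a)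
  linarith

theorem branch_sep (s : Finset (ℕ → ℕ)) :
    ∃ L, ∀ x ∈ s, ∀ y ∈ s, x ≠ y → ∃ m, m ≤ L ∧ x m ≠ y m := by
  classical
  have : ∀ p : (ℕ → ℕ) × (ℕ → ℕ), ∃ N, p.1 ≠ p.2 → p.1 N ≠ p.2 N := by
    intro p
    by_cases h : p.1 = p.2
    · exact ⟨0, fun h' => absurd h h'⟩
    · obtain ⟨N, hN⟩ := Function.ne_iff.1 h
      exact ⟨N, fun _ => hN⟩
  choose N hN using this
  refine ⟨(s ×ˢ s).sup N, fun x hx y hy hne => ⟨N (x, y), ?_, hN (x, y) hne⟩⟩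
  exact Finset.le_sup (f := N) (Finset.mk_mem_product hx hy)

theorem cantor_not_countable : ¬ (Set.univ : Set CantorSet).Countable := by
  intro h
  obtain ⟨f, hf⟩ := h.exists_eq_range Set.univ_nonempty
  obtain ⟨n, hn⟩ : (fun n => !(f n n)) ∈ Set.range f := hf ▸ Set.mem_univ _
  have := congrFun hn n
  simp at this

/-- Many distinct branches are impossible. -/
theorem many_branches (hn : ∀ a, ‖lc a‖ = tN u a) (hd : DenseRange lc) {ec : ℕ → E →L[ℝ] ℝ}
    (hec : ∀ k a, ec k (lc a) = a k) (J : CantorC →L[ℝ] E) {ε : ℝ} (hε : 0 < ε)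
    (s : Finset (ℕ → ℕ)) (x : (ℕ → ℕ) → CantorSet) (g : (ℕ → ℕ) → E →L[ℝ] ℝ)
    (c : (ℕ → ℕ) → ℝ)
    (hx : ∀ τ ∈ s, ∀ τ' ∈ s, τ ≠ τ' → x τ ≠ x τ')
    (hg : ∀ τ ∈ s, BSupp lc τ (g τ)) (hg1 : ∀ τ ∈ s, ‖g τ‖ ≤ 1)
    (hc : ∀ τ ∈ s, Tendsto (fun k => g τ (J (indC (cyl (x τ) k)))) atTop (𝓝 (c τ)))
    (hcε : ∀ τ ∈ s, ε ≤ |c τ|)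
    (h0 : ∀ τ ∈ s, ∀ t, Tendsto (fun k => ec t (J (indC (cyl (x τ) k)))) atTop (𝓝 0)) :
    (s.card : ℝ) * (ε / 2) ^ 2 ≤ 4 * ‖J‖ ^ 2 := by
  classical
  obtain ⟨L, hL⟩ := branch_sep s
  let G : (ℕ → ℕ) → E →L[ℝ] ℝ := fun τ => tailF lc ec L τ (g τ)
  have hG : ∀ y : E, ∑ τ ∈ s, (G τ y) ^ 2 ≤ 4 * ‖y‖ ^ 2 := by
    intro y
    refine hd.induction_on (p := fun y => ∑ τ ∈ s, (G τ y) ^ 2 ≤ 4 * ‖y‖ ^ 2) y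
      (isClosed_le (by fun_prop) (by fun_prop)) fun a => ?_
    have h1 : ∀ τ, ∃ P : TSeg, τ ∈ s → P.br = τ ∧ L ≤ P.lo ∧ |G τ (lc a)| ≤ 2 * ‖segS u P a‖ := by
      intro τ
      by_cases hτ : τ ∈ s
      · obtain ⟨P, hP⟩ := tailF_seg hn hec L (hg τ hτ) (hg1 τ hτ) a
        exact ⟨P, fun _ => hP⟩
      · exact ⟨default, fun h => absurd h hτ⟩
    choose P hP using h1
    have h2 := fam_le_tN u s P (fun τ hτ τ' hτ' hne => by
      obtain ⟨m, hm, hm2⟩ := hL τ hτ τ' hτ' hne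
      refine ⟨m, hm.trans (hP τ hτ).2.1, hm.trans (hP τ' hτ').2.1, ?_⟩
      rw [(hP τ hτ).1, (hP τ' hτ').1]
      exact hm2) a
    rw [hn]
    refine le_trans ?_ (mul_le_mul_of_nonneg_left h2 (by norm_num : (0 : ℝ) ≤ 4))
    rw [Finset.mul_sum]
    refine Finset.sum_le_sum fun τ hτ => ?_
    have := pow_le_pow_left₀ (abs_nonneg _) (hP τ hτ).2.2 2
    rw [sq_abs, mul_pow] at this
    linarith
  have hlim : ∀ τ ∈ s, Tendsto (fun k => G τ (J (indC (cyl (x τ) k)))) atTop (𝓝 (c τ)) := by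
    intro τ hτ
    have h1 : Tendsto (fun k => ∑ j ∈ Finset.range L, g τ (lc (Finsupp.single (tc τ j) 1)) *
        ec (tc τ j) (J (indC (cyl (x τ) k)))) atTop (𝓝 0) := by
      have := tendsto_finsetSum (Finset.range L) (fun j _ =>
        (h0 τ hτ (tc τ j)).const_mul (g τ (lc (Finsupp.single (tc τ j) 1))))
      simpa using this
    have h2 := (hc τ hτ).sub h1
    rw [sub_zero] at h2
    refine h2.congr fun k => ?_
    simp [G, tailF]
  obtain ⟨N, hN⟩ := cyl_sep (s.image x)
  have hev : ∀ᶠ k in atTop, ∀ τ ∈ s, ε / 2 < |G τ (J (indC (cyl (x τ) k)))| := by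
    rw [Filter.eventually_all_finset]
    intro τ hτ
    exact (hlim τ hτ).abs.eventually (lt_mem_nhds (by have := hcε τ hτ; linarith))
  obtain ⟨k, hk1, hk2⟩ := (hev.and (eventually_ge_atTop N)).exists
  obtain ⟨θ, hθ, hs⟩ := exists_signs s s (fun i j => G i (J (indC (cyl (x j) k))))
  let f : CantorC := ∑ j ∈ s, θ j • indC (cyl (x j) k)
  have hf : ‖f‖ ≤ 1 := by
    rw [ContinuousMap.norm_le _ zero_le_one]
    intro t
    simp only [f, ContinuousMap.coe_sum, Finset.sum_apply, ContinuousMap.coe_smul, Pi.smul_apply]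
    by_cases h : ∃ i ∈ s, t ∈ cyl (x i) k
    · obtain ⟨i, hi, hix⟩ := h
      rw [Finset.sum_eq_single_of_mem i hi]
      · rw [indC_mem (cyl_clopen _ _) hix, smul_eq_mul, mul_one, Real.norm_eq_abs, hθ]
      · intro j hj hne
        rw [indC_not_mem (hN (x i) (Finset.mem_image_of_mem x hi) (x j) (Finset.mem_image_of_mem x hj)
          (hx i hi j hj hne.symm) k hk2 t hix), smul_zero]
    · push Not at h
      rw [Finset.sum_eq_zero fun i hi => by rw [indC_not_mem (h i hi), smul_zero]]
      simp
  have h1 := hG (J f)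
  have h2 : ∀ i, G i (J f) = ∑ j ∈ s, θ j * G i (J (indC (cyl (x j) k))) := by
    intro i; simp [f]
  simp only [h2] at h1
  have h3 : ‖J f‖ ^ 2 ≤ ‖J‖ ^ 2 := by
    refine pow_le_pow_left₀ (norm_nonneg _) ?_ 2
    have := (J.le_opNorm f).trans (mul_le_mul_of_nonneg_left hf (norm_nonneg J))
    linarith
  have h4 : (s.card : ℝ) * (ε / 2) ^ 2 ≤ ∑ j ∈ s, ∑ i ∈ s, G i (J (indC (cyl (x j) k))) ^ 2 := by
    rw [← nsmul_eq_mul]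
    refine Finset.card_nsmul_le_sum _ _ _ fun j hj => ?_
    have h5 : G j (J (indC (cyl (x j) k))) ^ 2 ≤ ∑ i ∈ s, G i (J (indC (cyl (x j) k))) ^ 2 :=
      Finset.single_le_sum (f := fun i => G i (J (indC (cyl (x j) k))) ^ 2)
        (fun i _ => sq_nonneg _) hj
    refine le_trans ?_ h5
    rw [← sq_abs (G j _)]
    exact pow_le_pow_left₀ (by positivity) (hk1 j hj).le 2
  linarith

/-- An uncountable family of non-null functionals supported by one branch. -/
theorem one_branch {F : Type*} [NormedAddCommGroup F] [NormedSpace ℝ F] (J : CantorC →L[ℝ] E)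
    {S : CantorSet → ℕ → ℕ} {g : CantorSet → E →L[ℝ] ℝ} (hgS : ∀ x, BSupp lc (S x) (g x))
    (hg1 : ∀ x, ‖g x‖ ≤ 1) {lim : CantorSet → ℝ}
    (hlim : ∀ x, Tendsto (fun k => ((g x).comp J) (indC (cyl x k))) atTop (𝓝 (lim x)))
    {ε : ℝ} (hε : 0 < ε) {V : Set CantorSet} (hV : ¬ V.Countable) (hVε : ∀ y ∈ V, ε ≤ |lim y|)
    {σ : ℕ → ℕ} (hVσ : ∀ y ∈ V, S y = σ) (I : F →L[ℝ] E) (R : E →L[ℝ] F)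
    (hIR : ∀ g : E →L[ℝ] ℝ, BSupp lc σ g → g = g.comp (I.comp R)) : Embeds CantorC F := by
  obtain ⟨Q, hQ⟩ := exists_Q _ hV (fun y => (g y).comp J) (C := ‖J‖) (ε := ε) (fun y _ => by
    refine ((g y).opNorm_comp_le J).trans ?_
    have := mul_le_mul_of_nonneg_right (hg1 y) (norm_nonneg J)
    linarith) lim (fun y _ => hlim y) hε hVε
  refine ⟨R.comp (J.comp Q), ε / 2 / (‖I‖ + 1), by positivity, fun h => ?_⟩
  have h1 := hQ h (‖I‖ * ‖R (J (Q h))‖) (fun y hy => by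
    have h2 := hIR (g y) (hVσ y hy ▸ hgS y)
    have h3 : (g y) (J (Q h)) = (g y) (I (R (J (Q h)))) := by
      conv_lhs => rw [h2]
      rfl
    rw [ContinuousLinearMap.comp_apply, h3]
    have h4 := (g y).le_opNorm (I (R (J (Q h))))
    have h5 := mul_le_mul_of_nonneg_right (hg1 y) (norm_nonneg (I (R (J (Q h)))))
    have h6 := I.le_opNorm (R (J (Q h)))
    rw [Real.norm_eq_abs] at h4
    linarith)
  rw [div_mul_eq_mul_div, div_le_iff₀ (by positivity)]
  have h7 : 0 ≤ ‖R (J (Q h))‖ := norm_nonneg _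
  change ε / 2 * ‖h‖ ≤ ‖R (J (Q h))‖ * (‖I‖ + 1)
  linarith

theorem not_universal_E [CompleteSpace E] (hn : ∀ a, ‖lc a‖ = tN u a) (hd : DenseRange lc)
    (hu0 : ∀ k, u k ≠ 0)
    (hT : ∀ σ, ∃ Y : SB, ¬ Embeds CantorC Y.1 ∧ TRel u σ Y) : ¬ Embeds CantorC E := by
  rintro ⟨J, c, hc, hJ⟩
  -- coordinate functionals
  have hec : ∀ k, ∃ e : E →L[ℝ] ℝ, ∀ a, e (lc a) = a k := by
    intro k
    obtain ⟨e, he, -⟩ := lc_extend hn hd (Finsupp.lapply k) (‖u k‖⁻¹) (fun a => by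
      have h1 := segS_le_tN u ⟨nbr k, nlv k, nlv k + 1⟩ a
      rw [segS_apply] at h1
      simp only [Nat.Ico_succ_singleton, Finset.sum_singleton, tc_nbr_nlv, norm_smul] at h1
      have h2 := norm_pos_iff.2 (hu0 k)
      rw [inv_mul_eq_div, le_div_iff₀ h2]
      exact h1)
    exact ⟨e, he⟩
  choose ec hec using hec
  choose S g hgS hg1 hgn using exists_branch_nonnull hn hd J hc hJ
  choose lim hlim using fun x => cyl_lim_exists ((g x).comp J) x
  have hlim0 : ∀ x, lim x ≠ 0 := fun x h => hgn x (h ▸ hlim x)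
  let D : Set CantorSet := {x | ∀ t, Tendsto (fun k => ec t (J (indC (cyl x k)))) atTop (𝓝 0)}
  have hD : ¬ D.Countable := by
    intro h
    refine cantor_not_countable ((h.union (Set.countable_iUnion fun t =>
      cyl_lim_countable ((ec t).comp J))).mono fun x _ => ?_)
    by_cases hx : x ∈ D
    · exact Or.inl hx
    · right
      have hx2 : ¬ ∀ t, Tendsto (fun k => ec t (J (indC (cyl x k)))) atTop (𝓝 0) := hx
      push Not at hx2
      obtain ⟨t, ht⟩ := hx2
      exact Set.mem_iUnion.2 ⟨t, ht⟩
  obtain ⟨m, hm⟩ := exists_uncountable_nat hD (fun x m => 1 / ((m : ℝ) + 1) ≤ |lim x|)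
    (fun x _ => by
      obtain ⟨m, hm⟩ := exists_nat_one_div_lt (abs_pos.2 (hlim0 x))
      exact ⟨m, hm.le⟩)
  have hε : (0 : ℝ) < 1 / ((m : ℝ) + 1) := by positivity
  generalize 1 / ((m : ℝ) + 1) = ε at hm hε
  let W : Set CantorSet := {w | w ∈ D ∧ ε ≤ |lim w|}
  have hW : ¬ W.Countable := hm
  by_cases hfib : ∃ σ, ¬ {x | x ∈ W ∧ S x = σ}.Countable
  · obtain ⟨σ, hσ⟩ := hfib
    obtain ⟨Y, hYn, hY⟩ := hT σ
    obtain ⟨I, R, -, hIR⟩ := exists_IR hn hd hY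
    exact hYn (one_branch J hgS hg1 hlim hε hσ (fun y hy => hy.1.2) (fun y hy => hy.2) I R hIR)
  · push Not at hfib
    have hinf : (S '' W).Infinite := by
      intro hfin
      refine hW ((hfin.countable.biUnion fun σ _ => hfib σ).mono fun x hx => ?_)
      exact Set.mem_iUnion₂.2 ⟨S x, Set.mem_image_of_mem S hx, hx, rfl⟩
    obtain ⟨n, hnn⟩ := exists_nat_gt (4 * ‖J‖ ^ 2 / (ε / 2) ^ 2)
    obtain ⟨s, hs, hcard⟩ := Set.Infinite.exists_subset_card_eq hinf n
    have hx : ∀ τ, ∃ x, τ ∈ s → x ∈ W ∧ S x = τ := by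
      intro τ
      by_cases hτ : τ ∈ s
      · obtain ⟨x, hx, hx2⟩ := hs hτ
        exact ⟨x, fun _ => ⟨hx, hx2⟩⟩
      · exact ⟨fun _ => false, fun h => absurd h hτ⟩
    choose x hx using hx
    have h1 := many_branches hn hd hec J hε s x (fun τ => g (x τ)) (fun τ => lim (x τ))
      (fun τ hτ τ' hτ' hne h => hne (by rw [← (hx τ hτ).2, ← (hx τ' hτ').2, h]))
      (fun τ hτ => by
        have := hgS (x τ)
        rwa [(hx τ hτ).2] at this)
      (fun τ _ => hg1 _) (fun τ _ => hlim _) (fun τ hτ => (hx τ hτ).1.2) (fun τ hτ => (hx τ hτ).1.1)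
    rw [hcard] at h1
    rw [div_lt_iff₀ (by positivity)] at hnn
    linarith

theorem complemented_aux [CompleteSpace E] (hn : ∀ a, ‖lc a‖ = tN u a) (hd : DenseRange lc)
    {σ : ℕ → ℕ} {Y : SB} (hY : TRel u σ Y) :
    ∃ (I : Y.1 →L[ℝ] E) (R : E →L[ℝ] Y.1), R.comp I = ContinuousLinearMap.id ℝ Y.1 := by
  obtain ⟨I, R, hIR, -⟩ := exists_IR hn hd hY
  exact ⟨I, R, hIR⟩

theorem complemented_sub {Z : Submodule ℝ CantorC} [CompleteSpace Z] {e : (ℕ →₀ ℝ) →ₗ[ℝ] Z}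
    (hn : ∀ a, ‖e a‖ = tN u a) (hden : DenseRange e) {σ : ℕ → ℕ} {Y : SB} (hY : TRel u σ Y) :
    ∃ (I : Y.1 →L[ℝ] Z) (R : Z →L[ℝ] Y.1), R.comp I = ContinuousLinearMap.id ℝ Y.1 := by
  have h := @complemented_aux Z _ _ u e _
  have h2 := @h hn
  have h3 := @h2 hden σ Y
  exact h3 hY

theorem final_aux (A : Set SB) (hA : IsAnalyticIn A)
    (hAprop : ∀ Y ∈ A, ¬ Embeds CantorC ↥Y.1 ∧ HasSchauderBasis ↥Y.1) :
    ∃ Z : Submodule ℝ CantorC, IsClosed (Z : Set CantorC) ∧ ¬ Embeds CantorC ↥Z ∧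
      HasSchauderBasis ↥Z ∧
      ∀ Y ∈ A, ∃ (f : ↥Y.1 →L[ℝ] ↥Z) (g : ↥Z →L[ℝ] ↥Y.1),
        g.comp f = ContinuousLinearMap.id ℝ ↥Y.1 := by
  classical
  obtain ⟨u, hu1, hu2⟩ := exists_tree_param A hA (fun Y hY => (hAprop Y hY).2)
  have hu0 : ∀ k, u k ≠ 0 := by
    intro k
    obtain ⟨σ, n, rfl⟩ := tc_surj k
    obtain ⟨Y, -, x, K, hYx, h0, -⟩ := hu1 σ
    exact h0 n
  obtain ⟨z, hz⟩ := exists_realisation (tSN u)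
  obtain ⟨Z, hZ⟩ : ∃ Z : Submodule ℝ CantorC,
    Z = (Submodule.span ℝ (Set.range z)).topologicalClosure := ⟨_, rfl⟩
  have hZc : IsClosed (Z : Set CantorC) := by
    rw [hZ]; exact Submodule.isClosed_topologicalClosure _
  have hcomp : CompleteSpace Z := hZc.completeSpace_coe
  have hmem : ∀ i, z i ∈ Z := fun i => by
    rw [hZ]; exact Submodule.le_topologicalClosure _ (Submodule.subset_span ⟨i, rfl⟩)
  let e : (ℕ →₀ ℝ) →ₗ[ℝ] Z := Finsupp.linearCombination ℝ (fun i => (⟨z i, hmem i⟩ : Z))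
  have he : ∀ a, (e a : CantorC) = Finsupp.linearCombination ℝ z a := by
    intro a
    simp [e, Finsupp.linearCombination_apply, Finsupp.sum]
  have hden : DenseRange e := by
    intro y
    rw [Topology.IsInducing.subtypeVal.closure_eq_preimage_closure_image]
    rw [Set.mem_preimage]
    have hy : (y : CantorC) ∈ (Submodule.span ℝ (Set.range z)).topologicalClosure := hZ ▸ y.2
    rw [← SetLike.mem_coe, Submodule.topologicalClosure_coe] at hy
    convert hy using 2
    ext w
    rw [SetLike.mem_coe, Finsupp.mem_span_range_iff_exists_finsupp]
    constructor
    · rintro ⟨_, ⟨a, rfl⟩, rfl⟩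
      exact ⟨a, (he a).symm ▸ rfl⟩
    · rintro ⟨a, ha⟩
      exact ⟨e a, ⟨a, rfl⟩, (he a).trans ha⟩
  have hn : ∀ a, ‖e a‖ = tN u a := by
    intro a
    rw [← tSN_apply, ← hz a, ← he a]
    rfl
  clear_value e
  refine ⟨Z, hZc, ?_, ?_, ?_⟩
  · exact not_universal_E hn hden hu0 (fun σ => by
      obtain ⟨Y, hY, hr⟩ := hu1 σ
      exact ⟨Y, (hAprop Y hY).1, hr⟩)
  · refine schauder_of_const (x := z) (K := 1) ?_ ?_ Z hZ
    · intro n h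
      have h1 := hz (Finsupp.single n 1)
      rw [Finsupp.linearCombination_single, h, smul_zero, norm_zero, tSN_apply] at h1
      exact absurd h1 (tN_single_pos u (hu0 n)).ne
    · intro a n m hnm
      let b : ℕ →₀ ℝ := ∑ i ∈ Finset.range m, Finsupp.single i (a i)
      have hb : Finsupp.linearCombination ℝ z b = ∑ i ∈ Finset.range m, a i • z i := by
        simp [b, map_sum]
      have hbf : b.filter (· < n) = ∑ i ∈ Finset.range n, Finsupp.single i (a i) := by
        ext k
        simp only [b, Finsupp.filter_apply, Finsupp.finsetSum_apply, Finsupp.single_apply,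
          Finset.sum_ite_eq', Finset.mem_range]
        split_ifs <;> first | rfl | omega
      have hb2 : Finsupp.linearCombination ℝ z (b.filter (· < n)) =
          ∑ i ∈ Finset.range n, a i • z i := by
        rw [hbf]; simp [map_sum]
      rw [one_mul, ← hb, ← hb2, hz, hz, tSN_apply, tSN_apply]
      refine tN_filter u (· < n) (fun τ => ⟨fun i _ j hj k hk => ?_⟩) b
      exact lt_of_le_of_lt ((tc_strictMono τ).monotone hk.2) hj
  · intro Y hY
    obtain ⟨σ, hσ⟩ := hu2 Y hY
    exact complemented_sub hn hden hσ

end PartSix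

/-- **Theorem (Argyros-Dodos).** Let `A` be an analytic subset of `SB` such that every
`Y ∈ A` is non-universal and has a Schauder basis. Then there is a non-universal space
`Z` with a Schauder basis containing every `Y ∈ A` as a complemented subspace. -/
theorem nonuniversal_basis_strongly_bounded_complemented (A : Set SB)
    (hA : IsAnalyticIn A)
    (hAprop : ∀ Y ∈ A, ¬ Embeds CantorC ↥Y.1 ∧ HasSchauderBasis ↥Y.1) :
    ∃ Z : SB, ¬ Embeds CantorC ↥Z.1 ∧ HasSchauderBasis ↥Z.1 ∧
      ∀ Y ∈ A, ∃ (f : ↥Y.1 →L[ℝ] ↥Z.1) (g : ↥Z.1 →L[ℝ] ↥Y.1),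
        g.comp f = ContinuousLinearMap.id ℝ ↥Y.1 := by
  obtain ⟨Z, hZc, h1, h2, h3⟩ := final_aux A hA hAprop
  exact ⟨⟨Z, hZc⟩, h1, h2, h3⟩
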